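/- arXiv:1610.06820 — 2 statements merged into one kernel-verified Lean document; each statement's English description precedes it below -/
import Mathlib

section
/- Let m ≥ 1 be an integer, w₀(x) := log(2/(1+|x|²)) on ℝ^{2m}, and K, f : ℝ^{2m} → ℝ measurable with K ≥ 0, K ≢ 0, K e^{−2m w₀} ∈ L^∞(ℝ^{2m}), f e^{−2m w₀} ∈ L^∞(ℝ^{2m}), and Λ := ∫_{ℝ^{2m}} f dx ∈ (0, Λ₁). Suppose moreover f = (−Δ)^m g for some g ∈ C^{2m}(ℝ^{2m}) with g(x) = O(log|x|) as |x| → ∞. Then any function w ∈ C^{2m−1}(ℝ^{2m}) with c_w ∈ ℝ satisfying (−Δ)^m w = K e^{2m(w + c_w)} − f in the distributional sense, ∫_{ℝ^{2m}} K e^{2m(w + c_w)} dx = Λ, and lim_{|x|→∞} w(x) finite, satisfies the representation formula w(x) = γ_{2m}^{−1} ∫_{ℝ^{2m}} log((1+|y|)/|x−y|) K(y) e^{2m(w(y)+c_w)} dy − g(x) + C for some constant C ∈ ℝ. -/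
noncomputable section

open MeasureTheory Real Filter Topology Metric Set Bornology

/-- Euclidean space `ℝ^{2m}`. -/
abbrev Euc (m : ℕ) : Type := EuclideanSpace ℝ (Fin (2*m))

/-- Pointwise Laplacian `Δ f (x) = ∑ ∂²f/∂xᵢ²`. -/
def lap {m : ℕ} (f : Euc m → ℝ) (x : Euc m) : ℝ :=
  ∑ i : Fin (2*m),
    fderiv ℝ (fun y => fderiv ℝ f y (EuclideanSpace.single i (1:ℝ))) x
      (EuclideanSpace.single i (1:ℝ))

/-- `(−Δ)^j f`, pointwise. -/
def negLapPow {m : ℕ} (j : ℕ) (f : Euc m → ℝ) : Euc m → ℝ :=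
  (fun g x => -(lap g x))^[j] f

/-- Smooth test functions compactly supported inside `Ω`. -/
def IsTestOn {m : ℕ} (Ω : Set (Euc m)) (ψ : Euc m → ℝ) : Prop :=
  ContDiff ℝ (⊤ : ℕ∞) ψ ∧ HasCompactSupport ψ ∧ tsupport ψ ⊆ Ω

/-- `u` solves `(−Δ)^m u = V e^{2mu}` on `Ω` in the distributional sense. -/
def SolvesQ {m : ℕ} (Ω : Set (Euc m)) (V u : Euc m → ℝ) : Prop :=
  ∀ ψ : Euc m → ℝ, IsTestOn Ω ψ →
    ∫ x in Ω, u x * negLapPow m ψ x = ∫ x in Ω, V x * Real.exp ((2*m : ℝ) * u x) * ψ x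

/-- Volume of the standard unit `n`-sphere: `2 π^{(n+1)/2} / Γ((n+1)/2)`. -/
def sphereVol (n : ℕ) : ℝ :=
  2 * Real.pi ^ (((n : ℝ) + 1)/2) / Real.Gamma (((n : ℝ) + 1)/2)

/-- `Λ₁ = (2m−1)! vol(S^{2m})`. -/
def Lambda1 (m : ℕ) : ℝ := (Nat.factorial (2*m - 1) : ℝ) * sphereVol (2*m)

/-- `γ_{2m} = Λ₁/2`. -/
def gamma2m (m : ℕ) : ℝ := Lambda1 m / 2

/-- The class `K(Ω,∅)`: smooth, nonpositive, not identically zero, `Δ^m φ ≡ 0` on `Ω`. -/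
def memK {m : ℕ} (Ω : Set (Euc m)) (φ : Euc m → ℝ) : Prop :=
  ContDiffOn ℝ (⊤ : ℕ∞) φ Ω ∧ (∀ x ∈ Ω, φ x ≤ 0) ∧ (∃ x ∈ Ω, φ x ≠ 0) ∧
    ∀ x ∈ Ω, negLapPow m φ x = 0

/-- `S_φ = {x ∈ Ω : φ(x) = 0}`. -/
def Sphi {m : ℕ} (Ω : Set (Euc m)) (φ : Euc m → ℝ) : Set (Euc m) :=
  {x | x ∈ Ω ∧ φ x = 0}

/-- `S_φ^* = S_φ ∪ {x ∈ ∂Ω : lim_{Ω ∋ y → x} φ(y) = 0}`. -/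
def SphiStar {m : ℕ} (Ω : Set (Euc m)) (φ : Euc m → ℝ) : Set (Euc m) :=
  Sphi Ω φ ∪ {x | x ∈ frontier Ω ∧ Tendsto φ (𝓝[Ω] x) (𝓝 0)}

/-- `u_k → +∞` locally uniformly on `S`. -/
def LocUnifTop {m : ℕ} (u : ℕ → Euc m → ℝ) (S : Set (Euc m)) : Prop :=
  ∀ K : Set (Euc m), K ⊆ S → IsCompact K → ∀ C : ℝ,
    ∀ᶠ k in atTop, ∀ x ∈ K, C ≤ u k x

/-- `u_k → −∞` locally uniformly on `S`. -/
def LocUnifBot {m : ℕ} (u : ℕ → Euc m → ℝ) (S : Set (Euc m)) : Prop :=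
  ∀ K : Set (Euc m), K ⊆ S → IsCompact K → ∀ C : ℝ,
    ∀ᶠ k in atTop, ∀ x ∈ K, u k x ≤ C

section part1
variable {m : ℕ}

lemma lap_congr {f g : Euc m → ℝ} {x : Euc m} (h : f =ᶠ[𝓝 x] g) : lap f x = lap g x := by
  unfold lap
  refine Finset.sum_congr rfl fun i _ => ?_
  have h1 := h.fderiv (𝕜 := ℝ)
  have h2 : (fun y => fderiv ℝ f y (EuclideanSpace.single i (1:ℝ))) =ᶠ[𝓝 x]
      (fun y => fderiv ℝ g y (EuclideanSpace.single i (1:ℝ))) := by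
    filter_upwards [h1] with y hy
    rw [hy]
  rw [h2.fderiv_eq]

lemma contDiff_pd {k : ℕ} {f : Euc m → ℝ} (hf : ContDiff ℝ ((k + 1 : ℕ)) f) (v : Euc m) :
    ContDiff ℝ k (fun y => fderiv ℝ f y v) :=
  (hf.fderiv_right (m := k) (by norm_cast)).clm_apply contDiff_const

lemma contDiff_lap {k : ℕ} {f : Euc m → ℝ} (hf : ContDiff ℝ ((k + 2 : ℕ)) f) :
    ContDiff ℝ k (lap f) := by
  unfold lap
  exact ContDiff.sum fun i _ => contDiff_pd (contDiff_pd hf _) _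

lemma contDiff_lap_top {f : Euc m → ℝ} (hf : ContDiff ℝ (⊤ : ℕ∞) f) :
    ContDiff ℝ (⊤ : ℕ∞) (lap f) := by
  rw [contDiff_infty] at hf ⊢
  intro k
  exact contDiff_lap (hf (k+2))

lemma lap_const (a : ℝ) : lap (fun _ : Euc m => a) = fun _ => 0 := by
  funext x
  simp [lap]

lemma lap_sub {f g : Euc m → ℝ} (hf : ContDiff ℝ 2 f) (hg : ContDiff ℝ 2 g) :
    lap (fun x => f x - g x) = fun x => lap f x - lap g x := by
  funext x
  unfold lap
  rw [← Finset.sum_sub_distrib]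
  refine Finset.sum_congr rfl fun i _ => ?_
  have h1 : ∀ y, fderiv ℝ (fun x => f x - g x) y = fderiv ℝ f y - fderiv ℝ g y := fun y =>
    fderiv_fun_sub (hf.differentiable (by norm_num) y) (hg.differentiable (by norm_num) y)
  simp only [h1, _root_.sub_apply]
  rw [fderiv_fun_sub]
  · rfl
  · exact (contDiff_pd (k := 1) hf _).differentiable (by norm_num) x
  · exact (contDiff_pd (k := 1) hg _).differentiable (by norm_num) x

lemma lap_zero_of_notMem {f : Euc m → ℝ} {x : Euc m} (hx : x ∉ tsupport f) : lap f x = 0 := by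
  have := lap_congr (notMem_tsupport_iff_eventuallyEq.mp hx)
  rw [this]
  have h := congrFun (lap_const (m := m) 0) x
  exact h

lemma hcs_lap {f : Euc m → ℝ} (hf : HasCompactSupport f) : HasCompactSupport (lap f) :=
  HasCompactSupport.intro hf fun _ hx => lap_zero_of_notMem hx

lemma lap_affine {f : Euc m → ℝ} (hf : ContDiff ℝ 2 f) (z : Euc m) (R : ℝ) (x : Euc m) :
    lap (fun u => f (z + R • u)) x = R ^ 2 * lap f (z + R • x) := by
  have key : ∀ (F : Euc m → ℝ), Differentiable ℝ F → ∀ y v,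
      fderiv ℝ (fun u => F (z + R • u)) y v = R * fderiv ℝ F (z + R • y) v := by
    intro F hF y v
    have h1 : HasFDerivAt (fun u : Euc m => z + R • u) (R • ContinuousLinearMap.id ℝ (Euc m)) y :=
      ((hasFDerivAt_id y).const_smul R).const_add z
    have h2 := (hF (z + R • y)).hasFDerivAt.comp y h1
    have h3 := h2.fderiv
    have h4 : (F ∘ fun u => z + R • u) = fun u => F (z + R • u) := rfl
    rw [h4] at h3
    rw [h3]
    simp
  unfold lap
  rw [Finset.mul_sum]
  refine Finset.sum_congr rfl fun i _ => ?_
  simp only [key f (hf.differentiable (by norm_num))]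
  have hd : Differentiable ℝ (fun y => fderiv ℝ f y (EuclideanSpace.single i (1:ℝ))) :=
    (contDiff_pd (k := 1) hf _).differentiable (by norm_num)
  have hd2 : Differentiable ℝ
      (fun u => fderiv ℝ f (z + R • u) (EuclideanSpace.single i (1:ℝ))) :=
    hd.comp (by fun_prop)
  rw [fderiv_const_mul (hd2 x)]
  rw [_root_.smul_apply, key _ hd]
  simp; ring

lemma lap_ibp {f ψ : Euc m → ℝ} (hf : ContDiff ℝ 2 f) (hψ : ContDiff ℝ 2 ψ)
    (hc : HasCompactSupport ψ) : ∫ x, f x * lap ψ x = ∫ x, lap f x * ψ x := by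
  have hcont2 : ∀ (F : Euc m → ℝ), ContDiff ℝ 2 F → ∀ i : Fin (2*m),
      Continuous (fun x => fderiv ℝ (fun y => fderiv ℝ F y (EuclideanSpace.single i (1:ℝ))) x
      (EuclideanSpace.single i (1:ℝ))) := fun F hF i =>
    (contDiff_pd (k := 0) (contDiff_pd (k := 1) hF _) _).continuous
  have hcont1 : ∀ (F : Euc m → ℝ), ContDiff ℝ 2 F → ∀ i : Fin (2*m),
      Continuous (fun x => fderiv ℝ F x (EuclideanSpace.single i (1:ℝ))) := fun F hF i =>
    (contDiff_pd (k := 1) hF _).continuous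
  have hd1 : ∀ (F : Euc m → ℝ), ContDiff ℝ 2 F → ∀ i : Fin (2*m),
      Differentiable ℝ (fun x => fderiv ℝ F x (EuclideanSpace.single i (1:ℝ))) := fun F hF i =>
    (contDiff_pd (k := 1) hF _).differentiable (by norm_num)
  have hc1 : ∀ i : Fin (2*m), HasCompactSupport
      (fun x => fderiv ℝ ψ x (EuclideanSpace.single i (1:ℝ))) := fun i =>
    hc.fderiv_apply (𝕜 := ℝ) _
  have hc2 : ∀ i : Fin (2*m), HasCompactSupport
      (fun x => fderiv ℝ (fun y => fderiv ℝ ψ y (EuclideanSpace.single i (1:ℝ))) x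
      (EuclideanSpace.single i (1:ℝ))) := fun i =>
    (hc1 i).fderiv_apply (𝕜 := ℝ) _
  unfold lap
  simp only [Finset.mul_sum, Finset.sum_mul]
  have I1 : ∀ i, Integrable (fun x => f x * fderiv ℝ (fun y => fderiv ℝ ψ y (EuclideanSpace.single i (1:ℝ))) x
      (EuclideanSpace.single i (1:ℝ))) := fun i =>
    (hf.continuous.mul (hcont2 ψ hψ i)).integrable_of_hasCompactSupport (hc2 i).mul_left
  have I2 : ∀ i, Integrable (fun x => fderiv ℝ (fun y => fderiv ℝ f y (EuclideanSpace.single i (1:ℝ))) x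
      (EuclideanSpace.single i (1:ℝ)) * ψ x) := fun i =>
    ((hcont2 f hf i).mul hψ.continuous).integrable_of_hasCompactSupport hc.mul_left
  have I3 : ∀ i : Fin (2*m), Integrable (fun x => fderiv ℝ f x (EuclideanSpace.single i (1:ℝ)) *
      fderiv ℝ ψ x (EuclideanSpace.single i (1:ℝ))) := fun i =>
    ((hcont1 f hf i).mul (hcont1 ψ hψ i)).integrable_of_hasCompactSupport (hc1 i).mul_left
  have I4 : ∀ i : Fin (2*m), Integrable (fun x => f x *
      fderiv ℝ ψ x (EuclideanSpace.single i (1:ℝ))) := fun i =>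
    (hf.continuous.mul (hcont1 ψ hψ i)).integrable_of_hasCompactSupport (hc1 i).mul_left
  have I5 : ∀ i : Fin (2*m), Integrable (fun x => fderiv ℝ f x (EuclideanSpace.single i (1:ℝ)) *
      ψ x) := fun i =>
    ((hcont1 f hf i).mul hψ.continuous).integrable_of_hasCompactSupport hc.mul_left
  rw [integral_finsetSum _ fun i _ => I1 i, integral_finsetSum _ fun i _ => I2 i]
  refine Finset.sum_congr rfl fun i _ => ?_
  rw [integral_mul_fderiv_eq_neg_fderiv_mul_of_integrable (I3 i) (I1 i) (I4 i)
    (fun x _ => hf.differentiable (by norm_num) x) (fun x _ => hd1 ψ hψ i x)]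
  rw [integral_mul_fderiv_eq_neg_fderiv_mul_of_integrable (I2 i) (I3 i) (I5 i)
    (fun x _ => hd1 f hf i x) (fun x _ => hψ.differentiable (by norm_num) x), neg_neg]

lemma nlp_succ (j : ℕ) (f : Euc m → ℝ) :
    negLapPow (j+1) f = negLapPow j (fun x => -(lap f x)) := rfl

lemma nlp_succ' (j : ℕ) (f : Euc m → ℝ) :
    negLapPow (j+1) f = fun x => -(lap (negLapPow j f) x) := by
  unfold negLapPow
  rw [Function.iterate_succ_apply']

lemma nlp_smooth (j : ℕ) {f : Euc m → ℝ} (hf : ContDiff ℝ (⊤ : ℕ∞) f) :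
    ContDiff ℝ (⊤ : ℕ∞) (negLapPow j f) := by
  induction j with
  | zero => exact hf
  | succ j ih => rw [nlp_succ']; exact (contDiff_lap_top ih).neg

lemma nlp_hcs (j : ℕ) {f : Euc m → ℝ} (hf : HasCompactSupport f) :
    HasCompactSupport (negLapPow j f) := by
  induction j with
  | zero => exact hf
  | succ j ih => 
    rw [nlp_succ']
    exact (hcs_lap ih).comp_left (g := fun t => -t) neg_zero

lemma smooth2 {f : Euc m → ℝ} (hf : ContDiff ℝ (⊤ : ℕ∞) f) : ContDiff ℝ 2 f :=
  (contDiff_infty.mp hf 2)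

lemma nlp_sub (j : ℕ) {f g : Euc m → ℝ} (hf : ContDiff ℝ (⊤ : ℕ∞) f)
    (hg : ContDiff ℝ (⊤ : ℕ∞) g) :
    negLapPow j (fun x => f x - g x) = fun x => negLapPow j f x - negLapPow j g x := by
  induction j with
  | zero => rfl
  | succ j ih =>
    simp only [nlp_succ', ih]
    rw [lap_sub (smooth2 (nlp_smooth j hf)) (smooth2 (nlp_smooth j hg))]
    funext x; ring

lemma nlp_const (j : ℕ) (hj : 1 ≤ j) (a : ℝ) : negLapPow j (fun _ : Euc m => a) = fun _ => 0 := by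
  induction j, hj using Nat.le_induction with
  | base => rw [nlp_succ', negLapPow, Function.iterate_zero, id, lap_const]; simp
  | succ j hj ih => rw [nlp_succ', ih, lap_const]; simp

lemma nlp_affine (j : ℕ) {f : Euc m → ℝ} (hf : ContDiff ℝ (⊤ : ℕ∞) f) (z : Euc m) (R : ℝ) :
    negLapPow j (fun u => f (z + R • u)) = fun x => R ^ (2*j) * negLapPow j f (z + R • x) := by
  induction j with
  | zero => simp [negLapPow]
  | succ j ih =>
    simp only [nlp_succ', ih]
    funext x
    have hs := smooth2 (nlp_smooth j hf)
    have : lap (fun x => R ^ (2*j) * negLapPow j f (z + R • x)) x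
        = R ^ (2*j) * lap (fun x => negLapPow j f (z + R • x)) x := by
      unfold lap
      rw [Finset.mul_sum]
      refine Finset.sum_congr rfl fun i _ => ?_
      have hs' : ContDiff ℝ 2 (fun x => negLapPow j f (z + R • x)) :=
        hs.comp (by fun_prop)
      have h1 : ∀ y, fderiv ℝ (fun x => R ^ (2*j) * negLapPow j f (z + R • x)) y
          = R ^ (2*j) • fderiv ℝ (fun x => negLapPow j f (z + R • x)) y := fun y =>
        fderiv_const_mul (hs'.differentiable (by norm_num) y) _
      simp only [h1, _root_.smul_apply, smul_eq_mul]
      rw [fderiv_const_mul ((contDiff_pd (k := 1) hs' _).differentiable (by norm_num) x)]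
      rfl
    rw [this, lap_affine hs]
    ring

lemma nlp_ibp (j : ℕ) {f ψ : Euc m → ℝ} (hf : ContDiff ℝ ((2*j : ℕ)) f)
    (hψ : ContDiff ℝ (⊤ : ℕ∞) ψ) (hc : HasCompactSupport ψ) :
    ∫ x, f x * negLapPow j ψ x = ∫ x, negLapPow j f x * ψ x := by
  induction j generalizing f with
  | zero => rfl
  | succ j ih =>
    have hf' : ContDiff ℝ ((2*j : ℕ)) (fun x => -(lap f x)) := (contDiff_lap (k := 2*j) hf).neg
    have h2 : ContDiff ℝ 2 f := hf.of_le (by norm_cast; omega)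
    rw [nlp_succ j f, ← ih hf', nlp_succ' j ψ]
    simp only [mul_neg, neg_mul, integral_neg]
    rw [lap_ibp h2 (smooth2 (nlp_smooth j hψ)) (nlp_hcs j hc)]

lemma nlp_congr (j : ℕ) {f g : Euc m → ℝ} {x : Euc m} (h : f =ᶠ[𝓝 x] g) :
    negLapPow j f x = negLapPow j g x := by
  have : negLapPow j f =ᶠ[𝓝 x] negLapPow j g := by
    induction j with
    | zero => exact h
    | succ j ih =>
      rw [nlp_succ', nlp_succ']
      filter_upwards [ih.eventuallyEq_nhds] with y hy
      rw [lap_congr hy]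
  exact this.eq_of_nhds

end part1
section part2
variable {m : ℕ}

lemma lap_radial {F F' F'' : ℝ → ℝ} {a : ℝ} (hF : ∀ s, a < s → HasDerivAt F (F' s) s)
    (hF' : ∀ s, a < s → HasDerivAt F' (F'' s) s) (x : Euc m) (hx : a < ‖x‖^2) :
    lap (fun y => F (‖y‖^2)) x = 4 * ‖x‖^2 * F'' (‖x‖^2) + 4 * m * F' (‖x‖^2) := by
  have hinner : ∀ (y : Euc m) (i : Fin (2*m)),
      (2 • (innerSL ℝ y)) (EuclideanSpace.single i (1:ℝ)) = 2 * y i := by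
    intro y i
    simp [EuclideanSpace.inner_single_right]
  have hn : ∀ y : Euc m, HasFDerivAt (fun y : Euc m => ‖y‖^2) (2 • (innerSL ℝ y)) y := fun y =>
    (hasStrictFDerivAt_norm_sq y).hasFDerivAt
  have key : ∀ (G G' : ℝ → ℝ), (∀ s, a < s → HasDerivAt G (G' s) s) → ∀ y : Euc m, a < ‖y‖^2 →
      HasFDerivAt (fun y : Euc m => G (‖y‖^2)) (G' (‖y‖^2) • (2 • (innerSL ℝ y))) y := by
    intro G G' hG y hy
    exact (hG _ hy).comp_hasFDerivAt y (hn y)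
  have hev : ∀ᶠ y : Euc m in 𝓝 x, a < ‖y‖^2 :=
    (isOpen_lt continuous_const (by fun_prop)).mem_nhds hx
  unfold lap
  have h1 : ∀ i : Fin (2*m),
      fderiv ℝ (fun y => fderiv ℝ (fun y : Euc m => F (‖y‖^2)) y (EuclideanSpace.single i (1:ℝ))) x
      (EuclideanSpace.single i (1:ℝ)) = 4 * F'' (‖x‖^2) * (x i)^2 + 2 * F' (‖x‖^2) := by
    intro i
    have he : (fun y => fderiv ℝ (fun y : Euc m => F (‖y‖^2)) y (EuclideanSpace.single i (1:ℝ)))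
        =ᶠ[𝓝 x] fun y => F' (‖y‖^2) * (2 * y i) := by
      filter_upwards [hev] with y hy
      rw [(key F F' hF y hy).fderiv, _root_.smul_apply, hinner]
      rfl
    rw [he.fderiv_eq]
    have hcoord : HasFDerivAt (fun y : Euc m => 2 * y i)
        ((2:ℝ) • (EuclideanSpace.proj i : Euc m →L[ℝ] ℝ)) x :=
      (EuclideanSpace.proj i : Euc m →L[ℝ] ℝ).hasFDerivAt.const_mul 2
    rw [((key F' F'' hF' x hx).fun_mul hcoord).fderiv, _root_.add_apply, _root_.smul_apply,
      _root_.smul_apply, _root_.smul_apply, _root_.smul_apply, hinner]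
    simp
    ring
  rw [Finset.sum_congr rfl fun i _ => h1 i, Finset.sum_add_distrib, ← Finset.mul_sum,
    ← EuclideanSpace.real_norm_sq_eq]
  simp
  ring

/-- coefficients -/
def aco (M : ℝ) (j i : ℕ) : ℝ :=
  4^j * (Nat.factorial (j+i-1) : ℝ) * (Nat.choose j i : ℝ) * ∏ l ∈ Finset.Ioc i j, (M - (l:ℝ))

lemma aco_zero (M : ℝ) (j : ℕ) (hj : 1 ≤ j) :
    aco M (j+1) 0 = 4 * j * (M - 1 - j) * aco M j 0 := by
  unfold aco
  obtain ⟨k, rfl⟩ : ∃ k, j = k + 1 := ⟨j-1, by omega⟩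
  have h : ∏ l ∈ Finset.Ioc 0 (k+1+1), (M - (l:ℝ)) = (∏ l ∈ Finset.Ioc 0 (k+1), (M - (l:ℝ))) * (M - ((k+1+1 : ℕ):ℝ)) := by
    rw [← Finset.prod_Ioc_succ_top (by omega)]
  rw [h]
  have e1 : k + 1 + 1 + 0 - 1 = k + 1 := by omega
  have e2 : k + 1 + 0 - 1 = k := by omega
  rw [e1, e2, Nat.factorial_succ]
  push_cast
  simp
  ring

lemma aco_succ (M : ℝ) (j i : ℕ) (hj : 1 ≤ j) (hi : i ≤ j) :
    aco M (j+1) (i+1) = 4 * (j+i+1) * (M - 1 - j - (i+1)) * aco M j (i+1)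
      + 4 * (j+i) * (j+i+1) * aco M j i := by
  obtain ⟨k, rfl⟩ : ∃ k, j = k + 1 := ⟨j-1, by omega⟩
  unfold aco
  have e1 : k + 1 + 1 + (i+1) - 1 = k + i + 1 + 1 := by omega
  have e2 : k + 1 + (i+1) - 1 = k + i + 1 := by omega
  have e3 : k + 1 + i - 1 = k + i := by omega
  rw [e1, e2, e3, Nat.factorial_succ (k+i+1), Nat.factorial_succ (k+i)]
  rcases hi.lt_or_eq with h | h
  · have h1 : ∏ l ∈ Finset.Ioc (i+1) (k+1+1), (M - (l:ℝ)) =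
        (∏ l ∈ Finset.Ioc (i+1) (k+1), (M - (l:ℝ))) * (M - ((k+1+1 : ℕ):ℝ)) := by
      rw [← Finset.prod_Ioc_succ_top (by omega)]
    have h2 : ∏ l ∈ Finset.Ioc i (k+1), (M - (l:ℝ)) =
        (M - ((i+1 : ℕ):ℝ)) * ∏ l ∈ Finset.Ioc (i+1) (k+1), (M - (l:ℝ)) := by
      rw [← Finset.prod_Ioc_consecutive _ (show i ≤ i+1 by omega) (show i+1 ≤ k+1 by omega)]
      simp
    rw [h1, h2]
    have hc : ((k+1).choose (i+1) : ℝ) * (i+1) = ((k+1).choose i : ℝ) * (k + 1 - i) := by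
      have := Nat.choose_succ_right_eq (k+1) i
      have h3 : ((k+1 - i : ℕ) : ℝ) = (k:ℝ) + 1 - i := by
        rw [Nat.cast_sub (by omega)]; push_cast; ring
      rw [← h3]
      exact_mod_cast this
    rw [Nat.choose_succ_succ (k+1) i]
    push_cast
    set p := ∏ l ∈ Finset.Ioc (i+1) (k+1), (M - (l:ℝ))
    linear_combination (4 ^ (k+2) * (k+i+2) * (k+i+1) * ((k+i).factorial:ℝ) * p) * hc
  · subst h
    simp
    ring

/-- radial profile of `(-Δ)^j (-log(e+|x|²))` -/
def prof (M e : ℝ) (j : ℕ) (s : ℝ) : ℝ :=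
  ∑ i ∈ Finset.range (j+1), aco M j i * e^i * ((e+s)^(j+i))⁻¹

lemma hasDeriv_invpow (e s : ℝ) (hs : -e < s) (k : ℕ) :
    HasDerivAt (fun s => ((e+s)^k)⁻¹) (-(k:ℝ) * ((e+s)^(k+1))⁻¹) s := by
  have h0 : e + s ≠ 0 := by linarith
  have h1 : HasDerivAt (fun s : ℝ => e + s) 1 s := (hasDerivAt_id s).const_add e
  have h2 := (h1.fun_pow k).fun_inv (pow_ne_zero k h0)
  refine h2.congr_deriv ?_
  rcases k with _ | k
  · simp
  · simp only [Nat.add_sub_cancel]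
    field_simp
    ring

lemma prof_step (M e t : ℝ) (j : ℕ) (hj : 1 ≤ j) :
    ∑ i ∈ Finset.range (j+1), aco M j i * e^i *
      (4 * (j+i) * (M - 1 - (j+i)) * (t^(j+i+1))⁻¹ + 4 * e * (j+i) * (j+i+1) * (t^(j+i+2))⁻¹)
    = ∑ i ∈ Finset.range (j+1+1), aco M (j+1) i * e^i * (t^(j+1+i))⁻¹ := by
  have hz : aco M j (j+1) = 0 := by simp [aco]
  rw [Finset.sum_range_succ' _ (j+1), aco_zero M j hj]
  have h1 : ∑ i ∈ Finset.range (j+1), aco M (j+1) (i+1) * e^(i+1) * (t^(j+1+(i+1)))⁻¹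
      = ∑ i ∈ Finset.range (j+1), (aco M j (i+1) * e^(i+1) * (4 * (j+((i+1:ℕ):ℝ)) * (M - 1 - (j+((i+1:ℕ):ℝ)))
        * (t^(j+(i+1)+1))⁻¹))
        + ∑ i ∈ Finset.range (j+1), aco M j i * e^i * (4 * e * (j+i) * (j+i+1) * (t^(j+i+2))⁻¹) := by
    rw [← Finset.sum_add_distrib]
    refine Finset.sum_congr rfl fun i hi => ?_
    rw [aco_succ M j i hj (by simp at hi; omega)]
    have e1 : j + 1 + (i+1) = j + i + 2 := by omega
    have e2 : j + (i+1) + 1 = j + i + 2 := by omega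
    rw [e1, e2]
    push_cast
    ring
  rw [h1]
  have h2 := Finset.sum_range_succ' (fun i : ℕ => aco M j i * e^i * (4 * (j+(i:ℝ)) * (M - 1 - (j+(i:ℝ)))
        * (t^(j+i+1))⁻¹)) (j+1)
  rw [Finset.sum_range_succ, hz] at h2
  simp only [mul_add, Finset.sum_add_distrib] at h2 ⊢
  simp only [zero_mul, add_zero, Nat.cast_zero, pow_zero, mul_one] at h2 ⊢
  have e3 : aco M j 0 * (4 * (j:ℝ) * (M - 1 - j) * (t^(j+1))⁻¹) = 4 * (j:ℝ) * (M - 1 - j) * aco M j 0 * (t^(j+1))⁻¹ := by ring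
  push_cast at h2 ⊢
  linarith

lemma nlp_log (e : ℝ) (j : ℕ) (hj : 1 ≤ j) (x : Euc m) (hx : 0 < e + ‖x‖^2) :
    negLapPow j (fun y => -Real.log (e + ‖y‖^2)) x = prof m e j (‖x‖^2) := by
  induction j, hj using Nat.le_induction generalizing x with
  | base =>
    rw [nlp_succ', negLapPow, Function.iterate_zero, id]
    have h := lap_radial (m := m) (F := fun s => -Real.log (e+s)) (F' := fun s => -((e+s)^1)⁻¹)
      (F'' := fun s => ((e+s)^2)⁻¹) (a := -e) ?_ ?_ x (by linarith)
    · simp only [h]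
      simp only [prof, Finset.sum_range_succ, Finset.sum_range_zero, aco]
      simp
      field_simp
      ring
    · intro s hs
      have h1 : HasDerivAt (fun s : ℝ => e + s) 1 s := (hasDerivAt_id s).const_add e
      have := (h1.log (by linarith)).fun_neg
      simpa using this
    · intro s hs
      have := (hasDeriv_invpow e s hs 1).fun_neg
      simpa using this
  | succ j hj ih =>
    rw [nlp_succ']
    have hev : negLapPow j (fun y => -Real.log (e + ‖y‖^2)) =ᶠ[𝓝 x]
        fun y => prof m e j (‖y‖^2) := by
      filter_upwards [(isOpen_lt continuous_const (by fun_prop : Continuous fun y : Euc m => e + ‖y‖^2)).mem_nhds hx] with y hy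
      exact ih y hy
    simp only
    rw [lap_congr hev]
    have h := lap_radial (m := m) (F := prof m e j)
      (F' := fun s => ∑ i ∈ Finset.range (j+1), aco m j i * e^i * (-((j+i : ℕ):ℝ) * ((e+s)^(j+i+1))⁻¹))
      (F'' := fun s => ∑ i ∈ Finset.range (j+1), aco m j i * e^i * (-((j+i : ℕ):ℝ) *
         (-((j+i+1 : ℕ):ℝ) * ((e+s)^(j+i+1+1))⁻¹))) (a := -e) ?_ ?_ x (by linarith)
    · rw [h, prof, ← prof_step m e _ j hj, Finset.mul_sum, Finset.mul_sum,
        ← Finset.sum_add_distrib, ← Finset.sum_neg_distrib]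
      refine Finset.sum_congr rfl fun i _ => ?_
      obtain ⟨t, ht⟩ : ∃ t, t = e + ‖x‖^2 := ⟨_, rfl⟩
      have hs : ‖x‖^2 = t - e := by linarith
      rw [hs]
      have : e + (t - e) = t := by ring
      rw [this]
      have ht0 : t ≠ 0 := by rw [ht]; exact hx.ne'
      have e1 : (t^(j+i+1))⁻¹ = t * (t^(j+i+2))⁻¹ := by
        field_simp
        ring
      rw [e1]
      push_cast
      ring
    · intro s hs
      unfold prof
      exact HasDerivAt.fun_sum fun i _ => (hasDeriv_invpow e s hs (j+i)).const_mul _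
    · intro s hs
      exact HasDerivAt.fun_sum fun i _ => ((hasDeriv_invpow e s hs (j+i+1)).const_mul _).const_mul _

lemma nlp_log_m (hm : 1 ≤ m) (e : ℝ) (x : Euc m) (hx : 0 < e + ‖x‖^2) :
    negLapPow m (fun y => -Real.log (e + ‖y‖^2)) x
      = 4^m * (Nat.factorial (2*m-1) : ℝ) * e^m * ((e + ‖x‖^2)^(2*m))⁻¹ := by
  rw [nlp_log e m hm x hx, prof, Finset.sum_range_succ, Finset.sum_eq_zero]
  · simp [aco, two_mul]
  · intro i hi
    have : ∏ l ∈ Finset.Ioc i m, ((m:ℝ) - (l:ℝ)) = 0 := by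
      refine Finset.prod_eq_zero (i := m) ?_ (sub_self _)
      simp at hi ⊢
      exact hi
    simp [aco, this]

end part2
section part3
variable {m : ℕ}

lemma locInt_inv (hm : 1 ≤ m) : LocallyIntegrable (fun x : Euc m => ‖x‖⁻¹) := by
  refine locallyIntegrable_of_norm_le_rpow (C := 1) (α := 1) ?_ ?_ ?_ ?_
  · simp; omega
  · simp
    have : (1:ℝ) ≤ m := by exact_mod_cast hm
    linarith
  · refine Filter.Eventually.of_forall fun x => ?_
    simp [Real.rpow_neg_one]
  · exact (measurable_norm.inv).aestronglyMeasurable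

lemma integrable_japanese (hm : 1 ≤ m) :
    Integrable (fun x : Euc m => ((1 + ‖x‖^2)^(2*m))⁻¹) := by
  have h := integrable_rpow_neg_one_add_norm_sq (E := Euc m) (μ := volume) (r := 4*m) (by
    simp
    have : (1:ℝ) ≤ m := by exact_mod_cast hm
    linarith)
  refine h.congr (Filter.Eventually.of_forall fun x => ?_)
  have h0 : (0:ℝ) ≤ 1 + ‖x‖^2 := by positivity
  simp only
  rw [show (-(4 * (m:ℝ)) / 2) = -((2*m : ℕ):ℝ) by push_cast; ring, Real.rpow_neg h0,
    Real.rpow_natCast]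

lemma integral_japanese (hm : 1 ≤ m) :
    ∫ x : Euc m, ((1 + ‖x‖^2)^(2*m))⁻¹ = π^m * Real.Gamma m / Real.Gamma (2*m) := by
  have hm' : (0:ℝ) < m := by exact_mod_cast (by omega : 0 < m)
  have hG : 0 < Real.Gamma (2*m) := Real.Gamma_pos_of_pos (by positivity)
  have h1 : ∀ x : Euc m, ∫ t in Ioi (0:ℝ), t^((2*m:ℝ)-1) * Real.exp (-((1+‖x‖^2)*t))
      = ((1 + ‖x‖^2)^(2*m))⁻¹ * Real.Gamma (2*m) := by
    intro x
    rw [Real.integral_rpow_mul_exp_neg_mul_Ioi (by positivity) (by positivity)]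
    congr 1
    rw [show (2*m:ℝ) = ((2*m : ℕ):ℝ) by push_cast; ring, Real.rpow_natCast]
    simp
  have hint : Integrable (Function.uncurry fun (x : Euc m) (t : ℝ) =>
      t^((2*m:ℝ)-1) * Real.exp (-((1+‖x‖^2)*t))) (volume.prod (volume.restrict (Ioi 0))) := by
    rw [integrable_prod_iff]
    · constructor
      · refine Filter.Eventually.of_forall fun x => ?_
        refine Integrable.of_integral_ne_zero ?_
        simp only [Function.uncurry]
        rw [h1 x]
        positivity
      · have := (integrable_japanese hm).mul_const (Real.Gamma (2*m))
        refine this.congr (Filter.Eventually.of_forall fun x => ?_)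
        simp only
        rw [← h1 x]
        refine setIntegral_congr_fun measurableSet_Ioi fun t ht => ?_
        simp only [Function.uncurry]
        rw [Real.norm_of_nonneg]
        have : (0:ℝ) < t := ht
        positivity
    · refine Measurable.aestronglyMeasurable ?_
      unfold Function.uncurry
      fun_prop
  have hsw := integral_integral_swap hint
  simp only [h1] at hsw
  rw [integral_mul_const] at hsw
  have h2 : ∀ t ∈ Ioi (0:ℝ), ∫ x : Euc m, t^((2*m:ℝ)-1) * Real.exp (-((1+‖x‖^2)*t))
      = π^m * (t^((m:ℝ)-1) * Real.exp (-(1*t))) := by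
    intro t ht
    have ht' : (0:ℝ) < t := ht
    have : ∀ x : Euc m, t^((2*m:ℝ)-1) * Real.exp (-((1+‖x‖^2)*t)) =
        t^((2*m:ℝ)-1) * Real.exp (-(1*t)) * Real.exp (-t * ‖x‖^2) := by
      intro x
      rw [mul_assoc, ← Real.exp_add]
      congr 2; ring
    simp only [this]
    rw [integral_const_mul, GaussianFourier.integral_rexp_neg_mul_sq_norm ht']
    have e1 : ((Module.finrank ℝ (Euc m) : ℝ) / 2) = m := by simp
    rw [e1, Real.rpow_natCast, div_pow]
    have e2 : t^((2*m:ℝ)-1) = t^((m:ℝ)-1) * t^m := by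
      rw [← Real.rpow_natCast t m, ← Real.rpow_add ht']
      congr 1; ring
    rw [e2]
    field_simp
  rw [setIntegral_congr_fun measurableSet_Ioi h2, integral_const_mul,
    Real.integral_rpow_mul_exp_neg_mul_Ioi hm' one_pos] at hsw
  rw [eq_div_iff hG.ne', hsw]
  simp

lemma mass (hm : 1 ≤ m) :
    4^m * (Nat.factorial (2*m-1) : ℝ) * ∫ x : Euc m, ((1 + ‖x‖^2)^(2*m))⁻¹ = 2 * gamma2m m := by
  rw [integral_japanese hm]
  have hm' : (0:ℝ) < m := by exact_mod_cast (by omega : 0 < m)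
  have hG : 0 < Real.Gamma (2*m) := Real.Gamma_pos_of_pos (by positivity)
  have hG2 : 0 < Real.Gamma (m+1/2) := Real.Gamma_pos_of_pos (by positivity)
  have hd := Real.Gamma_mul_Gamma_add_half (m:ℝ)
  unfold gamma2m Lambda1 sphereVol
  have e1 : (((2*m:ℕ):ℝ) + 1)/2 = m + 1/2 := by push_cast; ring
  rw [e1, Real.rpow_add Real.pi_pos, Real.rpow_natCast, ← Real.sqrt_eq_rpow]
  have e2 : (4:ℝ)^m * 2^(1-2*(m:ℝ)) = 2 := by
    rw [show (4:ℝ)^m = 2^(2*(m:ℝ)) by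
      rw [show (2*(m:ℝ)) = ((2*m:ℕ):ℝ) by push_cast; ring, Real.rpow_natCast, pow_mul]; norm_num]
    rw [← Real.rpow_add two_pos]
    simp
  have e3 : Real.Gamma m = Real.Gamma (2*m) * 2^(1-2*(m:ℝ)) * √π / Real.Gamma (m+1/2) := by
    rw [eq_div_iff hG2.ne']; exact hd
  rw [e3]
  field_simp
  linear_combination e2

lemma gamma_pos (hm : 1 ≤ m) : 0 < gamma2m m := by
  unfold gamma2m Lambda1 sphereVol
  have : 0 < Real.Gamma ((((2*m:ℕ):ℝ) + 1)/2) := Real.Gamma_pos_of_pos (by positivity)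
  positivity

lemma ae_ne_zero (hm : 1 ≤ m) : ∀ᵐ x : Euc m, x ≠ 0 := by
  have : Nonempty (Fin (2*m)) := ⟨⟨0, by omega⟩⟩
  have : Nontrivial (Euc m) := inferInstance
  exact compl_mem_ae_iff.mpr (measure_singleton _)

lemma neg_inv_le_log {r : ℝ} (hr : 0 < r) : -r⁻¹ ≤ Real.log r := by
  have := Real.log_le_sub_one_of_pos (inv_pos.mpr hr)
  rw [Real.log_inv] at this
  linarith

lemma fund0 (hm : 1 ≤ m) {ψ : Euc m → ℝ} (hψ : ContDiff ℝ (⊤ : ℕ∞) ψ) (hc : HasCompactSupport ψ) :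
    ∫ x, -Real.log ‖x‖ * negLapPow m ψ x = gamma2m m * ψ 0 := by
  set P := negLapPow m ψ with hP
  have hPc : Continuous P := (nlp_smooth m hψ).continuous
  have hPs : HasCompactSupport P := nlp_hcs m hc
  set A : ℝ := 4^m * (Nat.factorial (2*m-1) : ℝ) with hA
  have hid : ∀ ε : ℝ, 0 < ε → ∫ x, -Real.log (ε^2 + ‖x‖^2) * P x
      = ∫ x, A * ((1 + ‖x‖^2)^(2*m))⁻¹ * ψ (ε • x) := by
    intro ε hε
    have hsm : ContDiff ℝ ((2*m : ℕ)) (fun x : Euc m => -Real.log (ε^2 + ‖x‖^2)) := by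
      refine ContDiff.neg (ContDiff.log ?_ ?_)
      · exact contDiff_const.add (contDiff_norm_sq ℝ)
      · intro x; positivity
    rw [hP, nlp_ibp m hsm hψ hc]
    have h1 : ∀ x : Euc m, negLapPow m (fun x : Euc m => -Real.log (ε^2 + ‖x‖^2)) x =
        A * (ε^2)^m * ((ε^2 + ‖x‖^2)^(2*m))⁻¹ := fun x => nlp_log_m hm (ε^2) x (by positivity)
    simp only [h1]
    have h2 := Measure.integral_comp_smul (volume : Measure (Euc m))
      (fun x => A * (ε^2)^m * ((ε^2 + ‖x‖^2)^(2*m))⁻¹ * ψ x) ε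
    have h3 : ∀ x : Euc m, A * (ε^2)^m * ((ε^2 + ‖ε • x‖^2)^(2*m))⁻¹ * ψ (ε • x)
        = (ε^(2*m))⁻¹ * (A * ((1 + ‖x‖^2)^(2*m))⁻¹ * ψ (ε • x)) := by
      intro x
      rw [norm_smul, Real.norm_of_nonneg hε.le,
        show ε^2 + (ε * ‖x‖)^2 = ε^2 * (1 + ‖x‖^2) by ring, mul_pow, ← pow_mul, ← pow_mul]
      field_simp
      ring
    simp only [h3] at h2
    rw [integral_const_mul] at h2
    have hfr : Module.finrank ℝ (Euc m) = 2*m := by simp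
    rw [hfr, abs_of_pos (by positivity), smul_eq_mul] at h2
    exact (mul_left_cancel₀ (by positivity) h2).symm
  have hR : Tendsto (fun ε : ℝ => ∫ x, A * ((1 + ‖x‖^2)^(2*m))⁻¹ * ψ (ε • x)) (𝓝[>] 0)
      (𝓝 (∫ x : Euc m, A * ((1 + ‖x‖^2)^(2*m))⁻¹ * ψ 0)) := by
    obtain ⟨B, hB⟩ := hψ.continuous.bounded_above_of_compact_support hc
    refine tendsto_integral_filter_of_dominated_convergence
      (fun x : Euc m => A * ((1 + ‖x‖^2)^(2*m))⁻¹ * B) ?_ ?_ ?_ ?_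
    · refine Filter.Eventually.of_forall fun ε => ?_
      have hcont : Continuous fun x : Euc m => ((1 + ‖x‖^2)^(2*m))⁻¹ :=
        Continuous.inv₀ (by fun_prop) fun x => by positivity
      exact ((continuous_const.mul hcont).mul
        (hψ.continuous.comp (by fun_prop))).aestronglyMeasurable
    · refine Filter.Eventually.of_forall fun ε => Filter.Eventually.of_forall fun x => ?_
      rw [norm_mul, Real.norm_of_nonneg (by positivity)]
      gcongr
      exact hB _
    · exact ((integrable_japanese hm).const_mul A).mul_const B
    · refine Filter.Eventually.of_forall fun x => ?_
      refine Tendsto.const_mul _ ?_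
      have h1 : Continuous fun ε : ℝ => ψ (ε • x) := hψ.continuous.comp (by fun_prop)
      have h2 := h1.tendsto 0
      rw [zero_smul] at h2
      exact h2.mono_left nhdsWithin_le_nhds
  have hL : Tendsto (fun ε : ℝ => ∫ x, -Real.log (ε^2 + ‖x‖^2) * P x) (𝓝[>] 0)
      (𝓝 (∫ x : Euc m, -Real.log (‖x‖^2) * P x)) := by
    refine tendsto_integral_filter_of_dominated_convergence
      (fun x : Euc m => (2 * ‖x‖⁻¹ + ‖x‖^2) * |P x|) ?_ ?_ ?_ ?_
    · refine Filter.Eventually.of_forall fun ε => ?_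
      refine Measurable.aestronglyMeasurable ?_
      have := hPc.measurable
      fun_prop
    · have h01 : ∀ᶠ ε : ℝ in 𝓝[>] 0, ε ∈ Ioo (0:ℝ) 1 := Ioo_mem_nhdsGT one_pos
      filter_upwards [h01] with ε hε
      filter_upwards [ae_ne_zero hm] with x hx
      have hr : 0 < ‖x‖ := norm_pos_iff.mpr hx
      rw [norm_mul, norm_neg, Real.norm_eq_abs, Real.norm_eq_abs]
      gcongr
      rw [abs_le]
      have hinv : 0 < ‖x‖⁻¹ := inv_pos.mpr hr
      constructor
      · have h1 : Real.log (‖x‖^2) ≤ Real.log (ε^2 + ‖x‖^2) :=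
          Real.log_le_log (by positivity) (by nlinarith [sq_nonneg ε])
        rw [Real.log_pow] at h1
        have h2 := neg_inv_le_log hr
        push_cast at h1
        nlinarith [sq_nonneg ‖x‖]
      · have h1 := Real.log_le_sub_one_of_pos (show 0 < ε^2 + ‖x‖^2 by positivity)
        have h2 : ε^2 ≤ 1 := by nlinarith [hε.1, hε.2]
        linarith
    · have h1 : LocallyIntegrable (fun x : Euc m => 2 * ‖x‖⁻¹ + ‖x‖^2) := by
        refine LocallyIntegrable.add ?_ ?_
        · have := (locInt_inv hm).smul (2:ℝ)
          exact this
        · exact (by fun_prop : Continuous fun x : Euc m => ‖x‖^2).locallyIntegrable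
      exact h1.integrable_smul_right_of_hasCompactSupport hPc.abs
        (hPs.comp_left (g := fun t : ℝ => |t|) abs_zero)
    · filter_upwards [ae_ne_zero hm] with x hx
      have hr : 0 < ‖x‖ := norm_pos_iff.mpr hx
      refine Tendsto.mul_const _ (Tendsto.neg ?_)
      have hc1 : ContinuousAt (fun ε : ℝ => Real.log (ε^2 + ‖x‖^2)) 0 := by
        refine ContinuousAt.log (by fun_prop) ?_
        positivity
      have h2 := hc1.tendsto
      simp only [ne_eq, OfNat.ofNat_ne_zero, not_false_eq_true, zero_pow, zero_add] at h2
      exact h2.mono_left nhdsWithin_le_nhds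
  have hR' := hR.congr' (by
    filter_upwards [self_mem_nhdsWithin] with ε hε
    exact (hid ε hε).symm)
  have := tendsto_nhds_unique hL hR'
  rw [integral_mul_const, integral_const_mul, mass hm] at this
  have h5 : ∫ x : Euc m, -Real.log (‖x‖^2) * P x = 2 * ∫ x : Euc m, -Real.log ‖x‖ * P x := by
    rw [← integral_const_mul]
    congr 1; funext x
    rw [Real.log_pow]; push_cast; ring
  rw [h5] at this
  linarith

lemma fund (hm : 1 ≤ m) {ψ : Euc m → ℝ} (hψ : ContDiff ℝ (⊤ : ℕ∞) ψ) (hc : HasCompactSupport ψ)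
    (y : Euc m) : ∫ x, Real.log ‖x - y‖ * negLapPow m ψ x = -(gamma2m m * ψ y) := by
  have hs : ContDiff ℝ (⊤ : ℕ∞) (fun u => ψ (y + (1:ℝ) • u)) := hψ.comp (by fun_prop)
  have hcs : HasCompactSupport (fun u => ψ (y + (1:ℝ) • u)) := by
    have := hc.comp_homeomorph (Homeomorph.addLeft y)
    simpa [Function.comp_def] using this
  have h := fund0 hm hs hcs
  rw [nlp_affine m hψ y 1] at h
  simp only [one_pow, one_mul, one_smul, add_zero, neg_mul] at h
  rw [integral_neg] at h
  rw [← h, neg_neg, ← integral_add_left_eq_self (fun x => Real.log ‖x - y‖ * negLapPow m ψ x) y]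
  simp

end part3
section part4
variable {m : ℕ}

lemma exists_G (m : ℕ) : ∃ G : Euc m → ℝ, ContDiff ℝ (⊤ : ℕ∞) G ∧
    ∀ x, 2 ≤ ‖x‖ → G x = -Real.log (0 + ‖x‖^2) := by
  let χ : ContDiffBump (0 : Euc m) := ⟨1, 2, one_pos, one_lt_two⟩
  refine ⟨fun x => (1 - χ x) * -Real.log (0 + ‖x‖^2), ?_, ?_⟩
  · rw [contDiff_iff_contDiffAt]
    intro x
    by_cases hx : x = 0
    · have he : (fun x : Euc m => (1 - χ x) * -Real.log (0 + ‖x‖^2)) =ᶠ[𝓝 x] fun _ => 0 := by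
        filter_upwards [Metric.ball_mem_nhds x one_pos] with y hy
        have : χ y = 1 := by
          refine χ.one_of_mem_closedBall ?_
          rw [hx] at hy
          exact Metric.ball_subset_closedBall hy
        simp [this]
      exact contDiffAt_const.congr_of_eventuallyEq he
    · have h1 : ContDiffAt ℝ (⊤ : ℕ∞) (fun x => 1 - χ x) x :=
        contDiffAt_const.sub χ.contDiff.contDiffAt
      have h2 : ContDiffAt ℝ (⊤ : ℕ∞) (fun x : Euc m => -Real.log (0 + ‖x‖^2)) x := by
        refine ContDiffAt.neg (ContDiffAt.log ?_ ?_)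
        · exact contDiffAt_const.add (contDiff_norm_sq ℝ).contDiffAt
        · have : 0 < ‖x‖ := norm_pos_iff.mpr hx
          positivity
      exact h1.mul h2
  · intro x hx
    have : χ x = 0 := χ.zero_of_le_dist (by simpa [dist_eq_norm] using hx)
    simp [this]

lemma Q_props (hm : 1 ≤ m) {G : Euc m → ℝ} (hG : ContDiff ℝ (⊤ : ℕ∞) G)
    (hG2 : ∀ x, 2 ≤ ‖x‖ → G x = -Real.log (0 + ‖x‖^2)) :
    (∀ x, 2 < ‖x‖ → negLapPow m G x = 0) ∧ ∫ x, negLapPow m G x = 2 * gamma2m m := by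
  have hQ0 : ∀ x, 2 < ‖x‖ → negLapPow m G x = 0 := by
    intro x hx
    have he : G =ᶠ[𝓝 x] fun y => -Real.log (0 + ‖y‖^2) := by
      filter_upwards [(isOpen_lt continuous_const continuous_norm).mem_nhds hx] with y hy
      exact hG2 y (le_of_lt hy)
    rw [nlp_congr m he, nlp_log_m hm 0 x (by positivity), zero_pow (by omega)]
    simp
  refine ⟨hQ0, ?_⟩
  let χ : ContDiffBump (0 : Euc m) := ⟨3, 4, by norm_num, by norm_num⟩
  have hχ1 : ∀ x, ‖x‖ ≤ 3 → χ x = 1 := fun x hx =>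
    χ.one_of_mem_closedBall (by simpa [dist_eq_norm] using hx)
  have h1 : ∀ x, negLapPow m G x = negLapPow m G x * χ x := by
    intro x
    by_cases hx : ‖x‖ ≤ 2
    · rw [hχ1 x (by linarith), mul_one]
    · rw [hQ0 x (not_le.mp hx), zero_mul]
  have hχs : ContDiff ℝ (⊤ : ℕ∞) (χ : Euc m → ℝ) := χ.contDiff
  rw [show (∫ x, negLapPow m G x) = ∫ x, negLapPow m G x * χ x by simp only [← h1],
    ← nlp_ibp m (contDiff_infty.mp hG _) hχs χ.hasCompactSupport]
  have h2 : ∀ x, G x * negLapPow m χ x = 2 * (-Real.log ‖x‖ * negLapPow m χ x) := by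
    intro x
    by_cases hx : ‖x‖ < 3
    · have : negLapPow m χ x = 0 := by
        have he : (χ : Euc m → ℝ) =ᶠ[𝓝 x] fun _ => 1 := by
          filter_upwards [(isOpen_lt continuous_norm continuous_const).mem_nhds hx] with y hy
          exact hχ1 y (le_of_lt hy)
        rw [nlp_congr m he, nlp_const m hm]
      rw [this]; simp
    · rw [hG2 x (by linarith), zero_add, Real.log_pow]
      push_cast; ring
  simp only [h2]
  rw [integral_const_mul, fund0 hm hχs χ.hasCompactSupport, hχ1 0 (by simp), mul_one]

lemma scale_inv (hm : 1 ≤ m) {G H : Euc m → ℝ} (hG : ContDiff ℝ (⊤ : ℕ∞) G)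
    (hG2 : ∀ x, 2 ≤ ‖x‖ → G x = -Real.log (0 + ‖x‖^2)) (hH : Continuous H)
    (hw : ∀ ψ : Euc m → ℝ, ContDiff ℝ (⊤ : ℕ∞) ψ → HasCompactSupport ψ →
      ∫ x, H x * negLapPow m ψ x = 0) {R : ℝ} (hR : 0 < R) :
    ∫ u, H (R • u) * negLapPow m G u = ∫ u, H u * negLapPow m G u := by
  have hQ0 := (Q_props hm hG hG2).1
  set Q := negLapPow m G with hQ
  have hQc : Continuous Q := (nlp_smooth m hG).continuous
  have hQs : HasCompactSupport Q := HasCompactSupport.intro (isCompact_closedBall 0 2) fun x hx =>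
    hQ0 x (by simpa using hx)
  have hGR : ContDiff ℝ (⊤ : ℕ∞) (fun x => G (0 + R⁻¹ • x)) := hG.comp (by fun_prop)
  have hsub : ContDiff ℝ (⊤ : ℕ∞) (fun x => G (0 + R⁻¹ • x) - G x) := hGR.sub hG
  have h1 := hw (fun x => (G (0 + R⁻¹ • x) - G x) - 2 * Real.log R) (hsub.sub contDiff_const) (by
    refine HasCompactSupport.intro (isCompact_closedBall 0 (max 2 (2*R))) fun x hx => ?_
    have hx' : max 2 (2*R) < ‖x‖ := by simpa using hx
    have hx1 : 2 < ‖x‖ := lt_of_le_of_lt (le_max_left _ _) hx'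
    have hx2 : 2*R < ‖x‖ := lt_of_le_of_lt (le_max_right _ _) hx'
    have hn : ‖0 + R⁻¹ • x‖ = R⁻¹ * ‖x‖ := by
      rw [zero_add, norm_smul, Real.norm_of_nonneg (by positivity)]
    have hge : 2 ≤ ‖0 + R⁻¹ • x‖ := by
      rw [hn, ← div_eq_inv_mul, le_div_iff₀ hR]; linarith
    rw [hG2 x hx1.le, hG2 _ hge, hn, zero_add, zero_add, Real.log_pow, Real.log_pow,
      Real.log_mul (by positivity) (by positivity), Real.log_inv]
    push_cast; ring)
  rw [nlp_sub m hsub contDiff_const, nlp_sub m hGR hG, nlp_const m hm, nlp_affine m hG 0 R⁻¹] at h1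
  simp only [sub_zero, zero_add, mul_sub, ← hQ] at h1
  have hI1 : Integrable (fun x => H x * (R⁻¹ ^ (2*m) * Q (R⁻¹ • x))) := by
    refine Continuous.integrable_of_hasCompactSupport ?_ ?_
    · have : Continuous fun x => Q (R⁻¹ • x) := hQc.comp (by fun_prop)
      fun_prop
    · exact ((hQs.comp_smul (inv_pos.mpr hR).ne').mul_left).mul_left
  have hI2 : Integrable (fun x => H x * Q x) :=
    (hH.mul hQc).integrable_of_hasCompactSupport hQs.mul_left
  rw [integral_sub hI1 hI2, sub_eq_zero] at h1
  rw [← h1]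
  have h2 := Measure.integral_comp_smul (volume : Measure (Euc m))
      (fun x => H x * Q (R⁻¹ • x)) R
  simp only [smul_smul, inv_mul_cancel₀ hR.ne', one_smul] at h2
  rw [h2, show Module.finrank ℝ (Euc m) = 2*m by simp, abs_of_pos (by positivity), smul_eq_mul,
    ← integral_const_mul]
  congr 1; funext x
  rw [inv_pow]; ring

lemma weak_translate {h : Euc m → ℝ}
    (hw : ∀ ψ : Euc m → ℝ, ContDiff ℝ (⊤ : ℕ∞) ψ → HasCompactSupport ψ →
      ∫ x, h x * negLapPow m ψ x = 0) (z : Euc m) (ψ : Euc m → ℝ) (hψ : ContDiff ℝ (⊤ : ℕ∞) ψ)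
      (hc : HasCompactSupport ψ) : ∫ x, h (z + x) * negLapPow m ψ x = 0 := by
  have hs : ContDiff ℝ (⊤ : ℕ∞) (fun u => ψ (-z + (1:ℝ) • u)) := hψ.comp (by fun_prop)
  have hcs : HasCompactSupport (fun u => ψ (-z + (1:ℝ) • u)) := by
    have := hc.comp_homeomorph (Homeomorph.addLeft (-z))
    simpa [Function.comp_def] using this
  have h1 := hw _ hs hcs
  rw [nlp_affine m hψ (-z) 1] at h1
  simp only [one_pow, one_mul, one_smul] at h1
  rw [← integral_add_left_eq_self _ z] at h1
  simpa using h1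

lemma liouville (hm : 1 ≤ m) {h : Euc m → ℝ} (hh : Continuous h)
    (hgr : ∃ A B : ℝ, ∀ x : Euc m, |h x| ≤ A * Real.log (2 + ‖x‖) + B)
    (hw : ∀ ψ : Euc m → ℝ, ContDiff ℝ (⊤ : ℕ∞) ψ → HasCompactSupport ψ →
      ∫ x, h x * negLapPow m ψ x = 0) (z z' : Euc m) : h z = h z' := by
  obtain ⟨G, hG, hG2⟩ := exists_G m
  obtain ⟨hQ0, hQi⟩ := Q_props hm hG hG2
  have hsc : ∀ (z : Euc m) (R : ℝ), 0 < R → ∫ u, h (z + R • u) * negLapPow m G u =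
      ∫ u, h (z + u) * negLapPow m G u := fun z R hR =>
    scale_inv hm (H := fun x => h (z + x)) hG hG2 (by fun_prop) (weak_translate hw z) hR
  have hQsm := nlp_smooth m hG
  set Q := negLapPow m G with hQ
  have hQc : Continuous Q := hQsm.continuous
  have hQs : HasCompactSupport Q := HasCompactSupport.intro (isCompact_closedBall 0 2) fun x hx =>
    hQ0 x (by simpa using hx)
  obtain ⟨A, B, hAB⟩ := hgr
  have hAB' : ∀ (x : Euc m) (r : ℝ), ‖x‖ ≤ r → |h x| ≤ |A| * Real.log (2 + r) + |B| := by
    intro x r hr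
    have h0 : 0 ≤ Real.log (2 + ‖x‖) := Real.log_nonneg (by linarith [norm_nonneg x])
    calc |h x| ≤ A * Real.log (2 + ‖x‖) + B := hAB x
      _ ≤ |A| * Real.log (2 + ‖x‖) + |B| := by
        gcongr
        · exact le_abs_self A
        · exact le_abs_self B
      _ ≤ _ := by gcongr
  have hJ : ∀ z : Euc m, ∫ u, h (z + u) * Q u = 2 * gamma2m m * h z := by
    intro z
    have ht : Tendsto (fun R : ℝ => ∫ u, h (z + R • u) * Q u) (𝓝[>] 0)
        (𝓝 (∫ u, h z * Q u)) := by
      refine tendsto_integral_filter_of_dominated_convergence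
        (fun u => (|A| * Real.log (2 + (‖z‖ + 2)) + |B|) * |Q u|) ?_ ?_ ?_ ?_
      · refine Filter.Eventually.of_forall fun R => ?_
        exact (by fun_prop : Continuous fun u => h (z + R • u) * Q u).aestronglyMeasurable
      · filter_upwards [Ioo_mem_nhdsGT (one_pos : (0:ℝ) < 1)] with R hR
        refine Filter.Eventually.of_forall fun u => ?_
        rw [norm_mul, Real.norm_eq_abs, Real.norm_eq_abs]
        by_cases hu : ‖u‖ ≤ 2
        · gcongr
          refine hAB' _ _ ((norm_add_le _ _).trans ?_)
          rw [norm_smul, Real.norm_of_nonneg hR.1.le]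
          nlinarith [hR.1, hR.2, norm_nonneg u]
        · rw [hQ0 u (not_le.mp hu)]; simp
      · exact ((hQc.abs).integrable_of_hasCompactSupport
          (hQs.comp_left (g := fun t : ℝ => |t|) abs_zero)).const_mul _
      · refine Filter.Eventually.of_forall fun u => Tendsto.mul_const _ ?_
        have h1 : Continuous fun R : ℝ => h (z + R • u) := by fun_prop
        have h2 := h1.tendsto 0
        rw [zero_smul, add_zero] at h2
        exact h2.mono_left nhdsWithin_le_nhds
    have hcst := (tendsto_const_nhds (x := ∫ u, h (z + u) * Q u) (f := 𝓝[>] (0:ℝ))).congr' (by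
      filter_upwards [self_mem_nhdsWithin] with R hR
      exact (hsc z R hR).symm)
    rw [tendsto_nhds_unique hcst ht, integral_const_mul, hQi]
    ring
  obtain ⟨Lc, hLc⟩ := ContDiff.lipschitzWith_of_hasCompactSupport hQs hQsm (by simp)
  set d := z' - z with hd
  have hdiff : ∀ R : ℝ, 0 < R → 2 * gamma2m m * h z - 2 * gamma2m m * h z' =
      ∫ u, h (z + R • u) * (Q u - Q (u - R⁻¹ • d)) := by
    intro R hR
    rw [← hJ z, ← hJ z', ← hsc z R hR, ← hsc z' R hR]
    have e1 : ∫ u, h (z' + R • u) * Q u = ∫ u, h (z + R • u) * Q (u - R⁻¹ • d) := by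
      rw [← integral_sub_right_eq_self (fun u => h (z' + R • u) * Q u) (R⁻¹ • d)]
      congr 1; funext u
      congr 2
      rw [smul_sub, smul_smul, mul_inv_cancel₀ hR.ne', one_smul, hd]
      abel
    have hcs2 : HasCompactSupport (fun u => Q (u - R⁻¹ • d)) := by
      have := hQs.comp_homeomorph (Homeomorph.subRight (R⁻¹ • d))
      simpa [Function.comp_def] using this
    rw [e1, ← integral_sub]
    · congr 1; funext u; ring
    · exact (by fun_prop : Continuous fun u => h (z + R • u) * Q u).integrable_of_hasCompactSupport
        hQs.mul_left
    · exact (by fun_prop : Continuous fun u => h (z + R • u) *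
        Q (u - R⁻¹ • d)).integrable_of_hasCompactSupport hcs2.mul_left
  have hbound : ∀ R : ℝ, 1 ≤ R → ‖d‖ ≤ R → 2 + ‖z‖ ≤ R →
      |2 * gamma2m m * h z - 2 * gamma2m m * h z'| ≤
      ((|A| * (Real.log 4 + Real.log R) + |B|) * (Lc * (‖d‖ / R))) *
        volume.real (closedBall (0 : Euc m) 3) := by
    intro R hR1 hRd hRz
    have hR : 0 < R := by linarith
    rw [hdiff R hR]
    have hz : ∀ u, u ∉ closedBall (0 : Euc m) 3 →
        h (z + R • u) * (Q u - Q (u - R⁻¹ • d)) = 0 := by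
      intro u hu
      have hu' : 3 < ‖u‖ := by simpa using hu
      have hs : ‖R⁻¹ • d‖ ≤ 1 := by
        rw [norm_smul, Real.norm_of_nonneg (by positivity), ← div_eq_inv_mul]
        exact (div_le_one hR).mpr hRd
      rw [hQ0 u (by linarith), hQ0 (u - R⁻¹ • d) (by
        have := norm_sub_norm_le u (R⁻¹ • d)
        linarith)]
      simp
    rw [← setIntegral_eq_integral_of_forall_compl_eq_zero hz, ← Real.norm_eq_abs]
    refine norm_setIntegral_le_of_norm_le_const measure_closedBall_lt_top fun u hu => ?_
    have hu' : ‖u‖ ≤ 3 := by simpa using hu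
    rw [norm_mul, Real.norm_eq_abs]
    have h1 : |h (z + R • u)| ≤ |A| * (Real.log 4 + Real.log R) + |B| := by
      refine (hAB' _ (‖z‖ + 3 * R) ?_).trans ?_
      · refine (norm_add_le _ _).trans ?_
        rw [norm_smul, Real.norm_of_nonneg hR.le]
        nlinarith
      · have := norm_nonneg z
        rw [← Real.log_mul (by norm_num) hR.ne']
        gcongr
        linarith
    have h2 : ‖Q u - Q (u - R⁻¹ • d)‖ ≤ Lc * (‖d‖ / R) := by
      have := hLc.dist_le_mul u (u - R⁻¹ • d)
      rw [dist_eq_norm, dist_eq_norm, sub_sub_cancel, norm_smul,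
        Real.norm_of_nonneg (inv_pos.mpr hR).le, ← div_eq_inv_mul] at this
      exact this
    exact mul_le_mul h1 h2 (norm_nonneg _) ((abs_nonneg _).trans h1)
  have hlim : Tendsto (fun R : ℝ =>
      ((|A| * (Real.log 4 + Real.log R) + |B|) * (Lc * (‖d‖ / R))) *
        volume.real (closedBall (0 : Euc m) 3)) atTop (𝓝 0) := by
    have hl : Tendsto (fun R : ℝ => Real.log R / R) atTop (𝓝 0) :=
      Real.isLittleO_log_id_atTop.tendsto_div_nhds_zero
    have hi : Tendsto (fun R : ℝ => R⁻¹) atTop (𝓝 0) := tendsto_inv_atTop_zero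
    have := ((hl.const_mul (|A| * Lc * ‖d‖)).add
      (hi.const_mul ((|A| * Real.log 4 + |B|) * Lc * ‖d‖))).mul_const
        (volume.real (closedBall (0 : Euc m) 3))
    simp only [mul_zero, add_zero, zero_mul] at this
    refine this.congr fun R => ?_
    simp only [div_eq_mul_inv]
    ring
  have hle : |2 * gamma2m m * h z - 2 * gamma2m m * h z'| ≤ 0 := by
    refine ge_of_tendsto hlim ?_
    filter_upwards [eventually_ge_atTop 1, eventually_ge_atTop ‖d‖,
      eventually_ge_atTop (2 + ‖z‖)] with R h1 h2 h3
    exact hbound R h1 h2 h3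
  have h0 := abs_nonpos_iff.mp hle
  have hg := gamma_pos hm
  have : 2 * gamma2m m * (h z - h z') = 0 := by linarith
  rcases mul_eq_zero.mp this with h1 | h1
  · linarith
  · linarith

end part4
section part5
variable {m : ℕ}

lemma integrable_norm_japanese (hm : 1 ≤ m) :
    Integrable (fun x : Euc m => ‖x‖ * ((1 + ‖x‖^2)^(2*m))⁻¹) := by
  have hm' : (1:ℝ) ≤ m := by exact_mod_cast hm
  have h := integrable_rpow_neg_one_add_norm_sq (E := Euc m) (μ := volume) (r := 4*m-1) (by
    simp
    linarith)
  refine h.mono' ?_ (Filter.Eventually.of_forall fun x => ?_)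
  · refine Measurable.aestronglyMeasurable ?_
    fun_prop
  · have h0 : (0:ℝ) < 1 + ‖x‖^2 := by positivity
    rw [Real.norm_of_nonneg (by positivity),
      show (-(4 * (m:ℝ) - 1) / 2) = 1/2 + -((2*m : ℕ):ℝ) by push_cast; ring,
      Real.rpow_add h0, Real.rpow_neg h0.le, Real.rpow_natCast, ← Real.sqrt_eq_rpow]
    gcongr
    exact Real.le_sqrt_of_sq_le (by linarith)

/-- decaying density -/
structure Dens (φ : Euc m → ℝ) (C₀ : ℝ) : Prop where
  meas : Measurable φ
  nonneg : ∀ x, 0 ≤ φ x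
  bd : ∀ x, φ x ≤ C₀ * ((1 + ‖x‖^2)^(2*m))⁻¹

lemma Dens.c_nonneg {φ : Euc m → ℝ} {C₀ : ℝ} (h : Dens φ C₀) : 0 ≤ C₀ := by
  have := (h.nonneg 0).trans (h.bd 0)
  simpa using this

lemma Dens.le {φ : Euc m → ℝ} {C₀ : ℝ} (h : Dens φ C₀) (x : Euc m) : φ x ≤ C₀ := by
  refine (h.bd x).trans ?_
  refine mul_le_of_le_one_right h.c_nonneg ?_
  refine inv_le_one_of_one_le₀ (one_le_pow₀ ?_)
  nlinarith [sq_nonneg ‖x‖]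

lemma Dens.integrable (hm : 1 ≤ m) {φ : Euc m → ℝ} {C₀ : ℝ} (h : Dens φ C₀) : Integrable φ := by
  refine ((integrable_japanese hm).const_mul C₀).mono' h.meas.aestronglyMeasurable
    (Filter.Eventually.of_forall fun x => ?_)
  rw [Real.norm_of_nonneg (h.nonneg x)]
  exact h.bd x

lemma log_one_add_le (r : ℝ) (hr : 0 ≤ r) : Real.log (1 + r) ≤ r := by
  have := Real.log_le_sub_one_of_pos (show 0 < 1 + r by linarith)
  linarith

lemma log_one_add_nonneg (r : ℝ) (hr : 0 ≤ r) : 0 ≤ Real.log (1 + r) :=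
  Real.log_nonneg (by linarith)

lemma Dens.integrable_log (hm : 1 ≤ m) {φ : Euc m → ℝ} {C₀ : ℝ} (h : Dens φ C₀) :
    Integrable (fun y => Real.log (1 + ‖y‖) * φ y) := by
  refine ((integrable_norm_japanese hm).const_mul C₀).mono' ?_
    (Filter.Eventually.of_forall fun x => ?_)
  · have := h.meas
    refine Measurable.aestronglyMeasurable ?_
    fun_prop
  · have h1 := log_one_add_nonneg _ (norm_nonneg x)
    have h2 := log_one_add_le _ (norm_nonneg x)
    rw [Real.norm_of_nonneg (mul_nonneg h1 (h.nonneg x))]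
    calc _ ≤ ‖x‖ * (C₀ * ((1 + ‖x‖^2)^(2*m))⁻¹) :=
          mul_le_mul h2 (h.bd x) (h.nonneg x) (norm_nonneg x)
      _ = _ := by ring

lemma Dens.inv_pot (hm : 1 ≤ m) {φ : Euc m → ℝ} {C₀ : ℝ} (h : Dens φ C₀) :
    ∃ C₁ : ℝ, 0 ≤ C₁ ∧ ∀ x, Integrable (fun y => ‖x - y‖⁻¹ * φ y) ∧
      ∫ y, ‖x - y‖⁻¹ * φ y ≤ C₁ := by
  set k : Euc m → ℝ := (closedBall (0 : Euc m) 1).indicator (fun z => ‖z‖⁻¹) with hk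
  have hki : Integrable k := by
    rw [hk, integrable_indicator_iff measurableSet_closedBall]
    exact (locInt_inv hm).integrableOn_isCompact (isCompact_closedBall _ _)
  have hk0 : ∀ z, 0 ≤ k z := fun z => Set.indicator_nonneg (fun z _ => by positivity) z
  have hle : ∀ x y, ‖x - y‖⁻¹ * φ y ≤ C₀ * k (x - y) + φ y := by
    intro x y
    by_cases hxy : ‖x - y‖ ≤ 1
    · have : k (x - y) = ‖x - y‖⁻¹ := Set.indicator_of_mem (by simpa using hxy) _
      rw [this]
      have h1 := mul_le_mul_of_nonneg_left (h.le y) (inv_nonneg.mpr (norm_nonneg (x - y)))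
      linarith [h.nonneg y]
    · have h1 : ‖x - y‖⁻¹ ≤ 1 := inv_le_one_of_one_le₀ (not_le.mp hxy).le
      have h2 := mul_le_mul_of_nonneg_right h1 (h.nonneg y)
      linarith [mul_nonneg h.c_nonneg (hk0 (x - y))]
  have hbi : ∀ x, Integrable (fun y => C₀ * k (x - y) + φ y) := fun x =>
    ((hki.comp_sub_left x).const_mul C₀).add (h.integrable hm)
  have hI : ∀ x, Integrable (fun y => ‖x - y‖⁻¹ * φ y) := by
    intro x
    refine (hbi x).mono' ?_ (Filter.Eventually.of_forall fun y => ?_)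
    · have := h.meas
      refine Measurable.aestronglyMeasurable ?_
      fun_prop
    · rw [Real.norm_of_nonneg (mul_nonneg (by positivity) (h.nonneg y))]
      exact hle x y
  refine ⟨C₀ * (∫ z, k z) + ∫ y, φ y, ?_, fun x => ⟨hI x, ?_⟩⟩
  · exact add_nonneg (mul_nonneg h.c_nonneg (integral_nonneg hk0)) (integral_nonneg h.nonneg)
  · refine (integral_mono (hI x) (hbi x) (hle x)).trans_eq ?_
    rw [integral_add ((hki.comp_sub_left x).const_mul C₀) (h.integrable hm), integral_const_mul,
      integral_sub_left_eq_self k volume x]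

lemma abs_log_le (x y : Euc m) :
    |Real.log ‖x - y‖| ≤ ‖x - y‖⁻¹ + Real.log (1 + ‖x‖) + Real.log (1 + ‖y‖) := by
  have hx := log_one_add_nonneg _ (norm_nonneg x)
  have hy := log_one_add_nonneg _ (norm_nonneg y)
  rcases eq_or_ne x y with rfl | hxy
  · simp; linarith
  · have hr : 0 < ‖x - y‖ := norm_pos_iff.mpr (sub_ne_zero.mpr hxy)
    have hi : 0 < ‖x - y‖⁻¹ := inv_pos.mpr hr
    rw [abs_le]
    constructor
    · linarith [neg_inv_le_log hr]
    · have h1 : Real.log ‖x - y‖ ≤ Real.log ((1 + ‖x‖) * (1 + ‖y‖)) := by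
        refine Real.log_le_log hr ?_
        have := norm_sub_le x y
        nlinarith [norm_nonneg x, norm_nonneg y]
      rw [Real.log_mul (by positivity) (by positivity)] at h1
      linarith

lemma abs_log_sub_le {a b : ℝ} (ha : 0 < a) (hb : 0 < b) :
    |Real.log a - Real.log b| ≤ |a - b| * (a⁻¹ + b⁻¹) := by
  have key : ∀ {a b : ℝ}, 0 < a → 0 < b → Real.log a - Real.log b ≤ |a - b| * (a⁻¹ + b⁻¹) := by
    intro a b ha hb
    rw [← Real.log_div ha.ne' hb.ne']
    have h1 := Real.log_le_sub_one_of_pos (div_pos ha hb)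
    have h2 : a / b - 1 = (a - b) * b⁻¹ := by field_simp
    rw [h2] at h1
    have h3 : (a - b) * b⁻¹ ≤ |a - b| * b⁻¹ := by
      gcongr
      exact le_abs_self _
    have h4 : 0 ≤ |a - b| * a⁻¹ := by positivity
    linarith
  rw [abs_le]
  constructor
  · have := key hb ha
    rw [abs_sub_comm] at this
    linarith
  · exact key ha hb

lemma ae_ne (hm : 1 ≤ m) (x : Euc m) : ∀ᵐ y : Euc m, y ≠ x := by
  have : Nonempty (Fin (2*m)) := ⟨⟨0, by omega⟩⟩
  have : Nontrivial (Euc m) := inferInstance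
  exact compl_mem_ae_iff.mpr (measure_singleton _)

/-- logarithmic potential -/
def logPot (φ : Euc m → ℝ) (x : Euc m) : ℝ := ∫ y, Real.log ‖x - y‖ * φ y

lemma Dens.log_int (hm : 1 ≤ m) {φ : Euc m → ℝ} {C₀ : ℝ} (h : Dens φ C₀) :
    ∃ D : ℝ, 0 ≤ D ∧ ∀ x, Integrable (fun y => Real.log ‖x - y‖ * φ y) ∧
      ∫ y, ‖Real.log ‖x - y‖ * φ y‖ ≤ D + (∫ y, φ y) * Real.log (1 + ‖x‖) := by
  obtain ⟨C₁, hC₁, hpot⟩ := h.inv_pot hm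
  have hle : ∀ x y, ‖Real.log ‖x - y‖ * φ y‖ ≤
      ‖x - y‖⁻¹ * φ y + Real.log (1 + ‖x‖) * φ y + Real.log (1 + ‖y‖) * φ y := by
    intro x y
    rw [norm_mul, Real.norm_eq_abs, Real.norm_of_nonneg (h.nonneg y)]
    have := mul_le_mul_of_nonneg_right (abs_log_le x y) (h.nonneg y)
    linarith
  have hi1 : ∀ x : Euc m, Integrable (fun y => ‖x - y‖⁻¹ * φ y + Real.log (1 + ‖x‖) * φ y) := fun x =>
    (hpot x).1.add ((h.integrable hm).const_mul _)
  have hi : ∀ x, Integrable (fun y => ‖x - y‖⁻¹ * φ y + Real.log (1 + ‖x‖) * φ y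
      + Real.log (1 + ‖y‖) * φ y) := fun x => (hi1 x).add (h.integrable_log hm)
  have hI : ∀ x, Integrable (fun y => Real.log ‖x - y‖ * φ y) := by
    intro x
    refine (hi x).mono' ?_ (Filter.Eventually.of_forall (hle x))
    have := h.meas
    refine Measurable.aestronglyMeasurable ?_
    fun_prop
  refine ⟨C₁ + ∫ y, Real.log (1 + ‖y‖) * φ y, ?_, fun x => ⟨hI x, ?_⟩⟩
  · refine add_nonneg hC₁ (integral_nonneg fun y => ?_)
    exact mul_nonneg (log_one_add_nonneg _ (norm_nonneg y)) (h.nonneg y)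
  · refine (integral_mono (hI x).norm (hi x) (hle x)).trans ?_
    rw [integral_add (hi1 x) (h.integrable_log hm),
      integral_add (hpot x).1 ((h.integrable hm).const_mul _), integral_const_mul]
    linarith [(hpot x).2]

lemma Dens.continuous_logPot (hm : 1 ≤ m) {φ : Euc m → ℝ} {C₀ : ℝ} (h : Dens φ C₀) :
    Continuous (logPot φ) := by
  obtain ⟨C₁, hC₁, hpot⟩ := h.inv_pot hm
  obtain ⟨D, hD, hlog⟩ := h.log_int hm
  refine (LipschitzWith.of_dist_le_mul (K := Real.toNNReal (2 * C₁)) fun x x' => ?_).continuous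
  rw [dist_eq_norm, dist_eq_norm]
  unfold logPot
  rw [← integral_sub (hlog x).1 (hlog x').1]
  have hb : Integrable (fun y => ‖x - x'‖ * (‖x - y‖⁻¹ * φ y + ‖x' - y‖⁻¹ * φ y)) :=
    ((hpot x).1.add (hpot x').1).const_mul _
  refine (norm_integral_le_of_norm_le hb ?_).trans ?_
  · filter_upwards [ae_ne hm x, ae_ne hm x'] with y hy hy'
    have h1 : 0 < ‖x - y‖ := norm_pos_iff.mpr (sub_ne_zero.mpr hy.symm)
    have h2 : 0 < ‖x' - y‖ := norm_pos_iff.mpr (sub_ne_zero.mpr hy'.symm)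
    rw [← sub_mul, norm_mul, Real.norm_eq_abs, Real.norm_of_nonneg (h.nonneg y)]
    have h3 := abs_log_sub_le h1 h2
    have h4 : |‖x - y‖ - ‖x' - y‖| ≤ ‖x - x'‖ := by
      have := abs_norm_sub_norm_le (x - y) (x' - y)
      simpa using this
    have h5 : |Real.log ‖x - y‖ - Real.log ‖x' - y‖| ≤ ‖x - x'‖ * (‖x - y‖⁻¹ + ‖x' - y‖⁻¹) :=
      h3.trans (by gcongr)
    have := mul_le_mul_of_nonneg_right h5 (h.nonneg y)
    linarith
  · rw [integral_const_mul, integral_add (hpot x).1 (hpot x').1]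
    have h1 := (hpot x).2
    have h2 := (hpot x').2
    have h3 := norm_nonneg (x - x')
    rw [Real.coe_toNNReal _ (by positivity)]
    nlinarith

lemma Dens.weak_logPot (hm : 1 ≤ m) {φ : Euc m → ℝ} {C₀ : ℝ} (h : Dens φ C₀)
    {ψ : Euc m → ℝ} (hψ : ContDiff ℝ (⊤ : ℕ∞) ψ) (hc : HasCompactSupport ψ) :
    ∫ x, logPot φ x * negLapPow m ψ x = -(gamma2m m * ∫ y, φ y * ψ y) := by
  obtain ⟨D, hD, hlog⟩ := h.log_int hm
  set P := negLapPow m ψ with hP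
  have hPc : Continuous P := (nlp_smooth m hψ).continuous
  have hPs : HasCompactSupport P := nlp_hcs m hc
  have hφ := h.meas
  have hPm := hPc.measurable
  have hmeas : AEStronglyMeasurable (Function.uncurry fun (x y : Euc m) =>
      Real.log ‖x - y‖ * φ y * P x) (volume.prod volume) := by
    refine Measurable.aestronglyMeasurable ?_
    unfold Function.uncurry
    fun_prop
  have hint : Integrable (Function.uncurry fun (x y : Euc m) =>
      Real.log ‖x - y‖ * φ y * P x) (volume.prod volume) := by
    rw [integrable_prod_iff hmeas]
    constructor
    · exact Filter.Eventually.of_forall fun x => (hlog x).1.mul_const (P x)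
    · have hb : Integrable (fun x => (D + (∫ y, φ y) * Real.log (1 + ‖x‖)) * ‖P x‖) := by
        refine Continuous.integrable_of_hasCompactSupport ?_ hPs.norm.mul_left
        have : Continuous fun x : Euc m => Real.log (1 + ‖x‖) :=
          Continuous.log (by fun_prop) fun x => by positivity
        fun_prop
      refine hb.mono' hmeas.norm.integral_prod_right' (Filter.Eventually.of_forall fun x => ?_)
      simp only [Function.uncurry]
      rw [Real.norm_of_nonneg (integral_nonneg fun y => norm_nonneg _)]
      have : ∀ y, ‖Real.log ‖x - y‖ * φ y * P x‖ = ‖Real.log ‖x - y‖ * φ y‖ * ‖P x‖ := fun y =>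
        norm_mul _ _
      simp only [this]
      rw [integral_mul_const]
      exact mul_le_mul_of_nonneg_right (hlog x).2 (norm_nonneg _)
  have hsw := integral_integral_swap hint
  have e1 : ∀ x, ∫ y, Real.log ‖x - y‖ * φ y * P x = logPot φ x * P x := fun x =>
    integral_mul_const _ _
  have e2 : ∀ y, ∫ x, Real.log ‖x - y‖ * φ y * P x = -(gamma2m m) * (φ y * ψ y) := by
    intro y
    have : ∀ x, Real.log ‖x - y‖ * φ y * P x = φ y * (Real.log ‖x - y‖ * P x) := fun x => by ring
    simp only [this]
    rw [integral_const_mul, hP, fund hm hψ hc y]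
    ring
  simp only [e1, e2] at hsw
  rw [hsw, integral_const_mul]
  ring

lemma bounded_of_lim {w : Euc m → ℝ} (hw : Continuous w)
    (hwlim : ∃ L : ℝ, Tendsto w (cocompact (Euc m)) (𝓝 L)) : ∃ W : ℝ, ∀ x, |w x| ≤ W := by
  obtain ⟨L, hL⟩ := hwlim
  have h1 : ∀ᶠ x in cocompact (Euc m), |w x| < |L| + 1 :=
    (hL.abs).eventually (gt_mem_nhds (by linarith))
  obtain ⟨s, hs, hsub⟩ := mem_cocompact.mp h1
  obtain ⟨B, hB⟩ := hs.exists_bound_of_continuousOn hw.continuousOn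
  refine ⟨max B (|L| + 1), fun x => ?_⟩
  by_cases hx : x ∈ s
  · exact le_max_of_le_left (hB x hx)
  · exact le_max_of_le_right (le_of_lt (hsub hx))

end part5
/-- **Proposition (integral representation formula).** Under the hypotheses of the
existence proposition, if moreover `f = (−Δ)^m g` with `g ∈ C^{2m}(ℝ^{2m})` and
`g(x) = O(log|x|)`, then any solution `w ∈ C^{2m−1}` with constant `c_w`, total curvature
`Λ` and finite limit at infinity satisfies
`w(x) = γ_{2m}⁻¹ ∫ log((1+|y|)/|x−y|) K(y) e^{2m(w(y)+c_w)} dy − g(x) + C`. -/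
theorem statement8 (m : ℕ) (hm : 1 ≤ m)
    (w₀ : Euc m → ℝ) (hw₀ : ∀ x : Euc m, w₀ x = Real.log (2 / (1 + ‖x‖^2)))
    (K f : Euc m → ℝ) (hKmeas : Measurable K) (hfmeas : Measurable f)
    (hKpos : ∀ x, 0 ≤ K x) (hKne : ¬ (K =ᵐ[volume] 0))
    (hKbd : ∃ C : ℝ, ∀ x, K x * Real.exp (-(2*m : ℝ) * w₀ x) ≤ C)
    (hfbd : ∃ C : ℝ, ∀ x, |f x| * Real.exp (-(2*m : ℝ) * w₀ x) ≤ C)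
    (hfint : Integrable f)
    (Λ : ℝ) (hΛdef : Λ = ∫ x, f x) (hΛpos : 0 < Λ) (hΛlt : Λ < Lambda1 m)
    (g : Euc m → ℝ) (hg : ContDiff ℝ (2*m : ℕ) g)
    (hfg : ∀ x, f x = negLapPow m g x)
    (hgO : ∃ A B : ℝ, ∀ x : Euc m, |g x| ≤ A * Real.log (2 + ‖x‖) + B)
    (w : Euc m → ℝ) (c : ℝ) (hw : ContDiff ℝ (2*m - 1 : ℕ) w)
    (hweq : ∀ ψ : Euc m → ℝ, ContDiff ℝ (⊤ : ℕ∞) ψ → HasCompactSupport ψ →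
      ∫ x, w x * negLapPow m ψ x
        = ∫ x, (K x * Real.exp ((2*m : ℝ) * (w x + c)) - f x) * ψ x)
    (hwint : Integrable (fun x => K x * Real.exp ((2*m : ℝ) * (w x + c))))
    (hwvol : (∫ x, K x * Real.exp ((2*m : ℝ) * (w x + c))) = Λ)
    (hwlim : ∃ L : ℝ, Tendsto w (cocompact (Euc m)) (𝓝 L)) :
    ∃ C : ℝ, ∀ x : Euc m,
      w x = (1 / gamma2m m) *
          (∫ y, Real.log ((1 + ‖y‖) / ‖x - y‖) * (K y * Real.exp ((2*m : ℝ) * (w y + c))))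
        - g x + C := by
  have hwc : Continuous w := hw.continuous
  obtain ⟨W, hW⟩ := bounded_of_lim hwc hwlim
  obtain ⟨C, hC⟩ := hKbd
  set φ : Euc m → ℝ := fun y => K y * Real.exp ((2*m : ℝ) * (w y + c)) with hφ
  have hexp : ∀ x : Euc m, Real.exp (-(2*m : ℝ) * w₀ x) = (1 + ‖x‖^2)^(2*m) / 2^(2*m) := by
    intro x
    have ht : 0 < 2 / (1 + ‖x‖^2) := by positivity
    have e : (2*m : ℝ) = ((2*m : ℕ) : ℝ) := by push_cast; ring
    rw [hw₀, neg_mul, Real.exp_neg, e, Real.exp_nat_mul, Real.exp_log ht, div_pow, inv_div]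
  have hD : Dens φ (C * 2^(2*m) * Real.exp ((2*m : ℝ) * (W + |c|))) := by
    refine ⟨?_, fun x => mul_nonneg (hKpos x) (Real.exp_pos _).le, fun x => ?_⟩
    · have := hwc.measurable
      rw [hφ]
      fun_prop
    · have h1 := hC x
      rw [hexp] at h1
      have hp : 0 < (1 + ‖x‖^2)^(2*m) := by positivity
      have h2 : K x ≤ C * 2^(2*m) * ((1 + ‖x‖^2)^(2*m))⁻¹ := by
        rw [← div_eq_mul_inv, le_div_iff₀ hp]
        rwa [← mul_div_assoc, div_le_iff₀ (by positivity)] at h1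
      have h3 : Real.exp ((2*m : ℝ) * (w x + c)) ≤ Real.exp ((2*m : ℝ) * (W + |c|)) := by
        have := (le_abs_self (w x)).trans (hW x)
        have := le_abs_self c
        gcongr
      have h4 := mul_le_mul h2 h3 (Real.exp_pos _).le ((hKpos x).trans h2)
      calc φ x ≤ _ := h4
        _ = _ := by ring
  have hγ := gamma_pos hm
  obtain ⟨D, hD0, hlog⟩ := hD.log_int hm
  have hφ0 : 0 ≤ ∫ y, φ y := integral_nonneg hD.nonneg
  have hLc := hD.continuous_logPot hm
  have hgc : Continuous g := hg.continuous
  have hφi := hD.integrable hm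
  have hconst := liouville hm (h := fun x => w x + g x + (gamma2m m)⁻¹ * logPot φ x)
    (by fun_prop) (by
      obtain ⟨A, B, hAB⟩ := hgO
      refine ⟨A + (gamma2m m)⁻¹ * ∫ y, φ y, W + B + (gamma2m m)⁻¹ * D, fun x => ?_⟩
      have h1 : |logPot φ x| ≤ D + (∫ y, φ y) * Real.log (2 + ‖x‖) := by
        have h2 : |logPot φ x| ≤ ∫ y, ‖Real.log ‖x - y‖ * φ y‖ :=
          norm_integral_le_integral_norm (fun y => Real.log ‖x - y‖ * φ y)
        have h3 : Real.log (1 + ‖x‖) ≤ Real.log (2 + ‖x‖) :=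
          Real.log_le_log (by positivity) (by linarith)
        have h4 := mul_le_mul_of_nonneg_left h3 hφ0
        linarith [(hlog x).2]
      have h5 := abs_add_le (w x + g x) ((gamma2m m)⁻¹ * logPot φ x)
      have h6 := abs_add_le (w x) (g x)
      rw [abs_mul, abs_of_pos (inv_pos.mpr hγ)] at h5
      have h7 := mul_le_mul_of_nonneg_left h1 (inv_pos.mpr hγ).le
      have h8 := hAB x
      have h9 := hW x
      calc _ ≤ _ := h5
        _ ≤ W + (A * Real.log (2 + ‖x‖) + B)
          + (gamma2m m)⁻¹ * (D + (∫ y, φ y) * Real.log (2 + ‖x‖)) := by linarith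
        _ = _ := by ring) (by
      intro ψ hψ hc
      have hPc : Continuous (negLapPow m ψ) := (nlp_smooth m hψ).continuous
      have hPs : HasCompactSupport (negLapPow m ψ) := nlp_hcs m hc
      have i1 : Integrable (fun x => w x * negLapPow m ψ x) :=
        (hwc.mul hPc).integrable_of_hasCompactSupport hPs.mul_left
      have i2 : Integrable (fun x => g x * negLapPow m ψ x) :=
        (hgc.mul hPc).integrable_of_hasCompactSupport hPs.mul_left
      have i3 : Integrable (fun x => logPot φ x * negLapPow m ψ x) :=
        (hLc.mul hPc).integrable_of_hasCompactSupport hPs.mul_left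
      obtain ⟨M, hM⟩ := hc.exists_bound_of_continuous hψ.continuous
      have j1 : Integrable (fun x => φ x * ψ x) :=
        hφi.mul_bdd (c := M) hψ.continuous.aestronglyMeasurable (Filter.Eventually.of_forall hM)
      have j2 : Integrable (fun x => f x * ψ x) :=
        hfint.mul_bdd (c := M) hψ.continuous.aestronglyMeasurable (Filter.Eventually.of_forall hM)
      have e0 : (fun x => (w x + g x + (gamma2m m)⁻¹ * logPot φ x) * negLapPow m ψ x)
          = fun x => w x * negLapPow m ψ x + g x * negLapPow m ψ x
            + (gamma2m m)⁻¹ * (logPot φ x * negLapPow m ψ x) := by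
        funext x; ring
      have e1 : ∫ x, w x * negLapPow m ψ x = (∫ x, φ x * ψ x) - ∫ x, f x * ψ x := by
        rw [hweq ψ hψ hc, ← integral_sub j1 j2]
        simp only [sub_mul, hφ]
      have e2 : ∫ x, g x * negLapPow m ψ x = ∫ x, f x * ψ x := by
        rw [nlp_ibp m hg hψ hc]
        simp only [hfg]
      have i12 : Integrable (fun x => w x * negLapPow m ψ x + g x * negLapPow m ψ x) := i1.add i2
      rw [e0, integral_add i12 (i3.const_mul _), integral_add i1 i2, integral_const_mul,
        hD.weak_logPot hm hψ hc, e1, e2]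
      field_simp
      ring)
  have hli := hD.integrable_log hm
  refine ⟨(w 0 + g 0 + (gamma2m m)⁻¹ * logPot φ 0)
    - (1 / gamma2m m) * ∫ y, Real.log (1 + ‖y‖) * φ y, fun x => ?_⟩
  have e3 : ∫ y, Real.log ((1 + ‖y‖) / ‖x - y‖) * φ y
      = (∫ y, Real.log (1 + ‖y‖) * φ y) - logPot φ x := by
    unfold logPot
    rw [← integral_sub hli (hlog x).1]
    refine integral_congr_ae ?_
    filter_upwards [ae_ne hm x] with y hy
    have : ‖x - y‖ ≠ 0 := norm_ne_zero_iff.mpr (sub_ne_zero.mpr hy.symm)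
    rw [Real.log_div (by positivity) this]
    ring
  have h0 : w x + g x + (gamma2m m)⁻¹ * logPot φ x
      = w 0 + g 0 + (gamma2m m)⁻¹ * logPot φ 0 := hconst x 0
  change w x = (1 / gamma2m m) * (∫ y, Real.log ((1 + ‖y‖) / ‖x - y‖) * φ y) - g x + _
  rw [e3, ← h0]
  ring
end
end

section
/- Let m ≥ 1 be an integer, Ω ⊂ ℝ^{2m} a domain, φ ∈ K(Ω,∅), β > 0, and 0 < Λ < Λ₁/2. Let V_k : Ω → ℝ be measurable with 0 ≤ V_k ≤ b < ∞, and suppose there exists x₀ ∈ S_φ^* such that liminf_{k→∞} ∫_{B_ε(x₀)∩Ω} V_k dx > 0 for every ε > 0. Let (u_k)_{k∈ℕ} be measurable functions on Ω ∪ S_φ^* and (c_k) ⊂ ℝ satisfying u_k(x) = γ_{2m}^{−1} ∫_Ω log((1+|y|)/|x−y|) V_k(y) e^{2m u_k(y)} dy − β|x|² + k φ(x) + c_k for all x ∈ Ω ∪ S_φ^* and ∫_Ω V_k e^{2m u_k} dy = Λ for all k. Then: (i) c_k → ∞ and c_k/k → 0 as k → ∞; (ii) the potentials I_k(x) := γ_{2m}^{−1}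 ∫_Ω log((1+|y|)/|x−y|) V_k(y) e^{2m u_k(y)} dy are uniformly bounded from above on compact subsets of Ω \ S_φ and uniformly bounded from below on compact subsets of ℝ^{2m}; (iii) u_k → +∞ pointwise on S_φ^* and u_k → −∞ locally uniformly on Ω \ S_φ. -/
noncomputable section

open MeasureTheory Real Filter Topology Metric Set Bornology

section
open MeasureTheory Real Filter Topology Metric Set Bornology

/-- directional derivative -/
def dirD {m : ℕ} (e : Euc m) (f : Euc m → ℝ) : Euc m → ℝ := fun x => fderiv ℝ f x e

lemma dirD_smooth {m : ℕ} (e : Euc m) {f : Euc m → ℝ} (hf : ContDiff ℝ (⊤ : ℕ∞) f) :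
    ContDiff ℝ (⊤ : ℕ∞) (dirD e f) :=
  ((contDiff_infty_iff_fderiv.1 hf).2).clm_apply contDiff_const

lemma lap_eq {m : ℕ} (f : Euc m → ℝ) :
    lap f = fun x => ∑ i : Fin (2*m), dirD (EuclideanSpace.single i (1:ℝ))
      (dirD (EuclideanSpace.single i (1:ℝ)) f) x := rfl

lemma lap_smooth {m : ℕ} {f : Euc m → ℝ} (hf : ContDiff ℝ (⊤ : ℕ∞) f) :
    ContDiff ℝ (⊤ : ℕ∞) (lap f) := by
  rw [lap_eq]
  exact ContDiff.sum fun i _ => dirD_smooth _ (dirD_smooth _ hf)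

lemma dirD_comm {m : ℕ} (e e' : Euc m) {f : Euc m → ℝ} (hf : ContDiff ℝ (⊤ : ℕ∞) f) :
    dirD e (dirD e' f) = dirD e' (dirD e f) := by
  have hd : Differentiable ℝ (fderiv ℝ f) :=
    (contDiff_infty_iff_fderiv.1 (contDiff_infty_iff_fderiv.1 hf).2).1
  ext x
  have h1 : ∀ a b : Euc m, dirD a (dirD b f) x = fderiv ℝ (fderiv ℝ f) x a b := by
    intro a b
    unfold dirD
    rw [fderiv_clm_apply hd.differentiableAt (differentiableAt_const _)]
    simp
  rw [h1, h1]
  have := (hf.contDiffAt (x := x)).isSymmSndFDerivAt (by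
    rw [minSmoothness_of_isRCLikeNormedField]; 
    exact WithTop.coe_le_coe.2 (le_top : (2:ℕ∞) ≤ ⊤))
  exact this e e'

lemma lap_dirD {m : ℕ} (e : Euc m) {f : Euc m → ℝ} (hf : ContDiff ℝ (⊤ : ℕ∞) f) :
    lap (dirD e f) = dirD e (lap f) := by
  ext x
  rw [lap_eq, lap_eq]
  conv_rhs => unfold dirD
  rw [fderiv_fun_sum]
  · rw [_root_.sum_apply]
    refine Finset.sum_congr rfl fun i _ => ?_
    rw [dirD_comm _ e hf, dirD_comm _ e (dirD_smooth _ hf)]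
    rfl
  · intro i _
    exact ((dirD_smooth _ (dirD_smooth _ hf)).differentiable (by simp)).differentiableAt

lemma negLapPow_succ {m : ℕ} (j : ℕ) (f : Euc m → ℝ) :
    negLapPow (j+1) f = negLapPow j (fun x => -(lap f x)) := rfl

lemma neglap_dirD {m : ℕ} (e : Euc m) {f : Euc m → ℝ} (hf : ContDiff ℝ (⊤ : ℕ∞) f) :
    (fun x => -(lap (dirD e f) x)) = dirD e (fun x => -(lap f x)) := by
  rw [lap_dirD e hf]
  ext x
  simp only [dirD]
  rw [fderiv_fun_neg]; simp

lemma negLapPow_dirD {m : ℕ} (e : Euc m) (j : ℕ) : ∀ {f : Euc m → ℝ} (_ : ContDiff ℝ (⊤ : ℕ∞) f),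
    negLapPow j (dirD e f) = dirD e (negLapPow j f) := by
  induction j with
  | zero => intro f hf; rfl
  | succ j ih =>
    intro f hf
    rw [negLapPow_succ, negLapPow_succ, neglap_dirD e hf, ih (lap_smooth hf).neg]

lemma negLapPow_dirD_zero {m : ℕ} (e : Euc m) (j : ℕ) {f : Euc m → ℝ} (hf : ContDiff ℝ (⊤ : ℕ∞) f)
    {U : Set (Euc m)} (hU : IsOpen U) (h : ∀ x ∈ U, negLapPow j f x = 0) :
    ∀ x ∈ U, negLapPow j (dirD e f) x = 0 := by
  intro x hx
  rw [negLapPow_dirD e j hf]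
  have : negLapPow j f =ᶠ[𝓝 x] fun _ => 0 := by
    filter_upwards [hU.mem_nhds hx] with y hy using h y hy
  simp [dirD, this.fderiv_eq]

lemma negLapPow_congr {m : ℕ} {U : Set (Euc m)} (hU : IsOpen U) (j : ℕ) :
    ∀ {f g : Euc m → ℝ} (_ : ∀ x ∈ U, f x = g x), ∀ x ∈ U, negLapPow j f x = negLapPow j g x := by
  induction j with
  | zero => intro f g h; exact h
  | succ j ih =>
    intro f g h
    rw [negLapPow_succ, negLapPow_succ]
    apply ih
    have hd : ∀ {f g : Euc m → ℝ} (e : Euc m), (∀ x ∈ U, f x = g x) →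
        ∀ x ∈ U, dirD e f x = dirD e g x := by
      intro f g e h x hx
      have : f =ᶠ[𝓝 x] g := by
        filter_upwards [hU.mem_nhds hx] with y hy using h y hy
      simp [dirD, this.fderiv_eq]
    intro x hx
    rw [lap_eq, lap_eq]
    congr 1
    exact Finset.sum_congr rfl fun i _ => hd _ (hd _ h) x hx

/-- radial cutoffs -/
def IsProf (h : ℝ → ℝ) : Prop := ContDiff ℝ 1 h ∧ ∀ s, 1 ≤ s → h s = 0

lemma prof_integral {h : ℝ → ℝ} (hh : IsProf h) : ∃ H : ℝ → ℝ, IsProf H ∧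
    ∀ s, HasDerivAt H (-(h s)/2) s := by
  have hd : ∀ s, HasDerivAt (fun s => -(1/2) * ∫ t in (1:ℝ)..s, h t) (-(h s)/2) s := by
    intro s
    have := (intervalIntegral.integral_hasDerivAt_right (hh.1.continuous.intervalIntegrable 1 s)
      (hh.1.continuous.stronglyMeasurableAtFilter _ _) hh.1.continuous.continuousAt).const_mul (-(1/2))
    exact this.congr_deriv (by ring)
  refine ⟨_, ⟨?_, ?_⟩, hd⟩
  · rw [contDiff_one_iff_deriv]
    refine ⟨fun s => (hd s).differentiableAt, ?_⟩
    have : deriv (fun s => -(1/2) * ∫ t in (1:ℝ)..s, h t) = fun s => -(h s)/2 :=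
      funext fun s => (hd s).deriv
    rw [this]
    exact hh.1.continuous.neg.div_const 2
  · intro s hs
    have : ∫ t in (1:ℝ)..s, h t = ∫ t in (1:ℝ)..s, (0:ℝ) := by
      apply intervalIntegral.integral_congr
      intro t ht
      rw [uIcc_of_le hs] at ht
      exact hh.2 t ht.1
    simp [this]

lemma prof_cpt {m : ℕ} {h : ℝ → ℝ} (hh : IsProf h) :
    HasCompactSupport (fun z : Euc m => h (‖z‖^2)) := by
  apply HasCompactSupport.intro (isCompact_closedBall (0 : Euc m) 1)
  intro z hz
  apply hh.2
  simp only [mem_closedBall, dist_zero_right, not_le] at hz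
  nlinarith

lemma prof_contDiff {m : ℕ} {h : ℝ → ℝ} (hh : IsProf h) :
    ContDiff ℝ 1 (fun z : Euc m => h (‖z‖^2)) := hh.1.comp (contDiff_norm_sq ℝ)

/-- radial average -/
def avg {m : ℕ} (h : ℝ → ℝ) (f : Euc m → ℝ) (x : Euc m) (r : ℝ) : ℝ :=
  ∫ z : Euc m, h (‖z‖^2) * f (x + r • z)

lemma avg_hasDerivAt {m : ℕ} {h : ℝ → ℝ} (hh : IsProf h) {f : Euc m → ℝ}
    (hf : ContDiff ℝ (⊤ : ℕ∞) f) (x : Euc m) (r : ℝ) :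
    HasDerivAt (avg h f x) (∫ z : Euc m, h (‖z‖^2) * fderiv ℝ f (x + r • z) z) r := by
  have hη := (prof_contDiff (m := m) hh).continuous
  have hηc := prof_cpt (m := m) hh
  have hfc := hf.continuous
  have hf'c : Continuous (fderiv ℝ f) := hf.continuous_fderiv (by simp)
  have hK : IsCompact ((Icc (r-1) (r+1)) ×ˢ (closedBall (0:Euc m) 1)) :=
    isCompact_Icc.prod (isCompact_closedBall _ _)
  have hcont : Continuous (fun q : ℝ × Euc m => fderiv ℝ f (x + q.1 • q.2) q.2) := by
    exact (hf'c.comp (by fun_prop)).clm_apply continuous_snd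
  obtain ⟨M, hM⟩ := hK.exists_bound_of_continuousOn hcont.continuousOn
  refine (hasDerivAt_integral_of_dominated_loc_of_deriv_le (μ := volume)
    (F := fun r z => h (‖z‖^2) * f (x + r • z))
    (F' := fun r z => h (‖z‖^2) * fderiv ℝ f (x + r • z) z)
    (bound := fun z => |h (‖z‖^2)| * M) (s := Icc (r-1) (r+1)) (Icc_mem_nhds (by linarith) (by linarith))
    ?_ ?_ ?_ ?_ ?_ ?_).2
  · refine Eventually.of_forall fun r => ?_
    exact (hη.mul (hfc.comp (by fun_prop))).aestronglyMeasurable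
  · exact (hη.mul (hfc.comp (by fun_prop))).integrable_of_hasCompactSupport hηc.mul_right
  · exact (hη.mul (hcont.comp (by fun_prop : Continuous fun z : Euc m => (r, z)))).aestronglyMeasurable
  · refine Eventually.of_forall fun z s hs => ?_
    rw [norm_mul, Real.norm_eq_abs]
    by_cases hz : z ∈ closedBall (0:Euc m) 1
    · exact mul_le_mul_of_nonneg_left (hM (s, z) ⟨hs, hz⟩) (abs_nonneg _)
    · have : h (‖z‖^2) = 0 := by
        apply hh.2
        simp only [mem_closedBall, dist_zero_right, not_le] at hz
        nlinarith
      simp [this]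
  · exact (hη.abs.mul continuous_const).integrable_of_hasCompactSupport
      (HasCompactSupport.mul_right (hηc.comp_left (g := fun t => |t|) (by simp)))
  · refine Eventually.of_forall fun z s hs => ?_
    have h1 : HasDerivAt (fun s : ℝ => x + s • z) z s := by
      have := ((hasDerivAt_id s).smul_const z).const_add x
      simpa using this
    have h2 := (((hf.differentiable (by simp)) (x + s • z)).hasFDerivAt).comp_hasDerivAt s h1
    exact h2.const_mul _

lemma single_expand {m : ℕ} (z : Euc m) (L : Euc m →L[ℝ] ℝ) :
    L z = ∑ i : Fin (2*m), z i * L (EuclideanSpace.single i (1:ℝ)) := by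
  have hz : z = ∑ i : Fin (2*m), z i • EuclideanSpace.single i (1:ℝ) := by
    ext j
    simp [Finset.sum_apply, Pi.single_apply]
  conv_lhs => rw [hz]
  rw [map_sum]
  simp

lemma ibp {m : ℕ} {F g : Euc m → ℝ} (hF : ContDiff ℝ 1 F) (hFc : HasCompactSupport F)
    (hg : ContDiff ℝ 1 g) (e : Euc m) :
    ∫ x, F x * fderiv ℝ g x e = - ∫ x, fderiv ℝ F x e * g x := by
  have h1 : Continuous fun x => fderiv ℝ F x e :=
    (hF.continuous_fderiv (by simp)).clm_apply continuous_const
  have h2 : Continuous fun x => fderiv ℝ g x e :=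
    (hg.continuous_fderiv (by simp)).clm_apply continuous_const
  apply integral_mul_fderiv_eq_neg_fderiv_mul_of_integrable
  · refine (h1.mul hg.continuous).integrable_of_hasCompactSupport (HasCompactSupport.mul_right ?_)
    exact hFc.fderiv_apply (𝕜 := ℝ) e
  · exact (hF.continuous.mul h2).integrable_of_hasCompactSupport hFc.mul_right
  · exact (hF.continuous.mul hg.continuous).integrable_of_hasCompactSupport hFc.mul_right
  · intro x _; exact (hF.differentiable (by simp)).differentiableAt
  · intro x _; exact (hg.differentiable (by simp)).differentiableAt

lemma fderiv_affine {m : ℕ} {f : Euc m → ℝ} (hf : Differentiable ℝ f) (x z e : Euc m) (r : ℝ) :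
    fderiv ℝ (fun z => f (x + r • z)) z e = r * fderiv ℝ f (x + r • z) e := by
  have h1 : HasFDerivAt (fun z : Euc m => x + r • z) (r • ContinuousLinearMap.id ℝ (Euc m)) z :=
    ((hasFDerivAt_id z).const_smul r).const_add x
  have h2 := ((hf (x + r • z)).hasFDerivAt).comp z h1
  have h3 : fderiv ℝ (fun z => f (x + r • z)) z = _ := h2.fderiv
  rw [h3]; simp

lemma smooth_affine {m : ℕ} {f : Euc m → ℝ} (hf : ContDiff ℝ (⊤ : ℕ∞) f) (x : Euc m) (r : ℝ) :
    ContDiff ℝ (⊤ : ℕ∞) (fun z => f (x + r • z)) := by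
  apply hf.comp; fun_prop

lemma avg_deriv_eq {m : ℕ} {h H : ℝ → ℝ} (hh : IsProf h) (hH : IsProf H)
    (hd : ∀ s, HasDerivAt H (-(h s)/2) s) {f : Euc m → ℝ}
    (hf : ContDiff ℝ (⊤ : ℕ∞) f) (x : Euc m) (r : ℝ) :
    (∫ z : Euc m, h (‖z‖^2) * fderiv ℝ f (x + r • z) z) = r * avg H (lap f) x r := by
  have hη := (prof_contDiff (m := m) hh).continuous
  have hηc := prof_cpt (m := m) hh
  have hHf : ∀ z e : Euc m, fderiv ℝ (fun z : Euc m => H (‖z‖^2)) z e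
      = - (h (‖z‖^2) * inner ℝ z e) := by
    intro z e
    have h1 := (hasStrictFDerivAt_norm_sq (F := Euc m) z).hasFDerivAt
    have h2 : HasFDerivAt (fun z : Euc m => H (‖z‖^2)) _ z := (hd (‖z‖^2)).comp_hasFDerivAt z h1
    rw [h2.fderiv]
    simp
    ring
  have e1 : ∀ z : Euc m, h (‖z‖^2) * fderiv ℝ f (x + r • z) z =
      ∑ i : Fin (2*m), - (fderiv ℝ (fun z : Euc m => H (‖z‖^2)) z (EuclideanSpace.single i (1:ℝ)) *
        dirD (EuclideanSpace.single i (1:ℝ)) f (x + r • z)) := by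
    intro z
    rw [single_expand z, Finset.mul_sum]
    refine Finset.sum_congr rfl fun i _ => ?_
    rw [hHf]
    simp [dirD, EuclideanSpace.inner_single_right]
    ring
  simp_rw [e1]
  have hHc := prof_contDiff (m := m) hH
  have hint : ∀ i : Fin (2*m), ∫ z : Euc m, - (fderiv ℝ (fun z : Euc m => H (‖z‖^2)) z (EuclideanSpace.single i (1:ℝ)) *
        dirD (EuclideanSpace.single i (1:ℝ)) f (x + r • z)) =
      ∫ z : Euc m, H (‖z‖^2) * (r * dirD (EuclideanSpace.single i (1:ℝ)) (dirD (EuclideanSpace.single i (1:ℝ)) f) (x + r • z)) := by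
    intro i
    rw [integral_neg, ← ibp hHc (prof_cpt hH) ((smooth_affine (dirD_smooth _ hf) x r).of_le (by norm_cast))]
    refine integral_congr_ae (Eventually.of_forall fun z => ?_)
    simp only
    rw [fderiv_affine ((dirD_smooth _ hf).differentiable (by simp))]
    rfl
  rw [integral_finsetSum]
  · simp_rw [hint]
    rw [← integral_finsetSum]
    · unfold avg
      rw [← integral_const_mul]
      refine integral_congr_ae (Eventually.of_forall fun z => ?_)
      simp only [lap_eq, Finset.mul_sum]
      refine Finset.sum_congr rfl fun i _ => by ring
    · intro i _
      refine (Continuous.mul hHc.continuous (continuous_const.mul ?_)).integrable_of_hasCompactSupport (prof_cpt hH).mul_right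
      exact (smooth_affine (dirD_smooth _ (dirD_smooth _ hf)) x r).continuous
  · intro i _
    apply Integrable.neg
    refine (Continuous.mul ?_ ?_).integrable_of_hasCompactSupport
      (HasCompactSupport.mul_right ((prof_cpt hH).fderiv_apply (𝕜 := ℝ) _))
    · exact (hHc.continuous_fderiv (by simp)).clm_apply continuous_const
    · exact (smooth_affine (dirD_smooth _ hf) x r).continuous
end

section
open MeasureTheory Real Filter Topology Metric Set Bornology

lemma avg_zero {m : ℕ} (h : ℝ → ℝ) (f : Euc m → ℝ) (x : Euc m) :
    avg h f x 0 = (∫ z : Euc m, h (‖z‖^2)) * f x := by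
  simp [avg, integral_mul_const]

lemma avg_poly {m : ℕ} (x : Euc m) {R : ℝ} (hR : 0 < R) (j : ℕ) :
    ∀ {f : Euc m → ℝ} (_ : ContDiff ℝ (⊤ : ℕ∞) f) (_ : ∀ y ∈ ball x R, negLapPow j f y = 0)
      {h : ℝ → ℝ} (_ : IsProf h), ∃ a : ℕ → ℝ, (∑ i ∈ Finset.range j, a i * (0:ℝ)^i) = (∫ z : Euc m, h (‖z‖^2)) * f x ∧
      ∀ r ∈ Ico 0 R, avg h f x r = ∑ i ∈ Finset.range j, a i * (r^2)^i := by
  induction j with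
  | zero =>
    intro f hf hz h hh
    have hz' : ∀ y ∈ ball x R, f y = 0 := hz
    refine ⟨0, ?_, ?_⟩
    · simp [hz' x (mem_ball_self hR)]
    · intro r hr
      simp only [avg, Finset.range_zero, Finset.sum_empty]
      rw [← integral_zero (Euc m) ℝ (μ := volume)]
      refine integral_congr_ae (Eventually.of_forall fun z => ?_)
      simp only
      by_cases h1 : 1 ≤ ‖z‖^2
      · simp [hh.2 _ h1]
      · rw [hz' (x + r • z), mul_zero]
        rw [mem_ball, dist_eq_norm, add_sub_cancel_left, norm_smul, Real.norm_eq_abs, abs_of_nonneg hr.1]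
        have : ‖z‖ ≤ 1 := by nlinarith [norm_nonneg z]
        calc r * ‖z‖ ≤ r * 1 := mul_le_mul_of_nonneg_left this hr.1
          _ < R := by linarith [hr.2]
  | succ j ih =>
    intro f hf hz h hh
    obtain ⟨H, hH, hd⟩ := prof_integral hh
    obtain ⟨a, -, ha⟩ := ih (f := fun x => -(lap f x)) (lap_smooth hf).neg hz hH
    let a' : ℕ → ℝ := fun i => match i with
      | 0 => avg h f x 0
      | (i+1) => - a i / (2*(i+1))
    have hsum : ∀ s : ℝ, ∑ i ∈ Finset.range (j+1), a' i * s^i =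
        (∑ i ∈ Finset.range j, - a i / (2*(i+1)) * s^(i+1)) + avg h f x 0 := by
      intro s
      rw [Finset.sum_range_succ']
      simp [a']
    refine ⟨a', ?_, ?_⟩
    · rw [hsum, avg_zero]; simp
    · intro r hr
      rw [hsum]
      have key : ∀ t ∈ Icc 0 r, HasDerivAt (fun t => avg h f x t -
          ((∑ i ∈ Finset.range j, - a i / (2*(i+1)) * (t^2)^(i+1)) + avg h f x 0)) 0 t := by
        intro t ht
        have h1 := avg_hasDerivAt hh hf x t
        rw [avg_deriv_eq hh hH hd hf] at h1
        have h2 : HasDerivAt (fun t : ℝ => ((∑ i ∈ Finset.range j, - a i / (2*(i+1)) * (t^2)^(i+1)) + avg h f x 0))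
            (∑ i ∈ Finset.range j, - a i * t * (t^2)^i) t := by
          apply HasDerivAt.add_const
          apply HasDerivAt.fun_sum
          intro i _
          have h3 := (((hasDerivAt_id t).pow 2).pow (i+1)).const_mul (- a i / (2*(i+1)))
          refine h3.congr_deriv ?_
          simp
          field_simp
        refine (h1.sub h2).congr_deriv ?_
        have h4 := ha t ⟨ht.1, ht.2.trans_lt hr.2⟩
        have h5 : avg H (fun x => -(lap f x)) x t = - avg H (lap f) x t := by
          simp [avg, integral_neg]
        rw [h5] at h4
        have h6 : avg H (lap f) x t = - ∑ i ∈ Finset.range j, a i * (t^2)^i := by linarith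
        rw [h6, mul_neg, Finset.mul_sum, ← Finset.sum_neg_distrib, sub_eq_zero]
        exact Finset.sum_congr rfl fun i _ => by ring
      have hconst := constant_of_has_deriv_right_zero (a := 0) (b := r)
        (f := fun t => avg h f x t -
          ((∑ i ∈ Finset.range j, - a i / (2*(i+1)) * (t^2)^(i+1)) + avg h f x 0))
        (fun t ht => (key t ht).continuousAt.continuousWithinAt)
        (fun t ht => (key t ⟨ht.1, ht.2.le⟩).hasDerivWithinAt) r ⟨hr.1, le_rfl⟩
      simp at hconst
      linarith

lemma exists_nodes (j : ℕ) : ∃ l : ℕ → ℝ, ∀ a : ℕ → ℝ, ∀ r : ℝ,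
    ∑ i ∈ Finset.range j, l i * (∑ k ∈ Finset.range j, a k * ((r * ((i+1)/(j+1)))^2)^k) =
      ∑ k ∈ Finset.range j, a k * (0:ℝ)^k := by
  classical
  let v : ℕ → ℝ := fun i => (((i:ℝ)+1)/(j+1))^2
  have hv : Set.InjOn v (Finset.range j : Set ℕ) := by
    intro i _ i' _ h
    simp only [v] at h
    have hp : (0:ℝ) < (j:ℝ)+1 := by positivity
    rw [sq_eq_sq₀ (by positivity) (by positivity)] at h
    have := (div_left_inj' hp.ne').1 h
    exact_mod_cast add_right_cancel this
  refine ⟨fun i => (Lagrange.basis (Finset.range j) v i).eval 0, fun a r => ?_⟩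
  let P : Polynomial ℝ := ∑ k ∈ Finset.range j, Polynomial.C (a k * (r^2)^k) * Polynomial.X^k
  have hdeg : P.degree < (Finset.range j).card := by
    rw [Finset.card_range]
    refine (Polynomial.degree_sum_le _ _).trans_lt ?_
    refine (Finset.sup_lt_iff (WithBot.bot_lt_coe j)).2 ?_
    intro k hk
    refine (Polynomial.degree_C_mul_X_pow_le _ _).trans_lt ?_
    exact WithBot.coe_lt_coe.2 (Finset.mem_range.1 hk)
  have h0 := Lagrange.eq_interpolate hv hdeg
  have h1 := congrArg (Polynomial.eval 0) h0
  rw [Lagrange.interpolate_apply] at h1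
  simp only [Polynomial.eval_finsetSum, Polynomial.eval_mul, Polynomial.eval_C, P,
    Polynomial.eval_pow, Polynomial.eval_X] at h1
  have h2 : ∑ k ∈ Finset.range j, a k * (0:ℝ)^k = ∑ k ∈ Finset.range j, a k * (r^2)^k * (0:ℝ)^k := by
    refine Finset.sum_congr rfl fun k _ => ?_
    rcases k with _ | k <;> simp
  rw [h2, h1]
  refine Finset.sum_congr rfl fun i _ => ?_
  rw [mul_comm]
  congr 1
  refine Finset.sum_congr rfl fun k _ => ?_
  simp only [v]
  rw [mul_pow, mul_pow, mul_assoc]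

lemma exists_prof (m : ℕ) : ∃ h : ℝ → ℝ, IsProf h ∧ 0 < ∫ z : Euc m, h (‖z‖^2) := by
  let b : ContDiffBump (0:ℝ) := ⟨1/2, 1, by norm_num, by norm_num⟩
  have hp : IsProf b := by
    refine ⟨b.contDiff, fun s hs => ?_⟩
    apply b.zero_of_le_dist
    simp [b]
    exact hs.trans (le_abs_self s)
  refine ⟨b, hp, ?_⟩
  apply (prof_contDiff (m := m) hp).continuous.integral_pos_of_hasCompactSupport_nonneg_nonzero (prof_cpt hp)
    (fun z => b.nonneg) (x := 0)
  simp
  rw [b.one_of_mem_closedBall]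
  · norm_num
  · simp [b]

/-- Cauchy estimate -/
lemma cauchy_est (m j : ℕ) (e : Euc m) : ∃ C : ℝ, 0 ≤ C ∧ ∀ (f : Euc m → ℝ) (_ : ContDiff ℝ (⊤ : ℕ∞) f)
    (x : Euc m) (r M : ℝ) (_ : 0 < r) (_ : ∀ y ∈ ball x r, negLapPow j f y = 0)
    (_ : ∀ y ∈ ball x r, |f y| ≤ M), |dirD e f x| ≤ C / r * M := by
  obtain ⟨h, hh, hpos⟩ := exists_prof m
  obtain ⟨l, hl⟩ := exists_nodes j
  set I := ∫ z : Euc m, h (‖z‖^2) with hI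
  set η' : Euc m → ℝ := fun z => fderiv ℝ (fun z : Euc m => h (‖z‖^2)) z e with hη'
  have hη'c : Continuous η' :=
    ((prof_contDiff hh).continuous_fderiv (by simp)).clm_apply continuous_const
  have hη's : HasCompactSupport η' := (prof_cpt hh).fderiv_apply (𝕜 := ℝ) e
  have hη'i : Integrable η' := hη'c.integrable_of_hasCompactSupport hη's
  have hη'z : ∀ z : Euc m, 1 < ‖z‖ → η' z = 0 := by
    intro z hz
    have : (fun z : Euc m => h (‖z‖^2)) =ᶠ[𝓝 z] fun _ => 0 := by
      filter_upwards [(isOpen_lt continuous_const continuous_norm).mem_nhds hz] with w hw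
      apply hh.2
      have : 1 < ‖w‖ := hw
      nlinarith
    simp [hη', this.fderiv_eq]
  set J := ∫ z, |η' z| with hJ
  have hJ0 : 0 ≤ J := integral_nonneg fun z => abs_nonneg _
  refine ⟨(∑ i ∈ Finset.range j, |l i| * (J * ((j+1)/(i+1)))) / I, by positivity, ?_⟩
  intro f hf x r M hr hz hM
  have hM0 : 0 ≤ M := (abs_nonneg _).trans (hM x (mem_ball_self hr))
  obtain ⟨a, ha0, ha⟩ := avg_poly x hr j (dirD_smooth e hf)
    (negLapPow_dirD_zero e j hf isOpen_ball hz) hh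
  have h1 := hl a r
  rw [ha0] at h1
  have hA : ∀ ρ ∈ Ioo 0 r, |avg h (dirD e f) x ρ| ≤ J * M / ρ := by
    intro ρ hρ
    have h2 : ρ * avg h (dirD e f) x ρ = - ∫ z, η' z * f (x + ρ • z) := by
      rw [hη', ← ibp (prof_contDiff hh) (prof_cpt hh) ((smooth_affine hf x ρ).of_le (by norm_cast))]
      unfold avg
      rw [← integral_const_mul]
      refine integral_congr_ae (Eventually.of_forall fun z => ?_)
      simp only
      rw [fderiv_affine (hf.differentiable (by simp))]
      simp [dirD]; ring
    have h3 : |ρ * avg h (dirD e f) x ρ| ≤ J * M := by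
      rw [h2, abs_neg]
      rw [hJ, ← integral_mul_const]
      refine (abs_integral_le_integral_abs).trans ?_
      apply integral_mono_of_nonneg (Eventually.of_forall fun z => abs_nonneg _) (hη'i.abs.mul_const M)
      refine Eventually.of_forall fun z => ?_
      simp only [abs_mul]
      by_cases hz1 : 1 < ‖z‖
      · simp [hη'z z hz1]
      · apply mul_le_mul_of_nonneg_left _ (abs_nonneg _)
        apply hM
        rw [mem_ball, dist_eq_norm, add_sub_cancel_left, norm_smul, Real.norm_eq_abs, abs_of_pos hρ.1]
        calc ρ * ‖z‖ ≤ ρ * 1 := mul_le_mul_of_nonneg_left (not_lt.1 hz1) hρ.1.le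
          _ < r := by linarith [hρ.2]
    rw [abs_mul, abs_of_pos hρ.1] at h3
    rw [le_div_iff₀ hρ.1]; linarith
  have hnode : ∀ i ∈ Finset.range j, r * (((i:ℝ)+1)/(j+1)) ∈ Ioo 0 r := by
    intro i hi
    have hij : (i:ℝ) < j := by exact_mod_cast Finset.mem_range.1 hi
    refine ⟨by positivity, ?_⟩
    have : ((i:ℝ)+1)/(j+1) < 1 := by rw [div_lt_one (by positivity)]; linarith
    nlinarith
  have h5 : I * |dirD e f x| ≤ ∑ i ∈ Finset.range j, |l i| * (J * M / (r * (((i:ℝ)+1)/(j+1)))) := by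
    rw [← abs_of_pos hpos, ← abs_mul, ← h1]
    refine (Finset.abs_sum_le_sum_abs _ _).trans (Finset.sum_le_sum fun i hi => ?_)
    rw [abs_mul]
    apply mul_le_mul_of_nonneg_left _ (abs_nonneg _)
    have hn := hnode i hi
    rw [← ha _ ⟨hn.1.le, hn.2⟩]
    exact hA _ hn
  have h6 : |dirD e f x| ≤ (∑ i ∈ Finset.range j, |l i| * (J * M / (r * (((i:ℝ)+1)/(j+1))))) / I := by
    rw [le_div_iff₀ hpos]; linarith
  refine h6.trans (le_of_eq ?_)
  rw [div_div, div_mul_eq_mul_div, Finset.sum_mul, div_eq_div_iff hpos.ne' (by positivity), Finset.sum_mul, Finset.sum_mul]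
  refine Finset.sum_congr rfl fun i _ => ?_
  field_simp

lemma cauchy_iter (m j : ℕ) (e : Euc m) : ∃ C : ℝ, 0 ≤ C ∧ ∀ (f : Euc m → ℝ) (_ : ContDiff ℝ (⊤ : ℕ∞) f)
    (x : Euc m) (R r M : ℝ) (_ : 0 < r) (_ : ∀ y ∈ ball x R, negLapPow j f y = 0)
    (_ : ∀ y ∈ ball x R, |f y| ≤ M) (i : ℕ), ContDiff ℝ (⊤ : ℕ∞) ((dirD e)^[i] f) ∧
      (∀ y ∈ ball x R, negLapPow j ((dirD e)^[i] f) y = 0) ∧ 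
      ∀ y, dist y x + i * r < R → |(dirD e)^[i] f y| ≤ (C/r)^i * M := by
  obtain ⟨C, hC, h⟩ := cauchy_est m j e
  refine ⟨C, hC, ?_⟩
  intro f hf x R r M hr hz hM i
  induction i with
  | zero => 
    refine ⟨hf, hz, ?_⟩
    intro y hy
    simpa using hM y (by simpa using hy)
  | succ i ih =>
    obtain ⟨h1, h2, h3⟩ := ih
    rw [Function.iterate_succ_apply']
    refine ⟨dirD_smooth e h1, negLapPow_dirD_zero e j h1 isOpen_ball h2, ?_⟩
    intro y hy
    push_cast at hy
    have hb : ∀ w ∈ ball y r, dist w x + i * r < R := by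
      intro w hw
      have := dist_triangle w y x
      have h4 : dist w y < r := hw
      linarith
    refine (h _ h1 y r ((C/r)^i*M) hr ?_ ?_).trans (le_of_eq (by ring))
    · intro w hw
      apply h2
      have := hb w hw
      rw [mem_ball]
      have : 0 ≤ (i:ℝ) * r := by positivity
      linarith
    · intro w hw
      exact h3 w (hb w hw)
end

section
open MeasureTheory Real Filter Topology Metric Set Bornology

lemma line_iteratedDeriv {m : ℕ} (e x : Euc m) {f : Euc m → ℝ} (hf : ContDiff ℝ (⊤ : ℕ∞) f) (i : ℕ) :
    ContDiff ℝ (⊤ : ℕ∞) ((dirD e)^[i] f) ∧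
    iteratedDeriv i (fun t : ℝ => f (x + t • e)) = fun t => (dirD e)^[i] f (x + t • e) := by
  induction i with
  | zero => exact ⟨hf, by simp⟩
  | succ i ih =>
    obtain ⟨h1, h2⟩ := ih
    rw [Function.iterate_succ_apply']
    refine ⟨dirD_smooth e h1, ?_⟩
    rw [iteratedDeriv_succ, h2]
    ext t
    have h3 : HasDerivAt (fun s : ℝ => x + s • e) e t := by
      have := ((hasDerivAt_id t).smul_const e).const_add x
      simpa using this
    exact ((((h1.differentiable (by simp)) (x + t • e)).hasFDerivAt).comp_hasDerivAt t h3).deriv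

lemma line_analytic {m j : ℕ} (e x : Euc m) {R : ℝ} (hR : 0 < R) {f : Euc m → ℝ}
    (hf : ContDiff ℝ (⊤ : ℕ∞) f) (hz : ∀ y ∈ ball x R, negLapPow j f y = 0) :
    AnalyticAt ℝ (fun t : ℝ => f (x + t • e)) 0 := by
  obtain ⟨C, hC, hc⟩ := cauchy_iter m j e
  obtain ⟨M, hM⟩ := (isCompact_closedBall x R).exists_bound_of_continuousOn hf.continuous.continuousOn
  have hM' : ∀ y ∈ ball x R, |f y| ≤ M := fun y hy => hM y (ball_subset_closedBall hy)
  have hM0 : 0 ≤ M := (abs_nonneg _).trans (hM' x (mem_ball_self hR))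
  set g : ℝ → ℝ := fun t => f (x + t • e) with hg
  have hgs : ContDiff ℝ (⊤ : ℕ∞) g := by
    apply hf.comp; fun_prop
  have hsm' : ∀ n : ℕ, ((n : ℕ) : WithTop ℕ∞) ≤ ((⊤ : ℕ∞) : WithTop ℕ∞) := fun n =>
    WithTop.coe_le_coe.2 (le_top : (n : ℕ∞) ≤ ⊤)
  have hsm : ∀ n : ℕ, ((n : ℕ) : WithTop ℕ∞) + 1 ≤ ((⊤ : ℕ∞) : WithTop ℕ∞) := fun n => by
    exact_mod_cast hsm' (n+1)
  set B : ℝ := 2 * C * Real.exp 1 / R with hB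
  have hB0 : 0 ≤ B := by positivity
  have hbound : ∀ t : ℝ, |t| * ‖e‖ < R/2 → ∀ i : ℕ, |iteratedDeriv i g t| ≤ B^i * i.factorial * M := by
    intro t ht i
    rw [(line_iteratedDeriv e x hf i).2]
    have hd : dist (x + t • e) x < R/2 := by
      rw [dist_eq_norm, add_sub_cancel_left, norm_smul, Real.norm_eq_abs]; exact ht
    rcases Nat.eq_zero_or_pos i with rfl | hi
    · simpa using hM' (x + t • e) (by rw [mem_ball]; linarith)
    · have hi' : (0:ℝ) < i := by exact_mod_cast hi
      have := (hc f hf x R (R/(2*i)) M (by positivity) hz hM' i).2.2 (x + t • e) (by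
        have : (i:ℝ) * (R/(2*i)) = R/2 := by field_simp
        rw [this]; linarith)
      refine this.trans ?_
      apply mul_le_mul_of_nonneg_right _ hM0
      have h1 := Real.pow_div_factorial_le_exp (i:ℝ) hi'.le i
      have hfac : (0:ℝ) < i.factorial := by exact_mod_cast i.factorial_pos
      rw [div_le_iff₀ hfac] at h1
      have h2 : Real.exp (i:ℝ) = Real.exp 1 ^ i := by rw [← Real.exp_nat_mul]; simp
      calc (C / (R/(2*i)))^i = (2*C/R)^i * (i:ℝ)^i := by rw [← mul_pow]; congr 1; field_simp
        _ ≤ (2*C/R)^i * (Real.exp 1 ^ i * i.factorial) := by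
            rw [← h2]; exact mul_le_mul_of_nonneg_left h1 (by positivity)
        _ = B^i * i.factorial := by rw [hB, ← mul_assoc, ← mul_pow]; congr 2; ring
  set δ : ℝ := min (R/(2*(‖e‖+1))) (1/(2*(B+1))) with hδ
  have hδ0 : 0 < δ := by positivity
  have hsmall : ∀ t : ℝ, |t| < δ → |t| * ‖e‖ < R/2 := by
    intro t ht
    have h1 : |t| < R/(2*(‖e‖+1)) := ht.trans_le (min_le_left _ _)
    rw [lt_div_iff₀ (by positivity)] at h1
    nlinarith [abs_nonneg t, norm_nonneg e]
  have hsmall2 : ∀ t : ℝ, |t| < δ → B * |t| ≤ 1/2 := by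
    intro t ht
    have h1 : |t| < 1/(2*(B+1)) := ht.trans_le (min_le_right _ _)
    rw [lt_div_iff₀ (by positivity)] at h1
    nlinarith [abs_nonneg t]
  have hp : HasFPowerSeriesAt g (FormalMultilinearSeries.ofScalars ℝ
      (fun i => iteratedDeriv i g 0 / i.factorial)) 0 := by
    rw [hasFPowerSeriesAt_iff]
    rw [Metric.eventually_nhds_iff]
    refine ⟨δ, hδ0, ?_⟩
    intro z hz'
    rw [dist_zero_right, Real.norm_eq_abs] at hz'
    simp only [FormalMultilinearSeries.coeff_ofScalars, zero_add, smul_eq_mul]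
    have hhalf : ∀ (t : ℝ) (_ : |t| < δ) (i : ℕ), |iteratedDeriv i g t * z^i / i.factorial| ≤ M * (1/2)^i := by
      intro t ht i
      have hfac : (0:ℝ) < i.factorial := by exact_mod_cast i.factorial_pos
      rw [abs_div, abs_mul, abs_of_pos hfac, div_le_iff₀ hfac, abs_pow]
      calc |iteratedDeriv i g t| * |z|^i ≤ (B^i * i.factorial * M) * |z|^i :=
            mul_le_mul_of_nonneg_right (hbound t (hsmall t ht) i) (by positivity)
        _ = M * (B*|z|)^i * i.factorial := by rw [mul_pow]; ring
        _ ≤ M * (1/2)^i * i.factorial := by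
            gcongr
            exact hsmall2 z hz'
    have hsummable : Summable fun i : ℕ => z^i * (iteratedDeriv i g 0 / i.factorial) := by
      refine Summable.of_norm_bounded (g := fun i : ℕ => M * (1/2)^i) ?_ ?_
      · exact (summable_geometric_of_lt_one (by norm_num) (by norm_num)).mul_left M
      · intro i
        have := hhalf 0 (by simpa using hδ0) i
        rw [Real.norm_eq_abs]
        convert this using 2
        ring
    rw [hsummable.hasSum_iff_tendsto_nat, ← tendsto_add_atTop_iff_nat 1]
    rw [tendsto_iff_norm_sub_tendsto_zero]
    have hlim : Tendsto (fun n : ℕ => M * (1/2:ℝ)^(n+1)) atTop (𝓝 0) := by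
      have := ((tendsto_pow_atTop_nhds_zero_of_lt_one (r := (1/2:ℝ)) (by norm_num) (by norm_num)).comp
        (tendsto_add_atTop_nat 1)).const_mul M
      simpa using this
    refine squeeze_zero (fun _ => norm_nonneg _) (fun n => ?_) hlim
    rcases eq_or_ne z 0 with rfl | hz0
    · rw [Finset.sum_range_succ']
      simp
      positivity
    · obtain ⟨t, ht, hte⟩ := taylor_mean_remainder_lagrange_iteratedDeriv (f := g) (n := n) hz0.symm
        (hgs.of_le (hsm n)).contDiffOn
      have ht' : |t| < δ := by
        refine lt_of_le_of_lt ?_ hz'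
        rcases lt_or_gt_of_ne hz0 with h | h
        · rw [uIoo_of_ge h.le] at ht
          rw [abs_of_neg ht.2, abs_of_neg h]; linarith [ht.1]
        · rw [uIoo_of_le h.le] at ht
          rw [abs_of_pos ht.1, abs_of_pos h]; linarith [ht.2]
      have h3 : taylorWithinEval g n (uIcc 0 z) 0 z = ∑ i ∈ Finset.range (n+1), z^i * (iteratedDeriv i g 0 / i.factorial) := by
        rw [taylor_within_apply]
        refine Finset.sum_congr rfl fun i _ => ?_
        rw [iteratedDerivWithin_eq_iteratedDeriv (s := uIcc 0 z) (uniqueDiffOn_Icc (by rcases lt_or_gt_of_ne hz0 with h | h <;> simp [h])) (hgs.of_le (hsm' i)).contDiffAt left_mem_uIcc]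
        simp
        ring
      rw [h3] at hte
      rw [norm_sub_rev, hte, Real.norm_eq_abs, sub_zero]
      exact hhalf t ht' (n+1)
  exact hp.analyticAt

lemma local_null {m j : ℕ} (q : Euc m) {ρ : ℝ} (hρ : 0 < ρ) {f : Euc m → ℝ}
    (hf : ContDiff ℝ (⊤ : ℕ∞) f) (hz : ∀ y ∈ ball q ρ, negLapPow j f y = 0) (hq : f q ≠ 0) :
    volume ({y | f y = 0} ∩ ball q (ρ/2)) = 0 := by
  have hline : ∀ y ∈ ball q ρ, ∀ᵐ t ∂(volume.restrict (Icc (0:ℝ) 1)), f (q + t • (y - q)) ≠ 0 := by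
    intro y hy
    have han : AnalyticOnNhd ℝ (fun t : ℝ => f (q + t • (y - q))) (Icc (0:ℝ) 1) := by
      intro t ht
      have hmem : q + t • (y - q) ∈ ball q ρ := by
        rw [mem_ball, dist_eq_norm, add_sub_cancel_left, norm_smul, Real.norm_eq_abs, abs_of_nonneg ht.1]
        rw [mem_ball, dist_eq_norm] at hy
        nlinarith [ht.2, norm_nonneg (y - q)]
      obtain ⟨r, hr, hrs⟩ := Metric.isOpen_iff.1 isOpen_ball _ hmem
      have h1 := line_analytic (y - q) (q + t • (y - q)) hr hf (fun w hw => hz w (hrs hw))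
      have h2 : AnalyticAt ℝ (fun s : ℝ => s - t) t := analyticAt_id.sub analyticAt_const
      have h3 := AnalyticAt.fun_comp (g := fun s : ℝ => f (q + t • (y - q) + s • (y - q))) (f := fun s : ℝ => s - t) (x := t)
        (by simpa using h1) h2
      convert h3 using 2 with s
      congr 1
      rw [add_assoc, ← add_smul]; congr 2; ring
    have := han.preimage_zero_mem_codiscreteWithin (x := 0) (by simpa using hq) (by simp) (isConnected_Icc zero_le_one)
    exact ae_restrict_le_codiscreteWithin measurableSet_Icc this
  have hmeas : MeasurableSet {x : Euc m × ℝ | f (q + x.2 • (x.1 - q)) ≠ 0} := by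
    have : Continuous fun x : Euc m × ℝ => f (q + x.2 • (x.1 - q)) :=
      hf.continuous.comp (by fun_prop)
    exact (isOpen_ne_fun this continuous_const).measurableSet
  have h1 : ∀ᵐ y ∂(volume.restrict (ball q ρ)), ∀ᵐ t ∂(volume.restrict (Icc (0:ℝ) 1)), f (q + t • (y - q)) ≠ 0 := by
    rw [ae_restrict_iff' measurableSet_ball]
    exact Eventually.of_forall hline
  rw [Measure.ae_ae_comm (p := fun y t => f (q + t • (y - q)) ≠ 0) hmeas] at h1
  have h2 : ∃ t ∈ Ioo (1/2:ℝ) 1, ∀ᵐ y ∂(volume.restrict (ball q ρ)), f (q + t • (y - q)) ≠ 0 := by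
    have h3 := ae_restrict_of_ae_restrict_of_subset (s := Ioo (1/2:ℝ) 1) (t := Icc (0:ℝ) 1)
      (fun t ht => ⟨by linarith [ht.1], ht.2.le⟩) h1
    rw [ae_restrict_iff' measurableSet_Ioo] at h3
    by_contra hcon
    push Not at hcon
    have : ∀ᵐ t : ℝ, t ∉ Ioo (1/2:ℝ) 1 := by
      filter_upwards [h3] with t ht hmem
      exact hcon t hmem (ht hmem)
    have h4 : volume (Ioo (1/2:ℝ) 1) = 0 := by
      have := ae_iff.1 this
      simp only [not_not] at this
      exact this
    rw [Real.volume_Ioo] at h4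
    norm_num at h4
  obtain ⟨t, ht, hae⟩ := h2
  rw [ae_restrict_iff' measurableSet_ball] at hae
  have hnull : volume {y | y ∈ ball q ρ ∧ f (q + t • (y - q)) = 0} = 0 := by
    have := ae_iff.1 hae
    convert this using 3 with y
    simp
  have hsub : ({y | f y = 0} ∩ ball q (ρ/2)) ⊆
      (AffineMap.homothety q t) '' {y | y ∈ ball q ρ ∧ f (q + t • (y - q)) = 0} := by
    rintro y ⟨hy, hyb⟩
    have ht0 : t ≠ 0 := by linarith [ht.1]
    have ht0' : 0 < t := by linarith [ht.1]
    have hval : t • (t⁻¹ • (y - q)) = y - q := by rw [smul_smul, mul_inv_cancel₀ ht0, one_smul]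
    refine ⟨q + t⁻¹ • (y - q), ⟨?_, ?_⟩, ?_⟩
    · rw [mem_ball, dist_eq_norm] at hyb ⊢
      rw [add_sub_cancel_left, norm_smul, Real.norm_eq_abs, abs_of_pos (by positivity), inv_mul_lt_iff₀ ht0']
      nlinarith [ht.1]
    · rw [add_sub_cancel_left, hval]
      simpa using hy
    · rw [AffineMap.homothety_apply]
      simp only [vsub_eq_sub, vadd_eq_add]
      rw [add_sub_cancel_left, hval]; simp
  refine measure_mono_null hsub ?_
  rw [Measure.addHaar_image_homothety, hnull, mul_zero]

lemma exists_global {m j : ℕ} {Ω : Set (Euc m)} (hΩ : IsOpen Ω) {φ : Euc m → ℝ}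
    (hφ : ContDiffOn ℝ (⊤ : ℕ∞) φ Ω) (hz : ∀ x ∈ Ω, negLapPow j φ x = 0)
    {p : Euc m} (hp : p ∈ Ω) : ∃ R > 0, ball p R ⊆ Ω ∧ ∃ f : Euc m → ℝ, ContDiff ℝ (⊤ : ℕ∞) f ∧
      (∀ y ∈ ball p R, f y = φ y) ∧ ∀ y ∈ ball p R, negLapPow j f y = 0 := by
  obtain ⟨r, hr, hrs⟩ := Metric.isOpen_iff.1 hΩ p hp
  let b : ContDiffBump p := ⟨r/4, r/2, by positivity, by linarith⟩
  have hsub : ball p (r/4) ⊆ Ω := (ball_subset_ball (by linarith)).trans hrs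
  have heq : ∀ y ∈ ball p (r/4), b y * φ y = φ y := by
    intro y hy
    rw [b.one_of_mem_closedBall (ball_subset_closedBall hy), one_mul]
  refine ⟨r/4, by positivity, hsub, fun y => b y * φ y, ?_, heq, ?_⟩
  · rw [contDiff_iff_contDiffAt]
    intro y
    by_cases hy : y ∈ Ω
    · exact b.contDiff.contDiffAt.mul (hφ.contDiffAt (hΩ.mem_nhds hy))
    · have hy2 : y ∉ tsupport b := by
        rw [b.tsupport_eq]
        intro h
        exact hy (hrs (closedBall_subset_ball (by simp [b]; linarith) h))
      have : (fun y => b y * φ y) =ᶠ[𝓝 y] fun _ => 0 := by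
        filter_upwards [notMem_tsupport_iff_eventuallyEq.1 hy2] with w hw
        simp [hw]
      exact contDiffAt_const.congr_of_eventuallyEq this
  · intro y hy
    rw [negLapPow_congr isOpen_ball j heq y hy]
    exact hz y (hsub hy)

lemma null_Sphi {m : ℕ} {Ω : Set (Euc m)} (hΩ : IsOpen Ω) (hc : IsConnected Ω) {φ : Euc m → ℝ}
    (hφ : memK Ω φ) : volume (Sphi Ω φ) = 0 := by
  obtain ⟨hs, -, ⟨x₁, hx₁, hne⟩, hz⟩ := hφ
  let A : Set (Euc m) := {x | ∃ r > 0, ∀ y ∈ ball x r, φ y = 0}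
  let B : Set (Euc m) := {x | ∃ r > 0, volume ({y | φ y = 0} ∩ ball x r) = 0}
  have hmono : ∀ {x y : Euc m} {r : ℝ}, y ∈ ball x r → ball y (r - dist y x) ⊆ ball x r := by
    intro x y r hy w hw
    rw [mem_ball] at *
    linarith [dist_triangle w y x]
  have hA : IsOpen A := by
    rw [Metric.isOpen_iff]
    rintro x ⟨r, hr, h⟩
    refine ⟨r, hr, fun y hy => ⟨r - dist y x, by rw [mem_ball] at hy; linarith, fun w hw => h w (hmono hy hw)⟩⟩
  have hB : IsOpen B := by
    rw [Metric.isOpen_iff]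
    rintro x ⟨r, hr, h⟩
    refine ⟨r, hr, fun y hy => ⟨r - dist y x, by rw [mem_ball] at hy; linarith, ?_⟩⟩
    exact measure_mono_null (inter_subset_inter_right _ (hmono hy)) h
  have hdisj : Disjoint A B := by
    rw [Set.disjoint_left]
    rintro x ⟨r, hr, h⟩ ⟨r', hr', h'⟩
    have : volume (ball x (min r r')) = 0 := by
      refine measure_mono_null ?_ h'
      intro y hy
      exact ⟨h y (ball_subset_ball (min_le_left _ _) hy), ball_subset_ball (min_le_right _ _) hy⟩
    exact (measure_ball_pos volume x (lt_min hr hr')).ne' this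
  have hcov : Ω ⊆ A ∪ B := by
    intro p hp
    obtain ⟨R, hR, hRs, f, hf, hfe, hfz⟩ := exists_global hΩ hs hz hp
    by_cases hall : ∀ y ∈ ball p (R/4), φ y = 0
    · exact Or.inl ⟨R/4, by positivity, hall⟩
    · push Not at hall
      obtain ⟨q, hq, hqne⟩ := hall
      right
      refine ⟨R/8, by positivity, ?_⟩
      have hsub : ball q (3*R/4) ⊆ ball p R := by
        intro y hy
        rw [mem_ball] at *
        linarith [dist_triangle y q p]
      have hn := local_null (j := m) q (ρ := 3*R/4) (by positivity) hf (fun y hy => hfz y (hsub hy))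
        (by rw [hfe q (ball_subset_ball (by linarith) hq)]; exact hqne)
      refine measure_mono_null ?_ hn
      rintro y ⟨hy, hyb⟩
      refine ⟨?_, ?_⟩
      · show f y = 0
        rw [hfe y (ball_subset_ball (by linarith) hyb)]; exact hy
      · rw [mem_ball] at *
        rw [dist_comm] at hq
        linarith [dist_triangle y p q]
  rcases hc.isPreconnected.subset_or_subset hA hB hdisj hcov with h | h
  · obtain ⟨r, hr, h'⟩ := h hx₁
    exact absurd (h' x₁ (mem_ball_self hr)) hne
  · apply measure_null_of_locally_null
    intro x hx
    obtain ⟨r, hr, h'⟩ := h hx.1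
    refine ⟨Sphi Ω φ ∩ ball x r, inter_mem self_mem_nhdsWithin (mem_nhdsWithin_of_mem_nhds (ball_mem_nhds x hr)), ?_⟩
    exact measure_mono_null (inter_subset_inter_left _ fun y hy => hy.2) h'
end

section
open MeasureTheory Real Filter Topology Metric Set Bornology

/-- truncated singular power -/
def rhoq {m : ℕ} (q : ℝ) (z : Euc m) : ℝ := (ball (0 : Euc m) 1).indicator (fun z => ‖z‖ ^ (-q)) z

lemma rhoq_nonneg {m : ℕ} (q : ℝ) (z : Euc m) : 0 ≤ rhoq q z := by
  unfold rhoq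
  exact Set.indicator_nonneg (fun z _ => Real.rpow_nonneg (norm_nonneg _) _) z

lemma rhoq_meas {m : ℕ} (q : ℝ) : Measurable (rhoq (m := m) q) := by
  unfold rhoq
  refine Measurable.indicator ?_ measurableSet_ball
  fun_prop

lemma rhoq_lint {m : ℕ} (hm : 1 ≤ m) {q : ℝ} (hq : q < 2 * m) :
    ∫⁻ z : Euc m, ENNReal.ofReal (rhoq q z) < ⊤ := by
  have hfin : Module.finrank ℝ (Euc m) = 2 * m := by simp
  have h1 : IntegrableOn (fun z : Euc m => ‖z‖ ^ (-q)) (ball 0 1) := by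
    refine integrableOn_ball_of_norm_le_rpow (C := 1) (α := q) (by omega) (by rw [hfin]; push_cast; exact hq) ?_ ?_
    · refine Eventually.of_forall fun x => ?_
      rw [Real.norm_of_nonneg (Real.rpow_nonneg (norm_nonneg _) _), one_mul]
    · apply Measurable.aestronglyMeasurable; fun_prop
  have h2 : Integrable (rhoq (m := m) q) := by
    have := (integrable_indicator_iff (measurableSet_ball)).2 h1
    exact this
  exact h2.lintegral_lt_top

lemma one_add_inv_rpow_le {m : ℕ} {q : ℝ} (hq : 0 ≤ q) (z : Euc m) :
    (1 + 1 / ‖z‖) ^ q ≤ 2 ^ q * (1 + rhoq q z) := by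
  have h2 : (1 : ℝ) ≤ 2 ^ q := Real.one_le_rpow (by norm_num) hq
  have hr := rhoq_nonneg q z
  by_cases hz : ‖z‖ < 1
  · rcases (norm_nonneg z).eq_or_lt with h0 | h0
    · rw [← h0]; simp; nlinarith
    · have : rhoq q z = ‖z‖ ^ (-q) := by
        unfold rhoq; rw [Set.indicator_of_mem]; simpa using hz
      rw [this]
      have h3 : 1 + 1 / ‖z‖ ≤ 2 * ‖z‖⁻¹ := by
        have : 1 ≤ ‖z‖⁻¹ := (one_le_inv₀ h0).2 hz.le
        rw [one_div]; linarith
      calc (1 + 1 / ‖z‖) ^ q ≤ (2 * ‖z‖⁻¹) ^ q := Real.rpow_le_rpow (by positivity) h3 hq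
        _ = 2 ^ q * ‖z‖ ^ (-q) := by
          rw [Real.mul_rpow (by norm_num) (by positivity), Real.inv_rpow h0.le, Real.rpow_neg h0.le]
        _ ≤ _ := by nlinarith
  · have h3 : 1 + 1 / ‖z‖ ≤ 2 := by
      have : 1 / ‖z‖ ≤ 1 := by rw [div_le_one (by linarith)]; linarith
      linarith
    calc (1 + 1 / ‖z‖) ^ q ≤ 2 ^ q := Real.rpow_le_rpow (by positivity) h3 hq
      _ ≤ _ := by nlinarith

/-- log kernel -/
def lker {m : ℕ} (x y : Euc m) : ℝ := Real.log ((1 + ‖y‖) / ‖x - y‖)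

lemma ker_meas {m : ℕ} : Measurable (fun z : Euc m × Euc m => lker z.1 z.2) := by
  unfold lker
  fun_prop

lemma ker_le {m : ℕ} (x y : Euc m) : lker x y ≤ ‖x‖ + Real.log (1 + 1 / ‖x - y‖) := by
  unfold lker
  rcases (norm_nonneg (x - y)).eq_or_lt with h0 | h0
  · rw [← h0]; simp
  · have h1 : (1 + ‖y‖) / ‖x - y‖ ≤ (1 + ‖x‖) * (1 + 1 / ‖x - y‖) := by
      rw [div_le_iff₀ h0]
      have : ‖y‖ ≤ ‖x‖ + ‖x - y‖ := by
        have := norm_sub_le x (x - y); simpa using this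
      have e : (1 + ‖x‖) * (1 + 1 / ‖x - y‖) * ‖x - y‖ = (1 + ‖x‖) * (1 + ‖x - y‖) := by
        field_simp; ring
      rw [e]
      nlinarith [norm_nonneg x, norm_nonneg (x - y)]
    calc _ ≤ Real.log ((1 + ‖x‖) * (1 + 1 / ‖x - y‖)) := Real.log_le_log (by positivity) h1
      _ = Real.log (1 + ‖x‖) + Real.log (1 + 1 / ‖x - y‖) := Real.log_mul (by positivity) (by positivity)
      _ ≤ _ := by
        have := Real.log_le_sub_one_of_pos (show 0 < 1 + ‖x‖ by positivity)
        linarith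

lemma le_ker {m : ℕ} (x y : Euc m) : -‖x‖ ≤ lker x y := by
  unfold lker
  rcases (norm_nonneg (x - y)).eq_or_lt with h0 | h0
  · rw [← h0]; simp
  · have h1 : ((1 + ‖x‖))⁻¹ ≤ (1 + ‖y‖) / ‖x - y‖ := by
      rw [inv_eq_one_div, div_le_div_iff₀ (by positivity) h0]
      have := norm_sub_le x y
      nlinarith [norm_nonneg x, norm_nonneg y]
    have h2 := Real.log_le_log (by positivity) h1
    rw [Real.log_inv] at h2
    have := Real.log_le_sub_one_of_pos (show 0 < 1 + ‖x‖ by positivity)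
    linarith

lemma exp_ker_le {m : ℕ} {q : ℝ} (hq : 0 ≤ q) (x y : Euc m) :
    Real.exp (q * lker x y) ≤ Real.exp (q * ‖x‖) * (2 ^ q * (1 + rhoq q (x - y))) := by
  have h1 := ker_le x y
  calc _ ≤ Real.exp (q * (‖x‖ + Real.log (1 + 1 / ‖x - y‖))) :=
        Real.exp_le_exp.2 (mul_le_mul_of_nonneg_left h1 hq)
    _ = Real.exp (q * ‖x‖) * (1 + 1 / ‖x - y‖) ^ q := by
      rw [mul_add, Real.exp_add, Real.rpow_def_of_pos (by positivity), mul_comm q (Real.log _)]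
    _ ≤ _ := mul_le_mul_of_nonneg_left (one_add_inv_rpow_le hq _) (Real.exp_pos _).le

lemma gauss_lint {m : ℕ} {δ : ℝ} (hδ : 0 < δ) :
    ∫⁻ x : Euc m, ENNReal.ofReal (Real.exp (-δ * ‖x‖ ^ 2)) < ⊤ := by
  have h := GaussianFourier.integrable_cexp_neg_mul_sq_norm_add (V := Euc m) (b := (δ : ℂ))
    (by simpa using hδ) 0 0
  have h2 := h.norm
  have h3 : Integrable (fun x : Euc m => Real.exp (-δ * ‖x‖ ^ 2)) := by
    refine h2.congr (Eventually.of_forall fun x => ?_)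
    simp only [Complex.norm_exp]
    congr 1
    simp
    norm_cast
    simp
  exact h3.lintegral_lt_top

lemma pot_lower {m : ℕ} {Ω : Set (Euc m)} (hΩ : MeasurableSet Ω) {f : Euc m → ℝ}
    (hf0 : ∀ y ∈ Ω, 0 ≤ f y) (hint : IntegrableOn f Ω) (x : Euc m) :
    -‖x‖ * ∫ y in Ω, f y ≤ ∫ y in Ω, lker x y * f y := by
  by_cases hi : IntegrableOn (fun y => lker x y * f y) Ω
  · rw [← integral_const_mul]
    refine setIntegral_mono_on (hint.const_mul _) hi hΩ fun y hy => ?_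
    exact mul_le_mul_of_nonneg_right (le_ker x y) (hf0 y hy)
  · rw [integral_undef hi]
    have : 0 ≤ ∫ y in Ω, f y := setIntegral_nonneg hΩ hf0
    nlinarith [norm_nonneg x]

lemma ofReal_integral_le_lintegral_aux {α : Type*} [MeasurableSpace α] {μ : Measure α} {g : α → ℝ}
    (hg : Integrable g μ) : ENNReal.ofReal (∫ y, g y ∂μ) ≤ ∫⁻ y, ENNReal.ofReal (g y) ∂μ := by
  rw [integral_eq_lintegral_pos_part_sub_lintegral_neg_part hg]
  refine (ENNReal.ofReal_le_ofReal (sub_le_self _ ENNReal.toReal_nonneg)).trans ?_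
  exact ENNReal.ofReal_toReal_le

lemma jensen_ker {m : ℕ} {Ω : Set (Euc m)} (hΩ : MeasurableSet Ω) {f : Euc m → ℝ} {Λ q : ℝ}
    (hΛ : 0 < Λ)
    (hf0 : ∀ y ∈ Ω, 0 ≤ f y) (hint : IntegrableOn f Ω) (hI : ∫ y in Ω, f y = Λ) (x : Euc m) :
    ENNReal.ofReal (Real.exp ((q / Λ) * ∫ y in Ω, lker x y * f y)) ≤
      1 + ∫⁻ y in Ω, ENNReal.ofReal (Real.exp (q * lker x y) * (f y / Λ)) := by
  by_cases hi : IntegrableOn (fun y => lker x y * f y) Ω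
  · set a := (q / Λ) * ∫ y in Ω, lker x y * f y with ha
    refine le_trans ?_ le_add_self
    have hg : IntegrableOn (fun y => Real.exp a * (1 + (q * lker x y - a)) * (f y / Λ)) Ω := by
      have h1 := ((hint.const_mul (1 - a)).add (hi.const_mul q)).const_mul (Real.exp a / Λ)
      refine h1.congr (Eventually.of_forall fun y => ?_)
      simp only [Pi.add_apply]
      field_simp
      ring
    have hgi : ∫ y in Ω, Real.exp a * (1 + (q * lker x y - a)) * (f y / Λ) = Real.exp a := by
      have : ∀ y, Real.exp a * (1 + (q * lker x y - a)) * (f y / Λ) =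
          (Real.exp a / Λ) * ((1 - a) * f y + q * (lker x y * f y)) := by
        intro y; field_simp; ring
      simp_rw [this]
      rw [integral_const_mul, integral_add (hint.const_mul _) (hi.const_mul _), integral_const_mul,
        integral_const_mul, hI]
      have : q * ∫ y in Ω, lker x y * f y = a * Λ := by rw [ha]; field_simp
      rw [this]
      field_simp
      ring
    rw [← hgi]
    refine (ofReal_integral_le_lintegral_aux hg).trans ?_
    refine setLIntegral_mono' hΩ fun y hy => ?_
    refine ENNReal.ofReal_le_ofReal ?_
    refine mul_le_mul_of_nonneg_right ?_ (div_nonneg (hf0 y hy) hΛ.le)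
    have := Real.add_one_le_exp (q * lker x y - a)
    calc _ ≤ Real.exp a * Real.exp (q * lker x y - a) :=
          mul_le_mul_of_nonneg_left (by linarith) (Real.exp_pos _).le
      _ = _ := by rw [← Real.exp_add]; congr 1; ring
  · rw [integral_undef hi]
    simp

lemma exp_quad {δ q s : ℝ} (hδ : 0 < δ) :
    Real.exp (-δ * s ^ 2) * Real.exp (q * s) ≤
      Real.exp (q ^ 2 / (2 * δ)) * Real.exp (-(δ / 2) * s ^ 2) := by
  rw [← Real.exp_add, ← Real.exp_add]
  refine Real.exp_le_exp.2 ?_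
  have : q ^ 2 / (2 * δ) + -(δ / 2) * s ^ 2 - (-δ * s ^ 2 + q * s) = (q - δ * s) ^ 2 / (2 * δ) := by
    field_simp; ring
  have h2 : 0 ≤ (q - δ * s) ^ 2 / (2 * δ) := by positivity
  linarith

lemma expint {m : ℕ} (hm : 1 ≤ m) {δ q Λ : ℝ} (hδ : 0 < δ) (hq0 : 0 ≤ q) (hq : q < 2 * m)
    (hΛ : 0 < Λ) :
    ∃ C : ℝ, 0 ≤ C ∧ ∀ (Ω : Set (Euc m)) (f : Euc m → ℝ), MeasurableSet Ω → Measurable f →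
      (∀ y ∈ Ω, 0 ≤ f y) → IntegrableOn f Ω → ∫ y in Ω, f y = Λ →
      ∫⁻ x, ENNReal.ofReal (Real.exp (-δ * ‖x‖ ^ 2) *
        Real.exp ((q / Λ) * ∫ y in Ω, lker x y * f y)) ≤ ENNReal.ofReal C := by
  set D : ℝ := Real.exp (q ^ 2 / (2 * δ)) * 2 ^ q with hD
  have hD0 : 0 ≤ D := by positivity
  set G := ∫⁻ x : Euc m, ENNReal.ofReal (Real.exp (-δ * ‖x‖ ^ 2)) with hG
  set G' := ∫⁻ x : Euc m, ENNReal.ofReal (Real.exp (-(δ/2) * ‖x‖ ^ 2)) with hG'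
  set R := ∫⁻ z : Euc m, ENNReal.ofReal (rhoq q z) with hR
  have hGt : G < ⊤ := gauss_lint hδ
  have hGt' : G' < ⊤ := gauss_lint (half_pos hδ)
  have hRt : R < ⊤ := rhoq_lint hm hq
  set T := G + ENNReal.ofReal D * (G' + R) with hT
  have hTt : T ≠ ⊤ := by
    rw [hT]
    refine ENNReal.add_ne_top.2 ⟨hGt.ne, ENNReal.mul_ne_top ENNReal.ofReal_ne_top ?_⟩
    exact ENNReal.add_ne_top.2 ⟨hGt'.ne, hRt.ne⟩
  refine ⟨T.toReal, ENNReal.toReal_nonneg, ?_⟩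
  intro Ω f hΩ hfm hf0 hint hI
  rw [ENNReal.ofReal_toReal hTt]
  have hfl : ∫⁻ y in Ω, ENNReal.ofReal (f y / Λ) = 1 := by
    rw [← ofReal_integral_eq_lintegral_ofReal (hint.div_const Λ)]
    · rw [integral_div, hI, div_self hΛ.ne', ENNReal.ofReal_one]
    · exact (ae_restrict_iff' hΩ).2 (Eventually.of_forall fun y hy => div_nonneg (hf0 y hy) hΛ.le)
  have hpt : ∀ x, ENNReal.ofReal (Real.exp (-δ * ‖x‖ ^ 2) *
        Real.exp ((q / Λ) * ∫ y in Ω, lker x y * f y)) ≤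
      ENNReal.ofReal (Real.exp (-δ * ‖x‖ ^ 2)) + ∫⁻ y in Ω,
        ENNReal.ofReal D * (ENNReal.ofReal (Real.exp (-(δ/2) * ‖x‖ ^ 2)) +
          ENNReal.ofReal (rhoq q (x - y))) * ENNReal.ofReal (f y / Λ) := by
    intro x
    rw [ENNReal.ofReal_mul (Real.exp_pos _).le]
    refine (mul_le_mul_right (jensen_ker hΩ hΛ hf0 hint hI x) _).trans ?_
    rw [mul_add, mul_one]
    gcongr
    rw [← lintegral_const_mul' _ _ ENNReal.ofReal_ne_top]
    refine setLIntegral_mono' hΩ fun y hy => ?_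
    have hfy : 0 ≤ f y / Λ := div_nonneg (hf0 y hy) hΛ.le
    rw [← ENNReal.ofReal_mul (Real.exp_pos _).le,
      ← ENNReal.ofReal_add (Real.exp_pos _).le (rhoq_nonneg _ _), ← ENNReal.ofReal_mul hD0,
      ← ENNReal.ofReal_mul (mul_nonneg hD0 (add_nonneg (Real.exp_pos _).le (rhoq_nonneg _ _)))]
    refine ENNReal.ofReal_le_ofReal ?_
    rw [← mul_assoc]
    refine mul_le_mul_of_nonneg_right ?_ hfy
    have h1 := exp_ker_le hq0 x y
    have h2 := exp_quad (q := q) (s := ‖x‖) hδ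
    have h3 : 0 ≤ rhoq q (x - y) := rhoq_nonneg _ _
    have h4 : Real.exp (-(δ/2) * ‖x‖ ^ 2) ≤ 1 := by
      apply Real.exp_le_one_iff.2
      nlinarith [sq_nonneg ‖x‖]
    have h5 := Real.exp_pos (-(δ/2) * ‖x‖ ^ 2)
    calc _ ≤ Real.exp (-δ * ‖x‖ ^ 2) * (Real.exp (q * ‖x‖) * (2 ^ q * (1 + rhoq q (x - y)))) :=
          mul_le_mul_of_nonneg_left h1 (Real.exp_pos _).le
      _ = (Real.exp (-δ * ‖x‖ ^ 2) * Real.exp (q * ‖x‖)) * (2 ^ q * (1 + rhoq q (x - y))) := by ring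
      _ ≤ (Real.exp (q ^ 2 / (2 * δ)) * Real.exp (-(δ / 2) * ‖x‖ ^ 2)) *
          (2 ^ q * (1 + rhoq q (x - y))) := mul_le_mul_of_nonneg_right h2 (by positivity)
      _ = D * (Real.exp (-(δ / 2) * ‖x‖ ^ 2) * 1 +
            Real.exp (-(δ / 2) * ‖x‖ ^ 2) * rhoq q (x - y)) := by rw [hD]; ring
      _ ≤ _ := by
        refine mul_le_mul_of_nonneg_left ?_ hD0
        rw [mul_one]
        have := mul_le_mul_of_nonneg_right h4 h3
        linarith
  have hGm : Measurable fun x : Euc m => ENNReal.ofReal (Real.exp (-δ * ‖x‖ ^ 2)) := by fun_prop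
  have hGm' : Measurable fun x : Euc m => ENNReal.ofReal (Real.exp (-(δ/2) * ‖x‖ ^ 2)) := by fun_prop
  have hrm := rhoq_meas (m := m) q
  calc _ ≤ ∫⁻ x, (ENNReal.ofReal (Real.exp (-δ * ‖x‖ ^ 2)) + ∫⁻ y in Ω,
        ENNReal.ofReal D * (ENNReal.ofReal (Real.exp (-(δ/2) * ‖x‖ ^ 2)) +
          ENNReal.ofReal (rhoq q (x - y))) * ENNReal.ofReal (f y / Λ)) := lintegral_mono hpt
    _ = G + ∫⁻ x, ∫⁻ y in Ω,
        ENNReal.ofReal D * (ENNReal.ofReal (Real.exp (-(δ/2) * ‖x‖ ^ 2)) +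
          ENNReal.ofReal (rhoq q (x - y))) * ENNReal.ofReal (f y / Λ) := by
        rw [lintegral_add_left hGm]
    _ = G + ∫⁻ y in Ω, ∫⁻ x,
        ENNReal.ofReal D * (ENNReal.ofReal (Real.exp (-(δ/2) * ‖x‖ ^ 2)) +
          ENNReal.ofReal (rhoq q (x - y))) * ENNReal.ofReal (f y / Λ) := by
        rw [lintegral_lintegral_swap]
        apply Measurable.aemeasurable
        have hr2 : Measurable fun z : Euc m × Euc m => rhoq q (z.1 - z.2) :=
          hrm.comp (measurable_fst.sub measurable_snd)
        fun_prop
    _ = G + ∫⁻ y in Ω, ENNReal.ofReal D * (G' + R) * ENNReal.ofReal (f y / Λ) := by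
        congr 1
        refine lintegral_congr fun y => ?_
        rw [lintegral_mul_const' _ _ ENNReal.ofReal_ne_top,
          lintegral_const_mul' _ _ ENNReal.ofReal_ne_top, lintegral_add_left hGm']
        have := lintegral_sub_right_eq_self (μ := (volume : Measure (Euc m)))
          (fun z : Euc m => ENNReal.ofReal (rhoq q z)) y
        rw [this]
    _ = T := by
        rw [lintegral_const_mul _ (by fun_prop), hfl, mul_one]

lemma young_log {a b : ℝ} (ha : 0 ≤ a) : b * a ≤ Real.exp b + a * Real.log a := by
  rcases ha.eq_or_lt with h | h
  · rw [← h]; simp; exact (Real.exp_pos _).le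
  · have h1 := Real.add_one_le_exp (b - Real.log a)
    rw [Real.exp_sub, Real.exp_log h, le_div_iff₀ h] at h1
    nlinarith

lemma pot_upper {m : ℕ} (hm : 1 ≤ m) {p δ A Λ Q : ℝ} (hp : 1 < p) (hδ : 0 < δ) (hA : 0 ≤ A) :
    ∃ B : ℝ, 0 ≤ B ∧ ∀ (Ω : Set (Euc m)) (f : Euc m → ℝ), MeasurableSet Ω → Measurable f →
      (∀ y ∈ Ω, 0 ≤ f y) → IntegrableOn f Ω → ∫ y in Ω, f y = Λ → ∀ x, ‖x‖ ≤ A →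
      ∫⁻ y in ball x δ ∩ Ω, ENNReal.ofReal (f y ^ p) ≤ ENNReal.ofReal Q →
      ∫ y in Ω, lker x y * f y ≤ B := by
  set R := ∫⁻ z : Euc m, ENNReal.ofReal (rhoq 1 z) with hR
  have hRt : R < ⊤ := rhoq_lint hm (by
    have : (1:ℝ) ≤ m := by exact_mod_cast hm
    linarith)
  set W := volume (ball (0 : Euc m) δ) with hW
  have hWt : W < ⊤ := measure_ball_lt_top
  set T := ENNReal.ofReal (A + 1 / δ) * ENNReal.ofReal Λ + (ENNReal.ofReal 2 * W + (ENNReal.ofReal 2 * R +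
    ENNReal.ofReal (1 / (p - 1)) * ENNReal.ofReal Q)) with hT
  have hTt : T ≠ ⊤ := by
    rw [hT]
    finiteness
  refine ⟨T.toReal, ENNReal.toReal_nonneg, ?_⟩
  intro Ω f hΩ hfm hf0 hint hI x hx hQ
  have hrm := rhoq_meas (m := m) 1
  by_cases hi : IntegrableOn (fun y => lker x y * f y) Ω
  swap
  · rw [integral_undef hi]; exact ENNReal.toReal_nonneg
  refine (ENNReal.ofReal_le_iff_le_toReal hTt).1 ?_
  refine (ofReal_integral_le_lintegral_aux hi).trans ?_
  have hpt : ∀ y ∈ Ω, ENNReal.ofReal (lker x y * f y) ≤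
      ENNReal.ofReal (A + 1 / δ) * ENNReal.ofReal (f y) + (ball x δ).indicator
        (fun y => ENNReal.ofReal 2 + (ENNReal.ofReal 2 * ENNReal.ofReal (rhoq 1 (x - y)) +
          ENNReal.ofReal (1 / (p - 1)) * ENNReal.ofReal (f y ^ p))) y := by
    intro y hy
    have hf := hf0 y hy
    have h1 : lker x y * f y ≤ (‖x‖ + Real.log (1 + 1 / ‖x - y‖)) * f y :=
      mul_le_mul_of_nonneg_right (ker_le x y) hf
    have hδ' : 0 < 1 / δ := by positivity
    rw [← ENNReal.ofReal_mul (by positivity)]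
    by_cases hb : y ∈ ball x δ
    · rw [Set.indicator_of_mem hb]
      have hr := rhoq_nonneg 1 (x - y)
      have hp1 : 0 < 1 / (p - 1) := by
        have : 0 < p - 1 := by linarith
        positivity
      have hfp : 0 ≤ f y ^ p := Real.rpow_nonneg hf _
      rw [← ENNReal.ofReal_mul (by norm_num), ← ENNReal.ofReal_mul hp1.le,
        ← ENNReal.ofReal_add (by positivity) (by positivity),
        ← ENNReal.ofReal_add (by positivity) (by positivity),
        ← ENNReal.ofReal_add (by positivity) (by positivity)]
      refine ENNReal.ofReal_le_ofReal ?_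
      have h2 := young_log (b := Real.log (1 + 1 / ‖x - y‖)) hf
      rw [Real.exp_log (by positivity)] at h2
      have h3 := one_add_inv_rpow_le (q := 1) (by norm_num) (x - y)
      rw [Real.rpow_one, Real.rpow_one] at h3
      have h4 : f y * Real.log (f y) ≤ 1 / (p - 1) * f y ^ p := by
        rcases hf.eq_or_lt with h | h
        · rw [← h]; simp; positivity
        · have h5 := Real.log_le_rpow_div hf (show 0 < p - 1 by linarith)
          calc _ ≤ f y * (f y ^ (p - 1) / (p - 1)) := mul_le_mul_of_nonneg_left h5 hf
            _ = 1 / (p - 1) * f y ^ p := by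
              rw [Real.rpow_sub_one h.ne']; field_simp
      have h6 : ‖x‖ * f y ≤ (A + 1 / δ) * f y := mul_le_mul_of_nonneg_right (by linarith) hf
      linarith
    · rw [Set.indicator_of_notMem hb, add_zero]
      refine ENNReal.ofReal_le_ofReal (h1.trans ?_)
      refine mul_le_mul_of_nonneg_right ?_ hf
      rw [mem_ball, not_lt, dist_comm, dist_eq_norm] at hb
      have h2 := Real.log_le_sub_one_of_pos (show 0 < 1 + 1 / ‖x - y‖ by positivity)
      have h3 : 1 / ‖x - y‖ ≤ 1 / δ := one_div_le_one_div_of_le hδ hb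
      linarith
  have hrm2 : Measurable fun y : Euc m => rhoq 1 (x - y) := hrm.comp (measurable_const.sub measurable_id)
  have hfl : ∫⁻ y in Ω, ENNReal.ofReal (f y) = ENNReal.ofReal Λ := by
    rw [← hI, ofReal_integral_eq_lintegral_ofReal hint]
    exact (ae_restrict_iff' hΩ).2 (Eventually.of_forall fun y hy => hf0 y hy)
  refine (setLIntegral_mono' hΩ hpt).trans ?_
  rw [lintegral_add_left (by fun_prop), lintegral_const_mul _ (by fun_prop), hfl,
    lintegral_indicator measurableSet_ball, Measure.restrict_restrict measurableSet_ball,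
    lintegral_add_left (by fun_prop), lintegral_add_left (by fun_prop),
    lintegral_const_mul _ (by fun_prop), lintegral_const_mul _ (by fun_prop), lintegral_const]
  rw [hT]
  gcongr
  · rw [Measure.restrict_apply_univ]
    refine (measure_mono inter_subset_left).trans ?_
    rw [hW, Measure.addHaar_ball_center]
  · refine (setLIntegral_le_lintegral _ _).trans ?_
    rw [hR]
    have := lintegral_sub_left_eq_self (μ := (volume : Measure (Euc m)))
          (fun z : Euc m => ENNReal.ofReal (rhoq 1 z)) x
    rw [this]
end

section
open MeasureTheory Real Filter Topology Metric Set Bornology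

lemma c_top_aux {m : ℕ} {Ω : Set (Euc m)} (hΩ : IsOpen Ω) {φ : Euc m → ℝ}
    (hφc : ContinuousOn φ Ω) (hφ0 : ∀ x ∈ Ω, φ x ≤ 0) (hnull : volume (Sphi Ω φ) = 0)
    {n β b Λ p C1 : ℝ} (hn : 0 < n) (hβ : 0 < β) (hb : 0 ≤ b) (hΛ : 0 < Λ) (hp : 1 < p)
    (hC1 : 0 ≤ C1)
    (F I : ℕ → Euc m → ℝ) (c : ℕ → ℝ)
    (hF : ∀ k, ∀ x ∈ Ω, F k x ≤ b * Real.exp (n * (I k x - β * ‖x‖ ^ 2 + k * φ x + c k)))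
    (hFl : ∀ k, ∫⁻ x in Ω, ENNReal.ofReal (F k x) = ENNReal.ofReal Λ)
    (hI : ∀ k, ∫⁻ x, ENNReal.ofReal (Real.exp (-(n * β) * ‖x‖ ^ 2) * Real.exp (n * p * I k x)) ≤
      ENNReal.ofReal C1) :
    Tendsto c atTop atTop := by
  set T : ℕ → ENNReal := fun k => ∫⁻ x in Ω, ENNReal.ofReal
    (Real.exp (-(n * β) * ‖x‖ ^ 2) * Real.exp (n * (k * φ x))) with hTdef
  have hmeas : ∀ k : ℕ, AEMeasurable (fun x => ENNReal.ofReal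
    (Real.exp (-(n * β) * ‖x‖ ^ 2) * Real.exp (n * (k * φ x)))) (volume.restrict Ω) := by
    intro k
    have h1 : AEMeasurable φ (volume.restrict Ω) := hφc.aemeasurable hΩ.measurableSet
    fun_prop
  have hT : Tendsto T atTop (𝓝 0) := by
    have h := tendsto_lintegral_of_dominated_convergence' (μ := volume.restrict Ω)
      (F := fun k : ℕ => fun x => ENNReal.ofReal
        (Real.exp (-(n * β) * ‖x‖ ^ 2) * Real.exp (n * (k * φ x)))) (f := fun _ => 0)
      (fun x => ENNReal.ofReal (Real.exp (-(n * β) * ‖x‖ ^ 2))) hmeas ?_ ?_ ?_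
    · rw [lintegral_zero] at h; exact h
    · intro k
      refine (ae_restrict_iff' hΩ.measurableSet).2 (Eventually.of_forall fun x hx => ?_)
      refine ENNReal.ofReal_le_ofReal ?_
      refine mul_le_of_le_one_right (Real.exp_pos _).le (Real.exp_le_one_iff.2 ?_)
      have : (0:ℝ) ≤ k := by positivity
      exact mul_nonpos_of_nonneg_of_nonpos hn.le (mul_nonpos_of_nonneg_of_nonpos this (hφ0 x hx))
    · exact ((setLIntegral_le_lintegral _ _).trans_lt (gauss_lint (mul_pos hn hβ))).ne
    · refine (ae_restrict_iff' hΩ.measurableSet).2 ?_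
      filter_upwards [measure_eq_zero_iff_ae_notMem.1 hnull] with x hx hxΩ
      have hneg : φ x < 0 := lt_of_le_of_ne (hφ0 x hxΩ) fun h => hx ⟨hxΩ, h⟩
      have h1 : Tendsto (fun k : ℕ => n * ((k : ℝ) * φ x)) atTop atBot :=
        ((tendsto_natCast_atTop_atTop (R := ℝ)).atTop_mul_const_of_neg hneg).const_mul_atBot hn
      have h2 := (Real.tendsto_exp_atBot.comp h1).const_mul (Real.exp (-(n * β) * ‖x‖ ^ 2))
      rw [mul_zero] at h2
      have h3 := ENNReal.tendsto_ofReal h2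
      simpa using h3
  by_contra hc
  rw [Filter.tendsto_atTop] at hc
  push Not at hc
  obtain ⟨C, hC⟩ := hc
  set M := b * Real.exp (n * C) with hM
  have hM0 : 0 ≤ M := by positivity
  set s := 2 * (M * C1) / Λ with hs
  set τ := s / (p - 1) with hτ
  have hp' : 0 < p - 1 := by linarith
  have hsτ : (p - 1) * τ = s := by rw [hτ]; field_simp
  have hsmall : M * C1 * Real.exp (-s) < Λ / 2 := by
    have h1 := Real.add_one_le_exp s
    have h2 : M * C1 = s * (Λ / 2) := by rw [hs]; field_simp
    rw [h2, Real.exp_neg, ← div_eq_mul_inv, div_lt_iff₀ (Real.exp_pos _)]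
    nlinarith
  have hTk : Tendsto (fun k => ENNReal.ofReal (M * Real.exp τ) * T k) atTop (𝓝 0) := by
    have := ENNReal.Tendsto.const_mul (a := ENNReal.ofReal (M * Real.exp τ)) hT
      (Or.inr ENNReal.ofReal_ne_top)
    simpa using this
  have hev := hTk.eventually_lt_const (show (0:ENNReal) < ENNReal.ofReal (Λ/2) by
    simpa using hΛ)
  obtain ⟨k, hk1, hk2⟩ := (hC.and_eventually hev).exists
  have hsplit : ENNReal.ofReal Λ ≤ ENNReal.ofReal (M * Real.exp τ) * T k +
      ENNReal.ofReal (M * Real.exp (-s)) * ENNReal.ofReal C1 := by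
    rw [← hFl k]
    calc ∫⁻ x in Ω, ENNReal.ofReal (F k x) ≤ ∫⁻ x in Ω,
          (ENNReal.ofReal (M * Real.exp τ) * ENNReal.ofReal
            (Real.exp (-(n * β) * ‖x‖ ^ 2) * Real.exp (n * (k * φ x))) +
          ENNReal.ofReal (M * Real.exp (-s)) * ENNReal.ofReal
            (Real.exp (-(n * β) * ‖x‖ ^ 2) * Real.exp (n * p * I k x))) := by
          refine setLIntegral_mono' hΩ.measurableSet fun x hx => ?_
          rw [← ENNReal.ofReal_mul (by positivity), ← ENNReal.ofReal_mul (by positivity),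
            ← ENNReal.ofReal_add (by positivity) (by positivity)]
          refine ENNReal.ofReal_le_ofReal ((hF k x hx).trans ?_)
          have e1 : Real.exp (n * (I k x - β * ‖x‖ ^ 2 + k * φ x + c k)) ≤
              Real.exp (n * C) * (Real.exp (-(n * β) * ‖x‖ ^ 2) *
                (Real.exp (n * (k * φ x)) * Real.exp (n * I k x))) := by
            rw [← Real.exp_add, ← Real.exp_add, ← Real.exp_add]
            refine Real.exp_le_exp.2 ?_
            have : n * c k ≤ n * C := mul_le_mul_of_nonneg_left hk1.le hn.le
            nlinarith
          have e2 : Real.exp (n * (k * φ x)) * Real.exp (n * I k x) ≤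
              Real.exp τ * Real.exp (n * (k * φ x)) + Real.exp (-s) * Real.exp (n * p * I k x) := by
            by_cases hle : n * I k x ≤ τ
            · have h1 := mul_le_mul_of_nonneg_right (Real.exp_le_exp.2 hle)
                (Real.exp_pos (n * (k * φ x))).le
              have h2 : 0 ≤ Real.exp (-s) * Real.exp (n * p * I k x) := by positivity
              linarith
            · have hneg : Real.exp (n * (k * φ x)) ≤ 1 := by
                refine Real.exp_le_one_iff.2 ?_
                have : (0:ℝ) ≤ k := by positivity
                exact mul_nonpos_of_nonneg_of_nonpos hn.le
                  (mul_nonpos_of_nonneg_of_nonpos this (hφ0 x hx))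
              have h1 : Real.exp (n * I k x) ≤ Real.exp (-s) * Real.exp (n * p * I k x) := by
                rw [← Real.exp_add]
                refine Real.exp_le_exp.2 ?_
                push Not at hle
                have := mul_le_mul_of_nonneg_left hle.le hp'.le
                nlinarith
              have h2 : 0 ≤ Real.exp τ * Real.exp (n * (k * φ x)) := by positivity
              have h3 := mul_le_mul_of_nonneg_right hneg (Real.exp_pos (n * I k x)).le
              linarith
          calc _ ≤ b * (Real.exp (n * C) * (Real.exp (-(n * β) * ‖x‖ ^ 2) *
                (Real.exp (n * (k * φ x)) * Real.exp (n * I k x)))) :=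
                mul_le_mul_of_nonneg_left e1 hb
            _ ≤ b * (Real.exp (n * C) * (Real.exp (-(n * β) * ‖x‖ ^ 2) *
                (Real.exp τ * Real.exp (n * (k * φ x)) + Real.exp (-s) * Real.exp (n * p * I k x)))) := by
                gcongr
            _ = _ := by rw [hM]; ring
      _ = ENNReal.ofReal (M * Real.exp τ) * T k + ENNReal.ofReal (M * Real.exp (-s)) *
          ∫⁻ x in Ω, ENNReal.ofReal
            (Real.exp (-(n * β) * ‖x‖ ^ 2) * Real.exp (n * p * I k x)) := by
          rw [lintegral_add_left' ((hmeas k).const_mul _),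
            lintegral_const_mul' _ _ ENNReal.ofReal_ne_top,
            lintegral_const_mul' _ _ ENNReal.ofReal_ne_top]
      _ ≤ _ := by
          gcongr
          exact (setLIntegral_le_lintegral _ _).trans (hI k)
  rw [← ENNReal.ofReal_mul (by positivity)] at hsplit
  have hlt : ENNReal.ofReal (M * Real.exp τ) * T k + ENNReal.ofReal (M * Real.exp (-s) * C1) <
      ENNReal.ofReal (Λ/2) + ENNReal.ofReal (Λ/2) := by
    refine ENNReal.add_lt_add hk2 ?_
    rw [ENNReal.ofReal_lt_ofReal_iff (by linarith)]
    linarith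
  rw [← ENNReal.ofReal_add (by linarith) (by linarith), add_halves] at hlt
  exact absurd hsplit (not_le.2 hlt)

lemma c_small_aux {m : ℕ} {Ω : Set (Euc m)} (hΩ : IsOpen Ω) {φ : Euc m → ℝ} {x₀ : Euc m}
    (hx₀ : Tendsto φ (𝓝[Ω] x₀) (𝓝 0))
    {n β b Λ L : ℝ} (hn : 0 < n) (hβ : 0 < β) (hL : 0 ≤ L)
    (V u : ℕ → Euc m → ℝ) (c : ℕ → ℝ) (hVm : ∀ k, Measurable (V k))
    (hVbd : ∀ k, ∀ x ∈ Ω, 0 ≤ V k x ∧ V k x ≤ b)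
    (hliminf : ∀ ε : ℝ, 0 < ε →
      0 < liminf (fun k => ∫ x in ball x₀ ε ∩ Ω, V k x) atTop)
    (hint : ∀ k, IntegrableOn (fun y => V k y * Real.exp (n * u k y)) Ω)
    (hvol : ∀ k, ∫ y in Ω, V k y * Real.exp (n * u k y) = Λ)
    (hu : ∀ k, ∀ x ∈ Ω, -(L * ‖x‖) - β * ‖x‖ ^ 2 + k * φ x + c k ≤ u k x)
    (hc : Tendsto c atTop atTop) : Tendsto (fun k => c k / (k : ℝ)) atTop (𝓝 0) := by
  rw [Metric.tendsto_atTop']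
  by_contra hcon
  push Not at hcon
  obtain ⟨ε, hε, hN⟩ := hcon
  have hfreq : ∃ᶠ k in atTop, ε * k ≤ c k := by
    have hpos : ∀ᶠ k in atTop, 0 ≤ c k := hc.eventually_ge_atTop 0
    have hf : ∃ᶠ k : ℕ in atTop, 0 < k ∧ ε ≤ dist (c k / k) 0 := by
      rw [frequently_atTop]
      intro a
      obtain ⟨k, hk, h⟩ := hN a
      exact ⟨k, by omega, by omega, h⟩
    refine (hf.and_eventually hpos).mono fun k hk => ?_
    obtain ⟨⟨hk0, hk⟩, hck⟩ := hk
    have hk0' : (0:ℝ) < k := by exact_mod_cast hk0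
    rw [dist_zero_right, Real.norm_of_nonneg (by positivity), le_div_iff₀ hk0'] at hk
    exact hk
  have h1 : ∀ᶠ x in 𝓝[Ω] x₀, -(ε/2) < φ x := hx₀.eventually_const_lt (by linarith)
  rw [eventually_nhdsWithin_iff, Metric.eventually_nhds_iff_ball] at h1
  obtain ⟨δ0, hδ0, h1⟩ := h1
  set δ := min δ0 1 with hδ
  have hδpos : 0 < δ := lt_min hδ0 one_pos
  set M := L * (‖x₀‖ + 1) + β * (‖x₀‖ + 1) ^ 2 with hM
  set S := ball x₀ δ ∩ Ω with hS
  have hSm : MeasurableSet S := measurableSet_ball.inter hΩ.measurableSet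
  have hSfin : volume S < ⊤ := (measure_mono inter_subset_left).trans_lt measure_ball_lt_top
  have hVi : ∀ k, IntegrableOn (V k) S := by
    intro k
    refine Measure.integrableOn_of_bounded (M := b) hSfin.ne (hVm k).aestronglyMeasurable ?_
    refine (ae_restrict_iff' hSm).2 (Eventually.of_forall fun x hx => ?_)
    rw [Real.norm_of_nonneg (hVbd k x hx.2).1]
    exact (hVbd k x hx.2).2
  have hl := hliminf δ hδpos
  set v := liminf (fun k => ∫ x in S, V k x) atTop with hv
  have hev : ∀ᶠ k in atTop, v / 2 < ∫ x in S, V k x := by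
    refine eventually_lt_of_lt_liminf (by linarith) ?_
    refine ⟨0, ?_⟩
    rw [eventually_map]
    exact Eventually.of_forall fun k => setIntegral_nonneg hSm fun x hx => (hVbd k x hx.2).1
  have hbig : ∀ᶠ k : ℕ in atTop, Λ < Real.exp (n * (-M + ε / 2 * k)) * (v / 2) := by
    have t1 : Tendsto (fun k : ℕ => n * (-M + ε / 2 * (k:ℝ))) atTop atTop :=
      (tendsto_atTop_add_const_left _ _
        ((tendsto_natCast_atTop_atTop (R := ℝ)).const_mul_atTop (half_pos hε))).const_mul_atTop hn
    have t2 := (Real.tendsto_exp_atTop.comp t1).atTop_mul_const (half_pos hl)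
    exact t2.eventually_gt_atTop Λ
  obtain ⟨k, hk, hk1, hk2⟩ := (hfreq.and_eventually (hev.and hbig)).exists
  have hle : Real.exp (n * (-M + ε / 2 * k)) * ∫ x in S, V k x ≤ Λ := by
    rw [← hvol k, ← integral_const_mul]
    refine (setIntegral_mono_on ((hVi k).const_mul _) ((hint k).mono_set inter_subset_right)
      hSm ?_).trans (setIntegral_mono_set (hint k) ?_ ?_)
    · intro x hx
      rw [mul_comm]
      refine mul_le_mul_of_nonneg_left ?_ (hVbd k x hx.2).1
      refine Real.exp_le_exp.2 (mul_le_mul_of_nonneg_left ?_ hn.le)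
      refine le_trans ?_ (hu k x hx.2)
      have hxd : dist x x₀ < δ := hx.1
      have hφx := h1 x (lt_of_lt_of_le hxd (min_le_left _ _)) hx.2
      have hnx : ‖x‖ ≤ ‖x₀‖ + 1 := by
        have a1 : dist x x₀ < 1 := lt_of_lt_of_le hxd (min_le_right _ _)
        rw [dist_eq_norm] at a1
        have := norm_sub_norm_le x x₀
        linarith
      have a2 : L * ‖x‖ ≤ L * (‖x₀‖ + 1) := mul_le_mul_of_nonneg_left hnx hL
      have a3 : β * ‖x‖ ^ 2 ≤ β * (‖x₀‖ + 1) ^ 2 := by gcongr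
      have a4 : (k:ℝ) * (-(ε/2)) ≤ k * φ x := mul_le_mul_of_nonneg_left hφx.le (by positivity)
      rw [hM]
      linarith
    · exact (ae_restrict_iff' hΩ.measurableSet).2 (Eventually.of_forall fun x hx =>
        mul_nonneg (hVbd k x hx).1 (Real.exp_pos _).le)
    · exact LE.le.eventuallyLE inter_subset_right
  have := mul_le_mul_of_nonneg_left hk1.le (Real.exp_pos (n * (-M + ε / 2 * k))).le
  linarith

lemma compact_eta {m : ℕ} {Ω : Set (Euc m)} (hΩ : IsOpen Ω) {φ : Euc m → ℝ}
    (hφc : ContinuousOn φ Ω) (hφ0 : ∀ x ∈ Ω, φ x ≤ 0) {K : Set (Euc m)}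
    (hK : K ⊆ Ω \ Sphi Ω φ) (hKc : IsCompact K) :
    ∃ δ > 0, ∃ η > 0, ∀ x ∈ K, ∀ y ∈ ball x δ, y ∈ Ω ∧ φ y ≤ -η := by
  have hU : IsOpen (Ω ∩ φ ⁻¹' {0}ᶜ) := hφc.isOpen_inter_preimage hΩ isOpen_compl_singleton
  have hKU : K ⊆ Ω ∩ φ ⁻¹' {0}ᶜ := fun x hx => ⟨(hK hx).1, fun h => (hK hx).2 ⟨(hK hx).1, h⟩⟩
  obtain ⟨δ, hδ, hsub⟩ := hKc.exists_cthickening_subset_open hU hKU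
  have hcc : IsCompact (cthickening δ K) := hKc.cthickening
  have hmem : ∀ x ∈ K, ∀ y ∈ ball x δ, y ∈ cthickening δ K := by
    intro x hx y hy
    exact mem_cthickening_of_dist_le y x δ K hx (le_of_lt hy)
  by_cases hne : (cthickening δ K).Nonempty
  · obtain ⟨z, hz, hmax⟩ := hcc.exists_isMaxOn hne (hφc.mono (hsub.trans inter_subset_left))
    have hzz := hsub hz
    have hneg : φ z < 0 := lt_of_le_of_ne (hφ0 z hzz.1) hzz.2
    refine ⟨δ, hδ, -φ z, by linarith, fun x hx y hy => ?_⟩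
    have hy' := hmem x hx y hy
    refine ⟨(hsub hy').1, ?_⟩
    rw [neg_neg]
    exact hmax hy'
  · refine ⟨δ, hδ, 1, one_pos, fun x hx y hy => ?_⟩
    exact absurd ⟨y, hmem x hx y hy⟩ hne

lemma c_sub_bdd {c : ℕ → ℝ} (hc : Tendsto (fun k => c k / (k : ℝ)) atTop (𝓝 0)) {η : ℝ} (hη : 0 < η) :
    Tendsto (fun k : ℕ => c k - k * η) atTop atBot := by
  have h1 : ∀ᶠ k : ℕ in atTop, c k - k * η ≤ -(η / 2) * k := by
    filter_upwards [hc.eventually_lt_const (half_pos hη), eventually_gt_atTop 0] with k hk hk0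
    have : (0:ℝ) < k := by exact_mod_cast hk0
    rw [div_lt_iff₀ this] at hk
    linarith
  refine tendsto_atBot_mono' _ h1 ?_
  exact (tendsto_natCast_atTop_atTop (R := ℝ)).const_mul_atTop_of_neg (by linarith)
end

/-- **Lemma (behaviour of solutions of the integral equation).** Suppose `u_k` solves
`u_k(x) = γ_{2m}⁻¹ ∫_Ω log((1+|y|)/|x−y|) V_k(y) e^{2m u_k(y)} dy − β|x|² + kφ(x) + c_k`
on `Ω ∪ S_φ^*` (with `kφ(x)` replaced by its boundary value `0` on `S_φ^* \ Ω`), with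
`∫_Ω V_k e^{2m u_k} dy = Λ < Λ₁/2`. Then `c_k → ∞`, `c_k = o(k)`, the potentials `I_k`
are uniformly bounded above on compact subsets of `Ω \ S_φ` and below on compact subsets
of `ℝ^{2m}`, `u_k → +∞` on `S_φ^*` and `u_k → −∞` locally uniformly on `Ω \ S_φ`. -/
theorem statement10 (m : ℕ) (hm : 1 ≤ m) (Ω : Set (Euc m)) (hΩopen : IsOpen Ω)
    (hΩconn : IsConnected Ω)
    (φ : Euc m → ℝ) (hφ : memK Ω φ)
    (β : ℝ) (hβ : 0 < β)
    (Λ : ℝ) (hΛpos : 0 < Λ) (hΛlt : Λ < Lambda1 m / 2)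
    (V : ℕ → Euc m → ℝ) (hVmeas : ∀ k, Measurable (V k))
    (b : ℝ) (hVbd : ∀ k, ∀ x ∈ Ω, 0 ≤ V k x ∧ V k x ≤ b)
    (x₀ : Euc m) (hx₀ : x₀ ∈ SphiStar Ω φ)
    (hliminf : ∀ ε : ℝ, 0 < ε →
      0 < liminf (fun k => ∫ x in ball x₀ ε ∩ Ω, V k x) atTop)
    (u : ℕ → Euc m → ℝ) (humeas : ∀ k, Measurable (u k)) (c : ℕ → ℝ)
    (hint : ∀ k, IntegrableOn (fun y => V k y * Real.exp ((2*m : ℝ) * u k y)) Ω)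
    (heq : ∀ k, ∀ x ∈ Ω, u k x =
      (1 / gamma2m m) *
        (∫ y in Ω, Real.log ((1 + ‖y‖) / ‖x - y‖) * (V k y * Real.exp ((2*m : ℝ) * u k y)))
      - β * ‖x‖^2 + (k : ℝ) * φ x + c k)
    (heq' : ∀ k, ∀ x ∈ SphiStar Ω φ \ Ω, u k x =
      (1 / gamma2m m) *
        (∫ y in Ω, Real.log ((1 + ‖y‖) / ‖x - y‖) * (V k y * Real.exp ((2*m : ℝ) * u k y)))
      - β * ‖x‖^2 + c k)
    (hvol : ∀ k, ∫ y in Ω, V k y * Real.exp ((2*m : ℝ) * u k y) = Λ) :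
    Tendsto c atTop atTop ∧
    Tendsto (fun k => c k / (k : ℝ)) atTop (𝓝 0) ∧
    (∀ K : Set (Euc m), K ⊆ Ω \ Sphi Ω φ → IsCompact K → ∃ C : ℝ, ∀ k, ∀ x ∈ K,
      (1 / gamma2m m) *
        (∫ y in Ω, Real.log ((1 + ‖y‖) / ‖x - y‖) * (V k y * Real.exp ((2*m : ℝ) * u k y)))
        ≤ C) ∧
    (∀ K : Set (Euc m), IsCompact K → ∃ C : ℝ, ∀ k, ∀ x ∈ K,
      C ≤ (1 / gamma2m m) *
        (∫ y in Ω, Real.log ((1 + ‖y‖) / ‖x - y‖) * (V k y * Real.exp ((2*m : ℝ) * u k y)))) ∧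
    (∀ x ∈ SphiStar Ω φ, Tendsto (fun k => u k x) atTop atTop) ∧
    LocUnifBot u (Ω \ Sphi Ω φ) := by
  set F : ℕ → Euc m → ℝ := fun k y => V k y * Real.exp ((2*m : ℝ) * u k y) with hFdef
  set I : ℕ → Euc m → ℝ := fun k x => (1 / gamma2m m) * ∫ y in Ω, lker x y * F k y with hIdef
  have heqI : ∀ k, ∀ x ∈ Ω, u k x = I k x - β * ‖x‖^2 + (k : ℝ) * φ x + c k := heq
  have heqJ : ∀ k, ∀ x ∈ SphiStar Ω φ \ Ω, u k x = I k x - β * ‖x‖^2 + c k := heq'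
  have hint : ∀ k, IntegrableOn (F k) Ω := hint
  have hvol : ∀ k, ∫ y in Ω, F k y = Λ := hvol
  change Tendsto c atTop atTop ∧
    Tendsto (fun k => c k / (k : ℝ)) atTop (𝓝 0) ∧
    (∀ K : Set (Euc m), K ⊆ Ω \ Sphi Ω φ → IsCompact K → ∃ C : ℝ, ∀ k, ∀ x ∈ K, I k x ≤ C) ∧
    (∀ K : Set (Euc m), IsCompact K → ∃ C : ℝ, ∀ k, ∀ x ∈ K, C ≤ I k x) ∧
    (∀ x ∈ SphiStar Ω φ, Tendsto (fun k => u k x) atTop atTop) ∧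
    LocUnifBot u (Ω \ Sphi Ω φ)
  have hm1 : (1:ℝ) ≤ m := by exact_mod_cast hm
  have hn : (0:ℝ) < 2 * m := by linarith
  have hΩm := hΩopen.measurableSet
  have hγ : Λ < gamma2m m := hΛlt
  have hγ0 : 0 < gamma2m m := hΛpos.trans hγ
  set γ := gamma2m m with hγdef
  have hb : 0 ≤ b := by
    obtain ⟨x, hx⟩ := hΩconn.nonempty
    exact (hVbd 0 x hx).1.trans (hVbd 0 x hx).2
  have hF0 : ∀ k, ∀ y ∈ Ω, 0 ≤ F k y := fun k y hy =>
    mul_nonneg (hVbd k y hy).1 (Real.exp_pos _).le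
  have hFm : ∀ k, Measurable (F k) := fun k =>
    (hVmeas k).mul (((humeas k).const_mul _).exp)
  have hφc : ContinuousOn φ Ω := hφ.1.continuousOn
  have hφ0 := hφ.2.1
  have hnull := null_Sphi hΩopen hΩconn hφ
  have hFle : ∀ k, ∀ x ∈ Ω, F k x ≤
      b * Real.exp ((2*m:ℝ) * (I k x - β * ‖x‖ ^ 2 + k * φ x + c k)) := by
    intro k x hx
    rw [← heqI k x hx]
    exact mul_le_mul_of_nonneg_right (hVbd k x hx).2 (Real.exp_pos _).le
  have hFl : ∀ k, ∫⁻ x in Ω, ENNReal.ofReal (F k x) = ENNReal.ofReal Λ := by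
    intro k
    rw [← hvol k, ofReal_integral_eq_lintegral_ofReal (hint k)]
    exact (ae_restrict_iff' hΩm).2 (Eventually.of_forall fun y hy => hF0 k y hy)
  -- exponent
  set p : ℝ := (1 + γ / Λ) / 2 with hp
  have hγΛ : 1 < γ / Λ := by rw [lt_div_iff₀ hΛpos]; linarith
  have hp1 : 1 < p := by rw [hp]; linarith
  set q : ℝ := 2 * m * p * Λ / γ with hq
  have hq0 : 0 ≤ q := by rw [hq]; positivity
  have hqlt : q < 2 * m := by
    have : p * Λ < γ := by
      have e : p * Λ = (Λ + γ) / 2 := by rw [hp]; field_simp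
      rw [e]; linarith
    rw [hq, div_lt_iff₀ hγ0]
    nlinarith
  obtain ⟨C1, hC1, hexp⟩ := expint hm (δ := 2 * m * β) (mul_pos hn hβ) hq0 hqlt hΛpos
  have hI : ∀ k, ∫⁻ x, ENNReal.ofReal (Real.exp (-(2 * m * β) * ‖x‖ ^ 2) *
      Real.exp (2 * m * p * I k x)) ≤ ENNReal.ofReal C1 := by
    intro k
    have h := hexp Ω (F k) hΩm (hFm k) (hF0 k) (hint k) (hvol k)
    refine le_of_eq_of_le (lintegral_congr fun x => ?_) h
    congr 3
    rw [hIdef, hq]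
    field_simp
  have hctop : Tendsto c atTop atTop :=
    c_top_aux hΩopen hφc hφ0 hnull hn hβ hb hΛpos hp1 hC1 F I c hFle hFl hI
  -- lower bound
  have hlow : ∀ k x, -(Λ / γ * ‖x‖) ≤ I k x := by
    intro k x
    have h := pot_lower hΩm (hF0 k) (hint k) x
    rw [hvol k] at h
    have h2 := mul_le_mul_of_nonneg_left h (one_div_pos.2 hγ0).le
    refine le_trans (le_of_eq ?_) h2
    field_simp
  have hx₀' : Tendsto φ (𝓝[Ω] x₀) (𝓝 0) := by
    rcases hx₀ with h | h
    · have := hφc x₀ h.1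
      rw [ContinuousWithinAt, h.2] at this
      exact this
    · exact h.2
  have hcsm : Tendsto (fun k => c k / (k : ℝ)) atTop (𝓝 0) :=
    c_small_aux hΩopen hx₀' hn hβ (div_nonneg hΛpos.le hγ0.le) V u c hVmeas hVbd hliminf hint hvol
      (fun k x hx => by rw [heqI k x hx]; linarith [hlow k x]) hctop
  have hup : ∀ K : Set (Euc m), K ⊆ Ω \ Sphi Ω φ → IsCompact K →
      ∃ C : ℝ, ∀ k, ∀ x ∈ K, I k x ≤ C := by
    intro K hK hKc
    obtain ⟨δ, hδ, η, hη, hball⟩ := compact_eta hΩopen hφc hφ0 hK hKc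
    obtain ⟨C', hC'⟩ := (c_sub_bdd hcsm hη).isBoundedUnder_le_atBot.bddAbove_range
    obtain ⟨A, hA0, hA⟩ := hKc.isBounded.exists_pos_norm_le
    obtain ⟨B, hB0, hB⟩ := pot_upper (m := m) hm (p := p) (δ := δ) (A := A) (Λ := Λ)
      (Q := (b * Real.exp (2 * m * C')) ^ p * C1) hp1 hδ hA0.le
    refine ⟨1 / γ * B, fun k x hx => ?_⟩
    refine mul_le_mul_of_nonneg_left ?_ (one_div_pos.2 hγ0).le
    refine hB Ω (F k) hΩm (hFm k) (hF0 k) (hint k) (hvol k) x (hA x hx) ?_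
    rw [ENNReal.ofReal_mul (by positivity)]
    calc ∫⁻ y in ball x δ ∩ Ω, ENNReal.ofReal (F k y ^ p) ≤
          ∫⁻ y in ball x δ ∩ Ω, ENNReal.ofReal ((b * Real.exp (2 * m * C')) ^ p) *
            ENNReal.ofReal (Real.exp (-(2 * m * β) * ‖y‖ ^ 2) * Real.exp (2 * m * p * I k y)) := by
          refine setLIntegral_mono' (measurableSet_ball.inter hΩm) fun y hy => ?_
          rw [← ENNReal.ofReal_mul (by positivity)]
          refine ENNReal.ofReal_le_ofReal ?_
          have hy2 := (hball x hx y hy.1).2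
          have hck : c k - k * η ≤ C' := hC' ⟨k, rfl⟩
          have h1 : F k y ≤ (b * Real.exp (2 * m * C')) * Real.exp (2 * m * (I k y - β * ‖y‖ ^ 2)) := by
            refine (hFle k y hy.2).trans ?_
            rw [mul_assoc b, ← Real.exp_add]
            refine mul_le_mul_of_nonneg_left (Real.exp_le_exp.2 ?_) hb
            rw [← mul_add]
            refine mul_le_mul_of_nonneg_left ?_ hn.le
            have : (k:ℝ) * φ y ≤ k * (-η) := mul_le_mul_of_nonneg_left hy2 (by positivity)
            linarith
          refine (Real.rpow_le_rpow (hF0 k y hy.2) h1 (by linarith)).trans ?_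
          rw [Real.mul_rpow (by positivity) (by positivity)]
          refine mul_le_mul_of_nonneg_left ?_ (by positivity)
          rw [← Real.exp_mul, ← Real.exp_add]
          refine Real.exp_le_exp.2 ?_
          have h3 : 0 ≤ 2 * m * β * ‖y‖ ^ 2 * (p - 1) := by
            have : 0 ≤ p - 1 := by linarith
            positivity
          nlinarith
      _ = ENNReal.ofReal ((b * Real.exp (2 * m * C')) ^ p) * ∫⁻ y in ball x δ ∩ Ω,
            ENNReal.ofReal (Real.exp (-(2 * m * β) * ‖y‖ ^ 2) * Real.exp (2 * m * p * I k y)) :=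
          lintegral_const_mul' _ _ ENNReal.ofReal_ne_top
      _ ≤ _ := by
          gcongr
          exact (setLIntegral_le_lintegral _ _).trans (hI k)
  refine ⟨hctop, hcsm, hup, ?_, ?_, ?_⟩
  · intro K hK
    obtain ⟨A, hA0, hA⟩ := hK.isBounded.exists_pos_norm_le
    refine ⟨-(Λ / γ * A), fun k x hx => le_trans ?_ (hlow k x)⟩
    have : 0 ≤ Λ / γ := div_nonneg hΛpos.le hγ0.le
    have := mul_le_mul_of_nonneg_left (hA x hx) this
    linarith
  · intro x hx
    have hux : ∀ k, u k x = I k x - β * ‖x‖ ^ 2 + c k := by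
      intro k
      by_cases hxΩ : x ∈ Ω
      · have hφx : φ x = 0 := by
          rcases hx with h | h
          · exact h.2
          · have h1 := h.1
            rw [hΩopen.frontier_eq] at h1
            exact absurd hxΩ h1.2
        rw [heqI k x hxΩ, hφx]; ring
      · exact heqJ k x ⟨hx, hxΩ⟩
    refine tendsto_atTop_mono (f := fun k => (-(Λ / γ * ‖x‖) - β * ‖x‖ ^ 2) + c k) ?_
      (tendsto_atTop_add_const_left _ _ hctop)
    intro k
    rw [hux k]
    linarith [hlow k x]
  · intro K hK hKc C
    obtain ⟨δ, hδ, η, hη, hball⟩ := compact_eta hΩopen hφc hφ0 hK hKc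
    obtain ⟨B, hB⟩ := hup K hK hKc
    filter_upwards [(c_sub_bdd hcsm hη).eventually_le_atBot (C - B)] with k hk x hx
    rw [heqI k x (hK hx).1]
    have h1 := (hball x hx x (mem_ball_self hδ)).2
    have h2 : (k:ℝ) * φ x ≤ k * (-η) := mul_le_mul_of_nonneg_left h1 (by positivity)
    have h3 := hB k x hx
    have h4 : 0 ≤ β * ‖x‖ ^ 2 := by positivity
    linarith
end
end
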